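/- Existence of Gaussian multiplicative chaos: Let D ⊆ ℝ^d be nonempty open and f : D → [0,∞) be Lebesgue-integrable. There exists a random Radon measure M on D (a measurable map from Ω to the Borel measures on D) such that for every continuous compactly supported φ : D → ℝ, ∫_D φ dM_ε converges in probability to ∫_D φ dM as ε → 0. Moreover, if f(x) > 0 for Lebesgue-almost every x ∈ D, then: if 0 < γ < √(2d) the measure M is nonzero almost surely, while if γ ≥ √(2d) then M = 0 almost surely. -/

import Mathlib

open MeasureTheory ProbabilityTheory Filter Topology
open scoped ENNReal NNReal

noncomputable section

variable {d : ℕ}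

/-- The rescaled mollifier `θ_ε(x) = ε^{-d} θ(x/ε)`. -/
def mollifierScaled (θ : EuclideanSpace ℝ (Fin d) → ℝ) (ε : ℝ)
    (x : EuclideanSpace ℝ (Fin d)) : ℝ :=
  (ε ^ d)⁻¹ * θ (ε⁻¹ • x)

/-- A nonnegative smooth mollifier: `C^∞`, compactly supported, nonnegative, total integral 1. -/
def IsMollifier (θ : EuclideanSpace ℝ (Fin d) → ℝ) : Prop :=
  ContDiff ℝ (⊤ : ℕ∞) θ ∧ HasCompactSupport θ ∧ (∀ x, 0 ≤ θ x) ∧ (∫ x, θ x) = 1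

/-- The kernel of log-type associated to `g`: `K(x,y) = ln₊(1/|x-y|) + g(x,y)` where
`ln₊ u = max (ln u) 0`. -/
def logKernel (g : EuclideanSpace ℝ (Fin d) → EuclideanSpace ℝ (Fin d) → ℝ)
    (x y : EuclideanSpace ℝ (Fin d)) : ℝ :=
  max (Real.log (dist x y)⁻¹) 0 + g x y

/-- `g` is bounded and (jointly) measurable. -/
def IsBoundedMeasurable (g : EuclideanSpace ℝ (Fin d) → EuclideanSpace ℝ (Fin d) → ℝ) : Prop :=
  Measurable (Function.uncurry g) ∧ ∃ C, ∀ x y, |g x y| ≤ C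

/-- The mollified covariance `K_{ε,ε'}(x,y) = ∫∫ θ₁_ε(u) θ₂_{ε'}(v) K(x-u, y-v) du dv`. -/
def mollifiedCov (K : EuclideanSpace ℝ (Fin d) → EuclideanSpace ℝ (Fin d) → ℝ)
    (θ₁ θ₂ : EuclideanSpace ℝ (Fin d) → ℝ) (ε ε' : ℝ)
    (x y : EuclideanSpace ℝ (Fin d)) : ℝ :=
  ∫ u, ∫ v, mollifierScaled θ₁ ε u * mollifierScaled θ₂ ε' v * K (x - u) (y - v)

/-- `X = (X(ε,x))` is a jointly measurable family whose finite-dimensional distributions are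
centered Gaussian with covariance `E[X(ε,x) X(ε',y)] = Km ε ε' x y` (expressed by requiring
every finite real linear combination to have the appropriate centered Gaussian law). -/
def IsGaussianFamily {Ω : Type*} [MeasurableSpace Ω] (P : Measure Ω)
    (X : ℝ → EuclideanSpace ℝ (Fin d) → Ω → ℝ)
    (Km : ℝ → ℝ → EuclideanSpace ℝ (Fin d) → EuclideanSpace ℝ (Fin d) → ℝ) : Prop :=
  (Measurable fun p : ℝ × EuclideanSpace ℝ (Fin d) × Ω => X p.1 p.2.1 p.2.2) ∧
  ∀ (n : ℕ) (ε : Fin n → ℝ) (x : Fin n → EuclideanSpace ℝ (Fin d)),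
    (∀ i, ε i ∈ Set.Ioc (0 : ℝ) 1) → ∀ l : Fin n → ℝ, ∃ v : ℝ≥0,
      (v : ℝ) = ∑ i, ∑ j, l i * l j * Km (ε i) (ε j) (x i) (x j) ∧
      Measure.map (fun ω => ∑ i, l i * X (ε i) (x i) ω) P = gaussianReal 0 v

/-- The approximate Gaussian multiplicative chaos measure
`M_ε(A) = ∫_A exp(γ X(ε,x) - (γ²/2) Km ε ε x x) f(x) dx`. -/
def approxGMC {Ω : Type*} (γ : ℝ) (X : ℝ → EuclideanSpace ℝ (Fin d) → Ω → ℝ)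
    (Km : ℝ → ℝ → EuclideanSpace ℝ (Fin d) → EuclideanSpace ℝ (Fin d) → ℝ)
    (f : EuclideanSpace ℝ (Fin d) → ℝ) (ε : ℝ) (ω : Ω)
    (A : Set (EuclideanSpace ℝ (Fin d))) : ℝ :=
  ∫ x in A, Real.exp (γ * X ε x ω - γ ^ 2 / 2 * Km ε ε x x) * f x

/-- `M` is the Gaussian multiplicative chaos measure on `D`: a random Radon measure on `D`
such that `M_ε(A) → M(A)` in probability as `ε → 0` for every Borel `A` with compact closure
contained in `D`. -/
def IsGMCMeasure {Ω : Type*} [MeasurableSpace Ω] (P : Measure Ω) (γ : ℝ)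
    (X : ℝ → EuclideanSpace ℝ (Fin d) → Ω → ℝ)
    (Km : ℝ → ℝ → EuclideanSpace ℝ (Fin d) → EuclideanSpace ℝ (Fin d) → ℝ)
    (f : EuclideanSpace ℝ (Fin d) → ℝ) (D : Set (EuclideanSpace ℝ (Fin d)))
    (M : Ω → Measure (EuclideanSpace ℝ (Fin d))) : Prop :=
  (∀ A : Set (EuclideanSpace ℝ (Fin d)), MeasurableSet A → Measurable fun ω => M ω A) ∧
  (∀ ω, ∀ A : Set (EuclideanSpace ℝ (Fin d)), IsCompact (closure A) → closure A ⊆ D →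
    M ω A ≠ ⊤) ∧
  (∀ A : Set (EuclideanSpace ℝ (Fin d)), MeasurableSet A → IsCompact (closure A) →
    closure A ⊆ D →
    TendstoInMeasure P (fun ε ω => approxGMC γ X Km f ε ω A) (𝓝[Set.Ioc (0 : ℝ) 1] 0)
      fun ω => (M ω A).toReal)

/-- Lebesgue differentiation for general bounded compactly supported approximate identities. -/
theorem ae_tendsto_integral_mollify {V : Type*} [NormedAddCommGroup V] [NormedSpace ℝ V]
    [FiniteDimensional ℝ V] [MeasurableSpace V] [BorelSpace V] (μ : Measure V)
    [μ.IsAddHaarMeasure] {ρ : V → ℝ} {R B : ℝ} (hρ : Continuous ρ) (hR : 0 < R)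
    (hsupp : ∀ u, R < ‖u‖ → ρ u = 0) (hB : ∀ u, |ρ u| ≤ B) (hint : ∫ u, ρ u ∂μ = 1)
    {h : V → ℝ} (hh : LocallyIntegrable h μ) :
    ∀ᵐ x ∂μ, Tendsto (fun ε : ℝ =>
      ∫ u, (ε ^ Module.finrank ℝ V)⁻¹ * ρ (ε⁻¹ • u) * h (x - u) ∂μ) (𝓝[>] 0) (𝓝 (h x)) := by
  set D := Module.finrank ℝ V
  have hB0 : 0 ≤ B := (abs_nonneg _).trans (hB 0)
  filter_upwards [IsUnifLocDoublingMeasure.ae_tendsto_average_norm_sub μ hh 1] with x hx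
  have hlim : Tendsto (fun ε : ℝ => ⨍ y in Metric.closedBall x (R * ε), ‖h y - h x‖ ∂μ)
      (𝓝[>] 0) (𝓝 0) := by
    refine hx (fun _ => x) (fun ε => R * ε) ?_ ?_
    · refine tendsto_nhdsWithin_iff.2 ⟨?_, ?_⟩
      · have : Tendsto (fun ε : ℝ => R * ε) (𝓝 0) (𝓝 (R * 0)) := by
          exact (continuous_const.mul continuous_id).tendsto 0
        rw [mul_zero] at this
        exact this.mono_left nhdsWithin_le_nhds
      · filter_upwards [self_mem_nhdsWithin] with ε hε using mul_pos hR hε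
    · filter_upwards [self_mem_nhdsWithin] with ε hε
      simp only [one_mul, Metric.mem_closedBall, dist_self]
      exact (mul_pos hR hε).le
  have hlim2 : Tendsto (fun ε : ℝ => B * (R ^ D * μ.real (Metric.ball (0 : V) 1)) *
      ⨍ y in Metric.closedBall x (R * ε), ‖h y - h x‖ ∂μ) (𝓝[>] 0) (𝓝 0) := by
    simpa using hlim.const_mul (B * (R ^ D * μ.real (Metric.ball (0 : V) 1)))
  rw [tendsto_iff_norm_sub_tendsto_zero]
  refine squeeze_zero' (Eventually.of_forall fun _ => norm_nonneg _) ?_ hlim2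
  filter_upwards [self_mem_nhdsWithin] with ε (hε : 0 < ε)
  have hεD : 0 < ε ^ D := pow_pos hε _
  set k : V → ℝ := fun u => (ε ^ D)⁻¹ * ρ (ε⁻¹ • u) with hk
  have hkc : Continuous k := by fun_prop
  have hksupp : ∀ u, u ∉ Metric.closedBall (0 : V) (R * ε) → k u = 0 := by
    intro u hu
    simp only [Metric.mem_closedBall, dist_zero_right, not_le] at hu
    have : R < ‖ε⁻¹ • u‖ := by
      rw [norm_smul, Real.norm_of_nonneg (inv_nonneg.2 hε.le), inv_mul_eq_div, lt_div_iff₀ hε]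
      exact hu
    simp [hk, hsupp _ this]
  have hkB : ∀ u, ‖k u‖ ≤ (ε ^ D)⁻¹ * B := by
    intro u
    rw [hk, Real.norm_eq_abs, abs_mul, abs_of_pos (inv_pos.2 hεD)]
    exact mul_le_mul_of_nonneg_left (hB _) (inv_pos.2 hεD).le
  have hkint : ∫ u, k u ∂μ = 1 := by
    rw [hk, integral_const_mul, Measure.integral_comp_smul, hint, inv_pow, inv_inv,
      abs_of_pos hεD]
    simp [hεD.ne', D]
  have hkcs : HasCompactSupport k :=
    HasCompactSupport.intro (isCompact_closedBall (0 : V) (R * ε)) hksupp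
  have hk1 : Integrable k μ := hkc.integrable_of_hasCompactSupport hkcs
  have hloc : IntegrableOn (fun u => h (x - u)) (Metric.closedBall 0 (R * ε)) μ := by
    have h1 : IntegrableOn h (Metric.closedBall x (R * ε)) μ :=
      hh.integrableOn_isCompact (isCompact_closedBall _ _)
    rw [← integrable_indicator_iff measurableSet_closedBall] at h1 ⊢
    refine (h1.comp_sub_left x).congr (Eventually.of_forall fun u => ?_)
    simp [Set.indicator, Metric.mem_closedBall, dist_eq_norm]
  have hki : Integrable (fun u => k u * h (x - u)) μ := by
    have h1 : IntegrableOn (fun u => k u * h (x - u)) (Metric.closedBall 0 (R * ε)) μ := by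
      exact Integrable.bdd_mul hloc hkc.aestronglyMeasurable (Eventually.of_forall hkB)
    rw [← integrable_indicator_iff measurableSet_closedBall] at h1
    refine h1.congr (Eventually.of_forall fun u => ?_)
    by_cases hu : u ∈ Metric.closedBall (0 : V) (R * ε)
    · simp [hu]
    · simp [Set.indicator_of_notMem hu, hksupp u hu]
  have e1 : (∫ u, k u * h (x - u) ∂μ) - h x = ∫ u, k u * (h (x - u) - h x) ∂μ := by
    simp_rw [mul_sub]
    rw [integral_sub hki (hk1.mul_const _), integral_mul_const, hkint, one_mul]
  change ‖(∫ u, k u * h (x - u) ∂μ) - h x‖ ≤ _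
  rw [e1]
  have hbint : Integrable ((Metric.closedBall (0 : V) (R * ε)).indicator
      fun u => (ε ^ D)⁻¹ * B * ‖h (x - u) - h x‖) μ := by
    rw [integrable_indicator_iff measurableSet_closedBall]
    refine Integrable.const_mul (Integrable.norm (hloc.sub ?_)) _
    exact integrableOn_const (isCompact_closedBall _ _).measure_lt_top.ne
  refine (norm_integral_le_of_norm_le hbint (Eventually.of_forall fun u => ?_)).trans ?_
  · by_cases hu : u ∈ Metric.closedBall (0 : V) (R * ε)
    · rw [Set.indicator_of_mem hu, norm_mul]
      exact mul_le_mul_of_nonneg_right (hkB u) (norm_nonneg _)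
    · simp [Set.indicator_of_notMem hu, hksupp u hu]
  · have e2 : ∫ u, (Metric.closedBall (0 : V) (R * ε)).indicator
        (fun u => (ε ^ D)⁻¹ * B * ‖h (x - u) - h x‖) u ∂μ =
        (ε ^ D)⁻¹ * B * ∫ y in Metric.closedBall x (R * ε), ‖h y - h x‖ ∂μ := by
      rw [← integral_indicator measurableSet_closedBall, ← integral_const_mul,
        ← integral_sub_left_eq_self _ μ x]
      refine integral_congr_ae (Eventually.of_forall fun u => ?_)
      simp [Set.indicator, Metric.mem_closedBall, dist_eq_norm, norm_sub_rev x u]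
    have e3 : ∫ y in Metric.closedBall x (R * ε), ‖h y - h x‖ ∂μ =
        μ.real (Metric.closedBall x (R * ε)) *
          ⨍ y in Metric.closedBall x (R * ε), ‖h y - h x‖ ∂μ := by
      have := measure_smul_setAverage (μ := μ) (fun y => ‖h y - h x‖)
        (isCompact_closedBall x (R * ε)).measure_lt_top.ne
      exact this.symm
    have e4 : μ.real (Metric.closedBall x (R * ε)) =
        (R * ε) ^ D * μ.real (Metric.ball (0 : V) 1) := by
      rw [Measure.addHaar_real_closedBall μ x (mul_pos hR hε).le]
    rw [e2, e3, e4, mul_pow]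
    apply le_of_eq
    field_simp

theorem integrable_max_log_inv_norm {V : Type*} [NormedAddCommGroup V] [NormedSpace ℝ V]
    [FiniteDimensional ℝ V] [MeasurableSpace V] [BorelSpace V] [Nontrivial V] (μ : Measure V)
    [μ.IsAddHaarMeasure] : Integrable (fun u : V => max (Real.log ‖u‖⁻¹) 0) μ := by
  have key : IntegrableOn (fun y : ℝ => y ^ (Module.finrank ℝ V - 1) • max (Real.log y⁻¹) 0)
      (Set.Ioi 0) := by
    rw [← Set.Ioc_union_Ioi_eq_Ioi (zero_le_one (α := ℝ)), integrableOn_union]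
    constructor
    · have h1 : IntegrableOn (fun y : ℝ => |Real.log y|) (Set.Ioc 0 1) := by
        have := (intervalIntegral.intervalIntegrable_log' (a := 0) (b := 1)).1
        exact this.abs
      refine Integrable.mono' h1 ?_ ?_
      · refine Measurable.aestronglyMeasurable ?_
        simp only [smul_eq_mul]
        exact (measurable_id.pow_const _).mul
          ((Real.measurable_log.comp measurable_inv).max measurable_const)
      · filter_upwards [ae_restrict_mem measurableSet_Ioc] with y hy
        have h0 : 0 ≤ max (Real.log y⁻¹) 0 := le_max_right _ _
        rw [smul_eq_mul, Real.norm_of_nonneg (mul_nonneg (pow_nonneg hy.1.le _) h0)]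
        calc _ ≤ 1 * max (Real.log y⁻¹) 0 :=
              mul_le_mul_of_nonneg_right (pow_le_one₀ hy.1.le hy.2) h0
          _ ≤ |Real.log y| := by
            rw [one_mul, Real.log_inv]
            exact max_le (neg_le_abs _) (abs_nonneg _)
    · refine (integrableOn_zero : IntegrableOn (fun _ : ℝ => (0 : ℝ)) _ _).congr_fun
        (fun y hy => ?_) measurableSet_Ioi
      have : 0 ≤ Real.log y := Real.log_nonneg (le_of_lt hy)
      simp [this]
  exact (integrable_fun_norm_addHaar μ (f := fun y => max (Real.log y⁻¹) 0)).2 key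

/-- The ambient Euclidean space. -/
abbrev Pt (d : ℕ) := EuclideanSpace ℝ (Fin d)

/-- The positive part of the logarithm of the inverse distance to the origin. -/
def logPlus (w : Pt d) : ℝ := max (Real.log ‖w‖⁻¹) 0

theorem logPlus_nonneg (w : Pt d) : 0 ≤ logPlus w := le_max_right _ _

@[fun_prop]
theorem measurable_logPlus : Measurable (logPlus : Pt d → ℝ) :=
  (Real.measurable_log.comp measurable_norm.inv).max measurable_const

theorem logPlus_neg (w : Pt d) : logPlus (-w) = logPlus w := by simp [logPlus]

theorem logKernel_eq (g : Pt d → Pt d → ℝ) (x y : Pt d) :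
    logKernel g x y = logPlus (x - y) + g x y := by simp [logKernel, logPlus, dist_eq_norm]

theorem nontrivial_pt (hd : 1 ≤ d) : Nontrivial (Pt d) := by
  have : Nonempty (Fin d) := ⟨⟨0, hd⟩⟩
  infer_instance

theorem integrable_logPlus (hd : 1 ≤ d) : Integrable (logPlus : Pt d → ℝ) := by
  have := nontrivial_pt hd
  exact integrable_max_log_inv_norm volume

theorem logPlus_le_of_le {w : Pt d} {a : ℝ} (ha : 0 < a) (ha1 : a ≤ 1) (h : a ≤ ‖w‖) :
    logPlus w ≤ Real.log a⁻¹ := by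
  refine max_le (Real.log_le_log (inv_pos.2 (ha.trans_le h)) ((inv_le_inv₀ (ha.trans_le h) ha).2 h))
    (Real.log_nonneg ((one_le_inv₀ ha).2 ha1))

theorem le_logPlus_of_le {w : Pt d} {a : ℝ} (hw : w ≠ 0) (h : ‖w‖ ≤ a) :
    Real.log a⁻¹ ≤ logPlus w := by
  have h0 := norm_pos_iff.2 hw
  exact le_max_of_le_left
    (Real.log_le_log (inv_pos.2 (h0.trans_le h)) ((inv_le_inv₀ (h0.trans_le h) h0).2 h))

theorem logPlus_le_scale {ε : ℝ} (h0 : 0 < ε) (h1 : ε ≤ 1) (w : Pt d) :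
    logPlus w ≤ Real.log ε⁻¹ + logPlus (ε⁻¹ • w) := by
  have hε : 0 ≤ Real.log ε⁻¹ := Real.log_nonneg ((one_le_inv₀ h0).2 h1)
  refine max_le ?_ (add_nonneg hε (logPlus_nonneg _))
  rcases eq_or_ne w 0 with rfl | hw
  · simpa [logPlus] using hε
  · have hn := norm_pos_iff.2 hw
    have : Real.log ‖w‖⁻¹ = Real.log ε⁻¹ + Real.log ‖ε⁻¹ • w‖⁻¹ := by
      rw [norm_smul, Real.norm_of_nonneg (inv_pos.2 h0).le, mul_inv, inv_inv,
        Real.log_mul h0.ne' (inv_pos.2 hn).ne', Real.log_inv ε]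
      ring
    rw [this]
    gcongr
    exact le_max_left _ _

/-- Quantitative form of `IsMollifier`: support radius `R` and bound `B`. -/
structure MollifierBound (θ : Pt d → ℝ) (R B : ℝ) : Prop where
  cont : Continuous θ
  nonneg : ∀ x, 0 ≤ θ x
  le : ∀ x, θ x ≤ B
  one_le : 1 ≤ R
  supp : ∀ x, R < ‖x‖ → θ x = 0
  int : ∫ x, θ x = 1

theorem IsMollifier.exists_bound {θ : Pt d → ℝ} (h : IsMollifier θ) :
    ∃ R B, MollifierBound θ R B := by
  obtain ⟨h1, h2, h3, h4⟩ := h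
  obtain ⟨B, hB⟩ := h1.continuous.bounded_above_of_compact_support h2
  obtain ⟨R, hR⟩ := h2.isCompact.isBounded.subset_closedBall (0 : Pt d)
  refine ⟨max R 1, B, h1.continuous, h3, fun x => (le_abs_self _).trans (hB x), le_max_right _ _,
    fun x hx => ?_, h4⟩
  by_contra hne
  have := hR (subset_tsupport _ hne)
  rw [mem_closedBall_zero_iff] at this
  exact absurd (this.trans (le_max_left _ 1)) (not_le.2 hx)

namespace MollifierBound

variable {θ : Pt d → ℝ} {R B : ℝ}

theorem bound_nonneg (h : MollifierBound θ R B) : 0 ≤ B := (h.nonneg 0).trans (h.le 0)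

theorem scaled_nonneg (h : MollifierBound θ R B) {ε : ℝ} (hε : 0 < ε) (u : Pt d) :
    0 ≤ mollifierScaled θ ε u := mul_nonneg (by positivity) (h.nonneg _)

theorem scaled_le (h : MollifierBound θ R B) {ε : ℝ} (hε : 0 < ε) (u : Pt d) :
    mollifierScaled θ ε u ≤ (ε ^ d)⁻¹ * B := mul_le_mul_of_nonneg_left (h.le _) (by positivity)

theorem scaled_cont (h : MollifierBound θ R B) (ε : ℝ) : Continuous (mollifierScaled θ ε) :=
  continuous_const.mul (h.cont.comp (continuous_const_smul _))

theorem scaled_supp (h : MollifierBound θ R B) {ε : ℝ} (hε : 0 < ε) {u : Pt d}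
    (hu : mollifierScaled θ ε u ≠ 0) : ‖u‖ ≤ R * ε := by
  by_contra! hlt
  refine hu ?_
  rw [mollifierScaled, h.supp, mul_zero]
  rwa [norm_smul, norm_inv, Real.norm_of_nonneg hε.le, inv_mul_eq_div, lt_div_iff₀ hε]

theorem scaled_int (h : MollifierBound θ R B) {ε : ℝ} (hε : 0 < ε) :
    ∫ u, mollifierScaled θ ε u = 1 := by
  simp only [mollifierScaled]
  rw [integral_const_mul, Measure.integral_comp_smul, h.int, finrank_euclideanSpace_fin]
  have : 0 < ε ^ d := by positivity
  rw [inv_pow, inv_inv, abs_of_pos this]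
  simp [this.ne']

theorem scaled_integrable (h : MollifierBound θ R B) {ε : ℝ} (hε : 0 < ε) :
    Integrable (mollifierScaled θ ε) := by
  by_contra hn
  have := h.scaled_int hε
  rw [integral_undef hn] at this
  exact zero_ne_one this

theorem integral_logPlus_le (h : MollifierBound θ R B) (hd : 1 ≤ d) {ε : ℝ} (h0 : 0 < ε)
    (h1 : ε ≤ 1) (z : Pt d) : Integrable (fun u => mollifierScaled θ ε u * logPlus (z - u)) ∧
    ∫ u, mollifierScaled θ ε u * logPlus (z - u) ≤
      Real.log ε⁻¹ + B * ∫ w : Pt d, logPlus w := by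
  have hL := integrable_logPlus hd
  have hi1 : Integrable (fun u => mollifierScaled θ ε u * logPlus (z - u)) := by
    refine (hL.comp_sub_left z).bdd_mul (c := (ε ^ d)⁻¹ * B)
      (h.scaled_cont ε).aestronglyMeasurable (Eventually.of_forall fun u => ?_)
    rw [Real.norm_of_nonneg (h.scaled_nonneg h0 u)]
    exact h.scaled_le h0 u
  have hi2 : Integrable (fun u => logPlus (ε⁻¹ • (z - u))) :=
    (hL.comp_smul (inv_pos.2 h0).ne').comp_sub_left z
  have hi3 := h.scaled_integrable h0
  refine ⟨hi1, ?_⟩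
  calc ∫ u, mollifierScaled θ ε u * logPlus (z - u)
      ≤ ∫ u, (Real.log ε⁻¹ * mollifierScaled θ ε u +
          (ε ^ d)⁻¹ * B * logPlus (ε⁻¹ • (z - u))) := by
        refine integral_mono hi1 ((hi3.const_mul _).add (hi2.const_mul _)) fun u => ?_
        calc _ ≤ mollifierScaled θ ε u * (Real.log ε⁻¹ + logPlus (ε⁻¹ • (z - u))) :=
              mul_le_mul_of_nonneg_left (logPlus_le_scale h0 h1 _) (h.scaled_nonneg h0 u)
          _ ≤ _ := by
            rw [mul_add, mul_comm]
            gcongr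
            · exact logPlus_nonneg _
            · exact h.scaled_le h0 u
    _ = _ := by
      rw [integral_add (hi3.const_mul _) (hi2.const_mul _), integral_const_mul,
        integral_const_mul, h.scaled_int h0,
        integral_sub_left_eq_self (fun u => logPlus (ε⁻¹ • u)) volume z,
        Measure.integral_comp_smul, finrank_euclideanSpace_fin]
      have : 0 < ε ^ d := by positivity
      rw [inv_pow, inv_inv, abs_of_pos this, smul_eq_mul]
      field_simp

end MollifierBound

section Covariance

variable {θ : Pt d → ℝ} {R B : ℝ} {g : Pt d → Pt d → ℝ} {c : ℝ}

theorem integrable_conv_logPlus (hd : 1 ≤ d) {k : Pt d → ℝ} (hk : Integrable k) (x y : Pt d) :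
    Integrable (fun p : Pt d × Pt d => k p.2 * logPlus (x - p.1 - (y - p.2)))
      (volume.prod volume) := by
  have h1 : Integrable (fun w : Pt d => logPlus (w - (x - y))) :=
    (integrable_logPlus hd).comp_sub_right (x - y)
  have := hk.convolution_integrand (ContinuousLinearMap.mul ℝ ℝ) h1
  refine this.congr (Eventually.of_forall fun p => ?_)
  simp only [ContinuousLinearMap.mul_apply']
  rw [← logPlus_neg]
  congr 2
  abel

theorem integrable_mollified (h : MollifierBound θ R B) (hd : 1 ≤ d)
    (hg : Measurable (Function.uncurry g)) (hgc : ∀ x y, |g x y| ≤ c) {ε ε' : ℝ}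
    (hε : 0 < ε) (hε' : 0 < ε') (x y : Pt d) :
    Integrable (fun p : Pt d × Pt d => mollifierScaled θ ε p.1 * mollifierScaled θ ε' p.2)
      (volume.prod volume) ∧
    Integrable (fun p : Pt d × Pt d => mollifierScaled θ ε p.1 * mollifierScaled θ ε' p.2 *
      logPlus (x - p.1 - (y - p.2))) (volume.prod volume) ∧
    Integrable (fun p : Pt d × Pt d => mollifierScaled θ ε p.1 * mollifierScaled θ ε' p.2 *
      g (x - p.1) (y - p.2)) (volume.prod volume) := by
  have hw := (h.scaled_integrable hε).mul_prod (h.scaled_integrable hε')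
  refine ⟨hw, ?_, ?_⟩
  · have := (integrable_conv_logPlus hd (h.scaled_integrable hε') x y).bdd_mul
      (c := (ε ^ d)⁻¹ * B) (f := fun p : Pt d × Pt d => mollifierScaled θ ε p.1)
      ((h.scaled_cont ε).comp continuous_fst).aestronglyMeasurable
      (Eventually.of_forall fun p => by
        rw [Real.norm_of_nonneg (h.scaled_nonneg hε _)]; exact h.scaled_le hε _)
    simpa only [mul_assoc] using this
  · refine hw.mul_bdd (c := c) ?_ (Eventually.of_forall fun p => hgc _ _)
    exact (hg.comp ((measurable_const.sub measurable_fst).prodMk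
      (measurable_const.sub measurable_snd))).aestronglyMeasurable

theorem integrable_mollified_logKernel (h : MollifierBound θ R B) (hd : 1 ≤ d)
    (hg : Measurable (Function.uncurry g)) (hgc : ∀ x y, |g x y| ≤ c) {ε ε' : ℝ}
    (hε : 0 < ε) (hε' : 0 < ε') (x y : Pt d) :
    Integrable (fun p : Pt d × Pt d => mollifierScaled θ ε p.1 * mollifierScaled θ ε' p.2 *
      logKernel g (x - p.1) (y - p.2)) (volume.prod volume) := by
  obtain ⟨-, h2, h3⟩ := integrable_mollified h hd hg hgc hε hε' x y
  refine (h2.add h3).congr (Eventually.of_forall fun p => ?_)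
  simp only [logKernel_eq, Pi.add_apply]
  ring

theorem mollifiedCov_eq_prod (h : MollifierBound θ R B) (hd : 1 ≤ d)
    (hg : Measurable (Function.uncurry g)) (hgc : ∀ x y, |g x y| ≤ c) {ε ε' : ℝ}
    (hε : 0 < ε) (hε' : 0 < ε') (x y : Pt d) :
    mollifiedCov (logKernel g) θ θ ε ε' x y = ∫ p : Pt d × Pt d,
      mollifierScaled θ ε p.1 * mollifierScaled θ ε' p.2 * logKernel g (x - p.1) (y - p.2)
        ∂(volume.prod volume) :=
  (integral_prod _ (integrable_mollified_logKernel h hd hg hgc hε hε' x y)).symm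

theorem mollifiedCov_swap (h : MollifierBound θ R B) (hd : 1 ≤ d)
    (hg : Measurable (Function.uncurry g)) (hgc : ∀ x y, |g x y| ≤ c) {ε ε' : ℝ}
    (hε : 0 < ε) (hε' : 0 < ε') (x y : Pt d) :
    mollifiedCov (logKernel g) θ θ ε' ε y x =
      mollifiedCov (logKernel fun a b => g b a) θ θ ε ε' x y := by
  have hg' : Measurable (Function.uncurry fun a b => g b a) := hg.comp measurable_swap
  rw [mollifiedCov_eq_prod h hd hg hgc hε' hε,
    mollifiedCov_eq_prod h hd hg' (fun x y => hgc y x) hε hε', ← integral_prod_swap]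
  refine integral_congr_ae (Eventually.of_forall fun p => ?_)
  simp only [Prod.fst_swap, Prod.snd_swap, logKernel_eq]
  rw [← logPlus_neg, neg_sub]
  ring

theorem integral_weight (h : MollifierBound θ R B) {ε ε' : ℝ} (hε : 0 < ε) (hε' : 0 < ε') (s : ℝ) :
    ∫ p : Pt d × Pt d, mollifierScaled θ ε p.1 * mollifierScaled θ ε' p.2 * s
      ∂(volume.prod volume) = s := by
  rw [integral_mul_const, integral_prod_mul, h.scaled_int hε, h.scaled_int hε']
  simp

theorem mollifiedCov_le (h : MollifierBound θ R B) (hd : 1 ≤ d)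
    (hg : Measurable (Function.uncurry g)) (hgc : ∀ x y, |g x y| ≤ c) {ε ε' r : ℝ}
    (hε : 0 < ε) (hε1 : ε ≤ 1) (hε' : 0 < ε') (hε1' : ε' ≤ 1) (x y : Pt d) (hr : 0 < r)
    (hr1 : r ≤ 1) (hm : r ≤ max (max ε ε') (dist x y)) :
    mollifiedCov (logKernel g) θ θ ε ε' x y ≤
      Real.log r⁻¹ + (Real.log (4 * R) + B * (∫ w : Pt d, logPlus w) + c) := by
  obtain ⟨h1, h2, h3⟩ := integrable_mollified h hd hg hgc hε hε' x y
  have hR := h.one_le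
  have hL0 : 0 ≤ B * ∫ w : Pt d, logPlus w :=
    mul_nonneg h.bound_nonneg (integral_nonneg logPlus_nonneg)
  have hw0 : ∀ p : Pt d × Pt d, 0 ≤ mollifierScaled θ ε p.1 * mollifierScaled θ ε' p.2 :=
    fun p => mul_nonneg (h.scaled_nonneg hε _) (h.scaled_nonneg hε' _)
  have hscale : ∀ δ, 0 < δ → r / (4 * R) ≤ δ → Real.log δ⁻¹ ≤ Real.log r⁻¹ + Real.log (4 * R) := by
    intro δ hδ hle
    rw [← Real.log_mul (inv_pos.2 hr).ne' (by positivity)]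
    refine Real.log_le_log (inv_pos.2 hδ) ?_
    rw [inv_le_comm₀ hδ (by positivity), mul_inv, inv_inv]
    exact hle
  have hlog : ∫ p : Pt d × Pt d, mollifierScaled θ ε p.1 * mollifierScaled θ ε' p.2 *
      logPlus (x - p.1 - (y - p.2)) ∂(volume.prod volume) ≤
      Real.log r⁻¹ + (Real.log (4 * R) + B * ∫ w : Pt d, logPlus w) := by
    rcases le_or_gt (r / (4 * R)) ε with hc | hc
    · rw [integral_prod_symm _ h2]
      calc _ ≤ ∫ v, mollifierScaled θ ε' v * (Real.log ε⁻¹ + B * ∫ w : Pt d, logPlus w) := by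
            refine integral_mono_of_nonneg (Eventually.of_forall fun v => integral_nonneg fun u =>
              mul_nonneg (hw0 (u, v)) (logPlus_nonneg _))
              ((h.scaled_integrable hε').mul_const _) (Eventually.of_forall fun v => ?_)
            have := (h.integral_logPlus_le hd hε hε1 (x - (y - v))).2
            calc _ = ∫ u, mollifierScaled θ ε' v *
                  (mollifierScaled θ ε u * logPlus (x - (y - v) - u)) := by
                  refine integral_congr_ae (Eventually.of_forall fun u => ?_)
                  simp only
                  rw [sub_right_comm x u]
                  ring
              _ ≤ _ := by
                rw [integral_const_mul]
                exact mul_le_mul_of_nonneg_left this (h.scaled_nonneg hε' v)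
        _ ≤ _ := by
          rw [integral_mul_const, h.scaled_int hε', one_mul]
          linarith [hscale ε hε hc]
    rcases le_or_gt (r / (4 * R)) ε' with hc' | hc'
    · rw [integral_prod _ h2]
      calc _ ≤ ∫ u, mollifierScaled θ ε u * (Real.log ε'⁻¹ + B * ∫ w : Pt d, logPlus w) := by
            refine integral_mono_of_nonneg (Eventually.of_forall fun u => integral_nonneg fun v =>
              mul_nonneg (hw0 (u, v)) (logPlus_nonneg _))
              ((h.scaled_integrable hε).mul_const _) (Eventually.of_forall fun u => ?_)
            have := (h.integral_logPlus_le hd hε' hε1' (y - (x - u))).2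
            calc _ = ∫ v, mollifierScaled θ ε u *
                  (mollifierScaled θ ε' v * logPlus (y - (x - u) - v)) := by
                  refine integral_congr_ae (Eventually.of_forall fun v => ?_)
                  simp only
                  rw [← logPlus_neg, neg_sub, sub_right_comm y v]
                  ring
              _ ≤ _ := by
                rw [integral_const_mul]
                exact mul_le_mul_of_nonneg_left this (h.scaled_nonneg hε u)
        _ ≤ _ := by
          rw [integral_mul_const, h.scaled_int hε, one_mul]
          linarith [hscale ε' hε' hc']
    have hz : r ≤ dist x y := by
      have : r / (4 * R) ≤ r := div_le_self hr.le (by linarith)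
      rcases le_max_iff.1 hm with h' | h'
      · rcases le_max_iff.1 h' with h' | h' <;> linarith
      · exact h'
    calc _ ≤ ∫ p : Pt d × Pt d, mollifierScaled θ ε p.1 * mollifierScaled θ ε' p.2 *
          Real.log (r / 2)⁻¹ ∂(volume.prod volume) := by
          refine integral_mono h2 (h1.mul_const _) fun p => ?_
          by_cases hp : mollifierScaled θ ε p.1 * mollifierScaled θ ε' p.2 = 0
          · simp [hp]
          refine mul_le_mul_of_nonneg_left (logPlus_le_of_le (by positivity) (by linarith) ?_)
            (hw0 p)
          have hu := h.scaled_supp hε (left_ne_zero_of_mul hp)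
          have hv := h.scaled_supp hε' (right_ne_zero_of_mul hp)
          have e1 : R * ε ≤ r / 4 := by
            rw [lt_div_iff₀ (by positivity)] at hc; linarith
          have e2 : R * ε' ≤ r / 4 := by
            rw [lt_div_iff₀ (by positivity)] at hc'; linarith
          have e3 : ‖x - y‖ ≤ ‖x - p.1 - (y - p.2)‖ + ‖p.1‖ + ‖p.2‖ := by
            have : x - y = (x - p.1 - (y - p.2)) + p.1 - p.2 := by abel
            calc ‖x - y‖ = ‖(x - p.1 - (y - p.2)) + p.1 - p.2‖ := by rw [← this]
              _ ≤ _ := (norm_sub_le _ _).trans (by gcongr; exact norm_add_le _ _)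
          rw [dist_eq_norm] at hz
          linarith
      _ ≤ _ := by
        rw [integral_weight h hε hε']
        have : Real.log (r / 2)⁻¹ = Real.log r⁻¹ + Real.log 2 := by
          rw [inv_div, div_eq_inv_mul, Real.log_mul (inv_pos.2 hr).ne' two_ne_zero]
        have h4 : Real.log 2 ≤ Real.log (4 * R) := Real.log_le_log two_pos (by linarith)
        linarith
  have hgi : ∫ p : Pt d × Pt d, mollifierScaled θ ε p.1 * mollifierScaled θ ε' p.2 *
      g (x - p.1) (y - p.2) ∂(volume.prod volume) ≤ c := by
    rw [← integral_weight h hε hε' c]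
    exact integral_mono h3 (h1.mul_const _) fun p =>
      mul_le_mul_of_nonneg_left ((le_abs_self _).trans (hgc _ _)) (hw0 p)
  rw [mollifiedCov_eq_prod h hd hg hgc hε hε']
  have := integral_add h2 h3
  simp only [logKernel_eq, mul_add]
  rw [this]
  linarith

theorem le_mollifiedCov (h : MollifierBound θ R B) (hd : 1 ≤ d)
    (hg : Measurable (Function.uncurry g)) (hgc : ∀ x y, |g x y| ≤ c) {ε ε' r : ℝ}
    (hε : 0 < ε) (hε' : 0 < ε') (x y : Pt d)
    (hm : max (max ε ε') (dist x y) ≤ r) :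
    Real.log r⁻¹ - (Real.log (1 + 2 * R) + c) ≤ mollifiedCov (logKernel g) θ θ ε ε' x y := by
  have hR := h.one_le
  have hr : 0 < r := hε.trans_le (((le_max_left _ _).trans (le_max_left _ _)).trans hm)
  obtain ⟨h1, -, -⟩ := integrable_mollified h hd hg hgc hε hε' x y
  rw [mollifiedCov_eq_prod h hd hg hgc hε hε', ← integral_weight h hε hε' (_ - _)]
  refine integral_mono_ae (h1.mul_const _)
    (integrable_mollified_logKernel h hd hg hgc hε hε' x y) ?_
  have hae : ∀ᵐ p : Pt d × Pt d ∂(volume.prod volume), x - p.1 - (y - p.2) ≠ 0 := by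
    have := nontrivial_pt hd
    refine (Measure.ae_prod_iff_ae_ae ?_).2 (Eventually.of_forall fun u => ?_)
    · exact (measurableSet_singleton (0 : Pt d)).compl.preimage (by fun_prop)
    · have := (measure_eq_zero_iff_ae_notMem (μ := volume)).1
        (measure_singleton (y - (x - u)) : volume {y - (x - u)} = 0)
      filter_upwards [this] with v hv h0
      exact hv (by rw [sub_eq_zero.1 h0]; simp)
  filter_upwards [hae] with p hp
  by_cases hp0 : mollifierScaled θ ε p.1 * mollifierScaled θ ε' p.2 = 0
  · simp [hp0]
  refine mul_le_mul_of_nonneg_left ?_ (mul_nonneg (h.scaled_nonneg hε _) (h.scaled_nonneg hε' _))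
  have hu := h.scaled_supp hε (left_ne_zero_of_mul hp0)
  have hv := h.scaled_supp hε' (right_ne_zero_of_mul hp0)
  have h3 : R * ε ≤ R * r := by gcongr; exact ((le_max_left _ _).trans (le_max_left _ _)).trans hm
  have h4 : R * ε' ≤ R * r := by gcongr; exact ((le_max_right _ _).trans (le_max_left _ _)).trans hm
  have h5 : ‖x - y‖ ≤ r := by rw [← dist_eq_norm]; exact (le_max_right _ _).trans hm
  have h6 : ‖x - p.1 - (y - p.2)‖ ≤ r * (1 + 2 * R) := by
    have : x - p.1 - (y - p.2) = x - y - p.1 + p.2 := by abel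
    rw [this]
    have := norm_add_le (x - y - p.1) p.2
    have := norm_sub_le (x - y) p.1
    linarith
  have h7 := le_logPlus_of_le hp h6
  rw [mul_inv, Real.log_mul (inv_pos.2 hr).ne' (by positivity), Real.log_inv (1 + 2 * R)] at h7
  have h8 := (abs_le.1 (hgc (x - p.1) (y - p.2))).1
  rw [logKernel_eq]
  linarith

end Covariance

/-- Mollification scales. -/
abbrev Scale := Set.Ioc (0 : ℝ) 1

/-- The filter of scales tending to `0`. -/
def smallScale : Filter Scale := comap (Subtype.val) (𝓝 0)

theorem map_smallScale : map (Subtype.val) smallScale = 𝓝[Set.Ioc (0 : ℝ) 1] 0 := by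
  rw [smallScale, map_comap, Subtype.range_coe, nhdsWithin]

instance : smallScale.NeBot := by
  rw [← map_neBot_iff (Subtype.val : Scale → ℝ), map_smallScale,
    nhdsWithin_Ioc_eq_nhdsGT zero_lt_one]
  infer_instance

instance : smallScale.IsCountablyGenerated := by
  unfold smallScale
  infer_instance

theorem tendsto_coe_smallScale : Tendsto (Subtype.val : Scale → ℝ) smallScale (𝓝[>] 0) := by
  rw [Tendsto, map_smallScale]
  exact nhdsWithin_mono _ fun x hx => hx.1

theorem eventually_smallScale_le {a : ℝ} (ha : 0 < a) :
    ∀ᶠ ε : Scale in smallScale, (ε : ℝ) ≤ a := by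
  have := tendsto_coe_smallScale.eventually
    (mem_nhdsWithin_of_mem_nhds (Iic_mem_nhds ha))
  exact this

/-- Approximate logarithmic covariance structure of a mollified log-correlated field. -/
structure IsLogCov (C : Scale × Pt d → Scale × Pt d → ℝ) (G : Scale → Pt d → Pt d → ℝ)
    (K : Pt d → Pt d → ℝ) (c₀ : ℝ) : Prop where
  meas : ∀ ε ε', Measurable fun p : Pt d × Pt d => C (ε, p.1) (ε', p.2)
  measG : ∀ δ, Measurable fun p : Pt d × Pt d => G δ p.1 p.2
  measK : Measurable fun p : Pt d × Pt d => K p.1 p.2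
  upper : ∀ (ε ε' : Scale) (x y : Pt d) (r : ℝ), 0 < r → r ≤ 1 →
    r ≤ max (max (ε : ℝ) ε') (dist x y) → C (ε, x) (ε', y) ≤ Real.log r⁻¹ + c₀
  lower : ∀ (ε ε' : Scale) (x y : Pt d) (r : ℝ), max (max (ε : ℝ) ε') (dist x y) ≤ r →
    Real.log r⁻¹ - c₀ ≤ C (ε, x) (ε', y)
  lim1 : ∀ δ y, ∀ᵐ x, Tendsto (fun ε => C (ε, x) (δ, y)) smallScale (𝓝 (G δ x y))
  lim2 : ∀ x, ∀ᵐ y, Tendsto (fun δ => G δ x y) smallScale (𝓝 (K x y))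
  lim3 : ∀ᵐ p : Pt d × Pt d ∂(volume.prod volume),
    Tendsto (fun ε => C (ε, p.1) (ε, p.2)) smallScale (𝓝 (K p.1 p.2))

theorem measurable_section {F : Pt d → Pt d → ℝ} (h : Measurable fun p : Pt d × Pt d => F p.1 p.2)
    (y : Pt d) : Measurable fun x => F x y := h.comp measurable_prodMk_right

section Covariance

variable {θ : Pt d → ℝ} {R B : ℝ} {g : Pt d → Pt d → ℝ} {c : ℝ}

theorem MollifierBound.continuous_scaled (h : MollifierBound θ R B) (ε : ℝ) :
    Measurable (mollifierScaled θ ε) := (h.scaled_cont ε).measurable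

theorem measurable_logKernel (hg : Measurable (Function.uncurry g)) :
    Measurable fun p : Pt d × Pt d => logKernel g p.1 p.2 := by
  simp only [logKernel_eq]
  exact (measurable_logPlus.comp (measurable_fst.sub measurable_snd)).add hg

theorem measurable_mollifiedCov (h : MollifierBound θ R B)
    (hg : Measurable (Function.uncurry g)) (ε ε' : ℝ) :
    Measurable fun p : Pt d × Pt d => mollifiedCov (logKernel g) θ θ ε ε' p.1 p.2 := by
  have hm : Measurable fun q : ((Pt d × Pt d) × Pt d) × Pt d =>
      mollifierScaled θ ε q.1.2 * mollifierScaled θ ε' q.2 *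
        logKernel g (q.1.1.1 - q.1.2) (q.1.1.2 - q.2) := by
    have h1 := h.continuous_scaled ε
    have h2 := h.continuous_scaled ε'
    have h3 : Measurable fun q : ((Pt d × Pt d) × Pt d) × Pt d =>
        logKernel g (q.1.1.1 - q.1.2) (q.1.1.2 - q.2) :=
      (measurable_logKernel hg).comp (f := fun q : ((Pt d × Pt d) × Pt d) × Pt d =>
        (q.1.1.1 - q.1.2, q.1.1.2 - q.2)) (by fun_prop)
    exact ((h1.comp (by fun_prop)).mul (h2.comp (by fun_prop))).mul h3
  have h1 := hm.stronglyMeasurable.integral_prod_right' (ν := (volume : Measure (Pt d)))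
  exact (h1.integral_prod_right' (ν := (volume : Measure (Pt d)))).measurable

/-- The kernel mollified in its second variable only. -/
def halfMollified (K : Pt d → Pt d → ℝ) (θ : Pt d → ℝ) (δ : ℝ) (x y : Pt d) : ℝ :=
  ∫ v, mollifierScaled θ δ v * K x (y - v)

theorem measurable_halfMollified (h : MollifierBound θ R B)
    (hg : Measurable (Function.uncurry g)) (δ : ℝ) :
    Measurable fun p : Pt d × Pt d => halfMollified (logKernel g) θ δ p.1 p.2 := by
  have hm : Measurable fun q : (Pt d × Pt d) × Pt d =>
      mollifierScaled θ δ q.2 * logKernel g q.1.1 (q.1.2 - q.2) := by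
    have h3 : Measurable fun q : (Pt d × Pt d) × Pt d => logKernel g q.1.1 (q.1.2 - q.2) :=
      (measurable_logKernel hg).comp (f := fun q : (Pt d × Pt d) × Pt d =>
        (q.1.1, q.1.2 - q.2)) (by fun_prop)
    exact ((h.continuous_scaled δ).comp (by fun_prop)).mul h3
  exact (hm.stronglyMeasurable.integral_prod_right' (ν := (volume : Measure (Pt d)))).measurable

theorem abs_halfMollified_le (h : MollifierBound θ R B) (hd : 1 ≤ d)
    (hg : Measurable (Function.uncurry g)) (hgc : ∀ x y, |g x y| ≤ c) {δ : ℝ} (hδ : 0 < δ)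
    (hδ1 : δ ≤ 1) (x y : Pt d) :
    |halfMollified (logKernel g) θ δ x y| ≤ Real.log δ⁻¹ + B * (∫ w : Pt d, logPlus w) + c := by
  obtain ⟨h1, h2⟩ := h.integral_logPlus_le hd hδ hδ1 (y - x)
  have h3 : Integrable fun v => mollifierScaled θ δ v * g x (y - v) := by
    refine (h.scaled_integrable hδ).mul_bdd (c := c) ?_ (Eventually.of_forall fun p => hgc _ _)
    exact (hg.comp (measurable_const.prodMk
      (measurable_const.sub measurable_id))).aestronglyMeasurable
  have e : halfMollified (logKernel g) θ δ x y =
      (∫ v, mollifierScaled θ δ v * logPlus (y - x - v)) +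
        ∫ v, mollifierScaled θ δ v * g x (y - v) := by
    rw [← integral_add h1 h3]
    refine integral_congr_ae (Eventually.of_forall fun v => ?_)
    simp only [logKernel_eq]
    rw [← logPlus_neg, mul_add, neg_sub, sub_right_comm y v]
  have h4 : |∫ v, mollifierScaled θ δ v * g x (y - v)| ≤ c := by
    calc _ ≤ ∫ v, |mollifierScaled θ δ v * g x (y - v)| := abs_integral_le_integral_abs
      _ ≤ ∫ v, mollifierScaled θ δ v * c := by
        refine integral_mono h3.abs ((h.scaled_integrable hδ).mul_const c) fun v => ?_
        simp only [abs_mul, abs_of_nonneg (h.scaled_nonneg hδ v)]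
        exact mul_le_mul_of_nonneg_left (hgc _ _) (h.scaled_nonneg hδ v)
      _ = c := by rw [integral_mul_const, h.scaled_int hδ, one_mul]
  have h5 : 0 ≤ ∫ v, mollifierScaled θ δ v * logPlus (y - x - v) :=
    integral_nonneg fun v => mul_nonneg (h.scaled_nonneg hδ v) (logPlus_nonneg _)
  rw [e]
  refine (abs_add_le _ _).trans ?_
  rw [abs_of_nonneg h5]
  linarith

theorem ae_tendsto_mollify (h : MollifierBound θ R B) {k : Pt d → ℝ} (hk : LocallyIntegrable k) :
    ∀ᵐ x, Tendsto (fun ε : Scale => ∫ u, mollifierScaled θ ε u * k (x - u)) smallScale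
      (𝓝 (k x)) := by
  have := ae_tendsto_integral_mollify volume h.cont (zero_lt_one.trans_le h.one_le) h.supp
    (B := B) (fun u => by rw [abs_of_nonneg (h.nonneg u)]; exact h.le u) h.int hk
  filter_upwards [this] with x hx
  rw [finrank_euclideanSpace_fin] at hx
  exact hx.comp tendsto_coe_smallScale

theorem locallyIntegrable_of_bounded {k : Pt d → ℝ} (hm : Measurable k) {a : ℝ}
    (ha : ∀ x, |k x| ≤ a) : LocallyIntegrable k := by
  refine (locallyIntegrable_const a).mono hm.aestronglyMeasurable (Eventually.of_forall fun x => ?_)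
  exact (ha x).trans (le_abs_self _)

theorem ae_tendsto_mollifiedCov_fst (h : MollifierBound θ R B) (hd : 1 ≤ d)
    (hg : Measurable (Function.uncurry g)) (hgc : ∀ x y, |g x y| ≤ c) {δ : ℝ} (hδ : 0 < δ)
    (hδ1 : δ ≤ 1) (y : Pt d) :
    ∀ᵐ x, Tendsto (fun ε : Scale => mollifiedCov (logKernel g) θ θ ε δ x y) smallScale
      (𝓝 (halfMollified (logKernel g) θ δ x y)) := by
  have hm : Measurable fun x => halfMollified (logKernel g) θ δ x y :=
    measurable_section (F := halfMollified (logKernel g) θ δ) (measurable_halfMollified h hg δ) y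
  have hl : LocallyIntegrable fun x => halfMollified (logKernel g) θ δ x y :=
    locallyIntegrable_of_bounded hm fun x => abs_halfMollified_le h hd hg hgc hδ hδ1 x y
  filter_upwards [ae_tendsto_mollify h hl] with x hx
  refine hx.congr fun ε => ?_
  simp only [mollifiedCov, halfMollified]
  refine integral_congr_ae (Eventually.of_forall fun u => ?_)
  simp only [mul_assoc]
  rw [integral_const_mul]

theorem ae_tendsto_halfMollified (h : MollifierBound θ R B) (hd : 1 ≤ d)
    (hg : Measurable (Function.uncurry g)) (hgc : ∀ x y, |g x y| ≤ c) (x : Pt d) :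
    ∀ᵐ y, Tendsto (fun δ : Scale => halfMollified (logKernel g) θ δ x y) smallScale
      (𝓝 (logKernel g x y)) := by
  have hl : LocallyIntegrable fun y => logKernel g x y := by
    simp only [logKernel_eq]
    refine ((integrable_logPlus hd).comp_sub_left x).locallyIntegrable.add
      (locallyIntegrable_of_bounded (a := c) ?_ fun y => hgc x y)
    exact hg.comp (measurable_const.prodMk measurable_id)
  exact ae_tendsto_mollify h hl

theorem locallyIntegrable_logKernel (hd : 1 ≤ d)
    (hg : Measurable (Function.uncurry g)) (hgc : ∀ x y, |g x y| ≤ c) :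
    LocallyIntegrable (fun p : Pt d × Pt d => logKernel g p.1 p.2) (volume.prod volume) := by
  simp only [logKernel_eq]
  have h2 : LocallyIntegrable (fun p : Pt d × Pt d => g p.1 p.2) (volume.prod volume) := by
    refine (locallyIntegrable_const c).mono hg.aestronglyMeasurable
      (Eventually.of_forall fun x => ?_)
    exact (hgc _ _).trans (le_abs_self _)
  refine LocallyIntegrable.add ?_ h2
  rw [locallyIntegrable_iff]
  intro k hk
  obtain ⟨r, hr⟩ := hk.isBounded.subset_closedBall (0 : Pt d × Pt d)
  have h1 : Integrable ((Metric.closedBall (0 : Pt d) r).indicator fun _ => (1 : ℝ)) :=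
    (integrable_indicator_iff measurableSet_closedBall).2
      (integrableOn_const (isCompact_closedBall _ _).measure_lt_top.ne)
  have h3 := integrable_conv_logPlus hd h1 (0 : Pt d) 0
  refine (h3.integrableOn (s := k)).congr_fun_ae ?_
  filter_upwards [ae_restrict_mem hk.measurableSet] with p hp
  have hp2 : p.2 ∈ Metric.closedBall (0 : Pt d) r := by
    have := hr hp
    rw [mem_closedBall_zero_iff] at this ⊢
    exact (norm_snd_le p).trans this
  rw [Set.indicator_of_mem hp2, one_mul, ← logPlus_neg]
  congr 1
  abel

theorem ae_tendsto_mollifiedCov_diag (h : MollifierBound θ R B) (hd : 1 ≤ d)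
    (hg : Measurable (Function.uncurry g)) (hgc : ∀ x y, |g x y| ≤ c) :
    ∀ᵐ p : Pt d × Pt d ∂(volume.prod volume),
      Tendsto (fun ε : Scale => mollifiedCov (logKernel g) θ θ ε ε p.1 p.2) smallScale
        (𝓝 (logKernel g p.1 p.2)) := by
  have hcont : Continuous fun p : Pt d × Pt d => θ p.1 * θ p.2 :=
    (h.cont.comp continuous_fst).mul (h.cont.comp continuous_snd)
  have hsupp : ∀ p : Pt d × Pt d, R < ‖p‖ → θ p.1 * θ p.2 = 0 := by
    intro p hp
    rcases lt_max_iff.1 hp with hp | hp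
    · rw [h.supp _ hp, zero_mul]
    · rw [h.supp _ hp, mul_zero]
  have hB : ∀ p : Pt d × Pt d, |θ p.1 * θ p.2| ≤ B * B := fun p => by
    rw [abs_of_nonneg (mul_nonneg (h.nonneg _) (h.nonneg _))]
    exact mul_le_mul (h.le _) (h.le _) (h.nonneg _) h.bound_nonneg
  have hint : ∫ p : Pt d × Pt d, θ p.1 * θ p.2 ∂(volume.prod volume) = 1 := by
    rw [integral_prod_mul, h.int, mul_one]
  have := ae_tendsto_integral_mollify (volume.prod volume) hcont
    (zero_lt_one.trans_le h.one_le) hsupp hB hint (locallyIntegrable_logKernel hd hg hgc)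
  filter_upwards [this] with p hp
  refine (hp.comp tendsto_coe_smallScale).congr fun ε => ?_
  rw [mollifiedCov_eq_prod h hd hg hgc ε.2.1 ε.2.1]
  refine integral_congr_ae (Eventually.of_forall fun q => ?_)
  simp only [mollifierScaled, Module.finrank_prod, finrank_euclideanSpace_fin, pow_add, mul_inv,
    Prod.smul_fst, Prod.smul_snd, Prod.fst_sub, Prod.snd_sub]
  ring

theorem isLogCov_mollifiedCov (h : MollifierBound θ R B) (hd : 1 ≤ d)
    (hg : Measurable (Function.uncurry g)) (hgc : ∀ x y, |g x y| ≤ c) :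
    ∃ c₀, IsLogCov (fun s t : Scale × Pt d => mollifiedCov (logKernel g) θ θ s.1 t.1 s.2 t.2)
      (fun δ => halfMollified (logKernel g) θ δ) (logKernel g) c₀ := by
  have hL : 0 ≤ B * (∫ w : Pt d, logPlus w) :=
    mul_nonneg h.bound_nonneg (integral_nonneg logPlus_nonneg)
  have hc : 0 ≤ c := (abs_nonneg _).trans (hgc 0 0)
  have hR := h.one_le
  have h1 : 0 ≤ Real.log (4 * R) := Real.log_nonneg (by linarith)
  have h2 : Real.log (1 + 2 * R) ≤ Real.log (4 * R) :=
    Real.log_le_log (by positivity) (by linarith)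
  refine ⟨Real.log (4 * R) + B * (∫ w : Pt d, logPlus w) + c,
    fun ε ε' => measurable_mollifiedCov h hg ε ε', fun δ => measurable_halfMollified h hg δ,
    measurable_logKernel hg, fun ε ε' x y r hr hr1 hm =>
      mollifiedCov_le h hd hg hgc ε.2.1 ε.2.2 ε'.2.1 ε'.2.2 x y hr hr1 hm,
    fun ε ε' x y r hm => ?_,
    fun δ y => ae_tendsto_mollifiedCov_fst h hd hg hgc δ.2.1 δ.2.2 y,
    fun x => ae_tendsto_halfMollified h hd hg hgc x,
    ae_tendsto_mollifiedCov_diag h hd hg hgc⟩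
  have := le_mollifiedCov h hd hg hgc ε.2.1 ε'.2.1 x y hm
  simp only
  linarith

end Covariance

/-- A centred Gaussian process `Y` with covariance `c` over an arbitrary index set. -/
structure IsGaussProc {T Ω : Type*} [MeasurableSpace Ω] (P : Measure Ω) (Y : T → Ω → ℝ)
    (c : T → T → ℝ) : Prop where
  meas : ∀ t, Measurable (Y t)
  symm : ∀ s t, c s t = c t s
  law : ∀ (n : ℕ) (t : Fin n → T) (l : Fin n → ℝ), ∃ v : ℝ≥0,
    (v : ℝ) = ∑ i, ∑ j, l i * l j * c (t i) (t j) ∧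
    Measure.map (fun ω => ∑ i, l i * Y (t i) ω) P = gaussianReal 0 v

namespace IsGaussProc

variable {T Ω : Type*} [MeasurableSpace Ω] {P : Measure Ω} {Y : T → Ω → ℝ} {c : T → T → ℝ}

theorem exists_law_fintype (h : IsGaussProc P Y c) {ι : Type*} [Fintype ι] (t : ι → T)
    (l : ι → ℝ) : ∃ v : ℝ≥0, (v : ℝ) = ∑ i, ∑ j, l i * l j * c (t i) (t j) ∧
      Measure.map (fun ω => ∑ i, l i * Y (t i) ω) P = gaussianReal 0 v := by
  let e := Fintype.equivFin ι
  obtain ⟨v, hv, hl⟩ := h.law _ (t ∘ e.symm) (l ∘ e.symm)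
  refine ⟨v, ?_, ?_⟩
  · rw [hv]
    simp only [Function.comp]
    rw [Equiv.sum_comp e.symm fun i => ∑ j, l i * l (e.symm j) * c (t i) (t (e.symm j))]
    exact Finset.sum_congr rfl fun i _ =>
      Equiv.sum_comp e.symm fun j => l i * l j * c (t i) (t j)
  · rw [← hl]
    congr 1
    ext ω
    exact (Equiv.sum_comp e.symm fun i => l i * Y (t i) ω).symm

theorem integrable_exp_sum (h : IsGaussProc P Y c) {ι : Type*} [Fintype ι] (t : ι → T)
    (l : ι → ℝ) : Integrable (fun ω => Real.exp (∑ i, l i * Y (t i) ω)) P := by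
  obtain ⟨v, -, hl⟩ := h.exists_law_fintype t l
  have hm : Measurable fun ω => ∑ i, l i * Y (t i) ω :=
    Finset.measurable_sum _ fun i _ => (h.meas _).const_mul _
  have := integrable_exp_mul_gaussianReal (μ := 0) (v := v) 1
  rw [← hl, integrable_map_measure (by fun_prop) hm.aemeasurable] at this
  simpa [Function.comp_def] using this

theorem integral_exp_sum (h : IsGaussProc P Y c) {ι : Type*} [Fintype ι] (t : ι → T)
    (l : ι → ℝ) : ∫ ω, Real.exp (∑ i, l i * Y (t i) ω) ∂P =
      Real.exp ((∑ i, ∑ j, l i * l j * c (t i) (t j)) / 2) := by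
  obtain ⟨v, hv, hl⟩ := h.exists_law_fintype t l
  have := mgf_gaussianReal hl 1
  rw [← hv]
  simpa [mgf] using this

theorem integral_exp_three (h : IsGaussProc P Y c) (a b e : ℝ) (s t u : T) :
    ∫ ω, Real.exp (a * Y s ω + b * Y t ω + e * Y u ω) ∂P =
      Real.exp (a ^ 2 / 2 * c s s + b ^ 2 / 2 * c t t + e ^ 2 / 2 * c u u
        + a * b * c s t + a * e * c s u + b * e * c t u) := by
  have := h.integral_exp_sum ![s, t, u] ![a, b, e]
  simp only [Fin.sum_univ_three, Matrix.cons_val] at this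
  rw [this, h.symm t s, h.symm u s, h.symm u t]
  ring_nf

theorem integrable_exp_three (h : IsGaussProc P Y c) (a b e : ℝ) (s t u : T) :
    Integrable (fun ω => Real.exp (a * Y s ω + b * Y t ω + e * Y u ω)) P := by
  have := h.integrable_exp_sum ![s, t, u] ![a, b, e]
  simpa only [Fin.sum_univ_three, Matrix.cons_val] using this

/-- **Cameron–Martin**: tilting by a finite linear combination shifts the other coordinates. -/
theorem tilted_map (h : IsGaussProc P Y c) [IsProbabilityMeasure P] {ι κ : Type*} [Fintype ι]
    [Fintype κ] (s : ι → T) (l : ι → ℝ) (t : κ → T) :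
    (P.tilted fun ω => ∑ i, l i * Y (s i) ω).map (fun ω k => Y (t k) ω) =
      P.map (fun ω k => Y (t k) ω + ∑ i, l i * c (s i) (t k)) := by
  have hY : Measurable fun ω k => Y (t k) ω := measurable_pi_lambda _ fun k => h.meas _
  have hY' : Measurable fun ω k => Y (t k) ω + ∑ i, l i * c (s i) (t k) :=
    measurable_pi_lambda _ fun k => (h.meas _).add_const _
  have hint := h.integrable_exp_sum s l
  have := isProbabilityMeasure_tilted hint
  have := Measure.isProbabilityMeasure_map (μ := P) hY'.aemeasurable
  have := Measure.isProbabilityMeasure_map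
    (μ := P.tilted fun ω => ∑ i, l i * Y (s i) ω) hY.aemeasurable
  classical
  refine Measure.ext_of_charFunDual ?_
  ext L
  let q : κ → ℝ := fun k => L (Pi.single k 1)
  have hL : ∀ z : κ → ℝ, L z = ∑ k, q k * z k := by
    intro z
    conv_lhs => rw [← Finset.univ_sum_single z, map_sum]
    refine Finset.sum_congr rfl fun k _ => ?_
    rw [← mul_one (z k), ← smul_eq_mul, Pi.single_smul', map_smul]
    simp [q, mul_comm]
  have hLm : Measurable L := L.continuous.measurable
  set m : ℝ := ∑ k, q k * ∑ i, l i * c (s i) (t k) with hm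
  have key : (P.tilted fun ω => ∑ i, l i * Y (s i) ω).map (fun ω => L fun k => Y (t k) ω) =
      P.map (fun ω => L fun k => Y (t k) ω + ∑ i, l i * c (s i) (t k)) := by
    have hmgf : mgf (fun ω => L fun k => Y (t k) ω) (P.tilted fun ω => ∑ i, l i * Y (s i) ω) =
        mgf (fun ω => L fun k => Y (t k) ω + ∑ i, l i * c (s i) (t k)) P := by
      ext r
      have h1 := h.integral_exp_sum (Sum.elim s t) (Sum.elim l fun k => r * q k)
      have h2 := h.integral_exp_sum t (fun k => r * q k)
      have h0 := h.integral_exp_sum s l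
      simp only [Fintype.sum_sum_type, Sum.elim_inl, Sum.elim_inr] at h1
      have e1 : mgf (fun ω => L fun k => Y (t k) ω) (P.tilted fun ω => ∑ i, l i * Y (s i) ω) r =
          (∫ ω, Real.exp (∑ i, l i * Y (s i) ω + ∑ k, r * q k * Y (t k) ω) ∂P) /
            ∫ ω, Real.exp (∑ i, l i * Y (s i) ω) ∂P := by
        rw [mgf, integral_exp_tilted]
        congr 2
        ext ω
        simp only [Pi.add_apply, hL, Finset.mul_sum, mul_assoc]
      have e2 : mgf (fun ω => L fun k => Y (t k) ω + ∑ i, l i * c (s i) (t k)) P r =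
          (∫ ω, Real.exp (∑ k, r * q k * Y (t k) ω) ∂P) * Real.exp (r * m) := by
        rw [mgf, ← integral_mul_const]
        congr 1
        ext ω
        simp only [← Real.exp_add, hL, hm, mul_add, Finset.mul_sum, Finset.sum_add_distrib,
          mul_assoc]
      rw [e1, e2, h1, h2, h0, ← Real.exp_sub, ← Real.exp_add]
      congr 1
      have hc : ∑ k, ∑ i, r * q k * l i * c (t k) (s i) = r * m := by
        rw [hm, Finset.mul_sum]
        refine Finset.sum_congr rfl fun k _ => ?_
        rw [Finset.mul_sum, Finset.mul_sum]
        exact Finset.sum_congr rfl fun i _ => by rw [h.symm (t k)]; ring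
      have hc' : ∑ i, ∑ k, l i * (r * q k) * c (s i) (t k) = r * m := by
        rw [← hc, Finset.sum_comm]
        exact Finset.sum_congr rfl fun k _ => Finset.sum_congr rfl fun i _ => by
          rw [h.symm (t k)]; ring
      simp only [Finset.sum_add_distrib]
      rw [hc, hc']
      ring
    have hset : integrableExpSet (fun ω => L fun k => Y (t k) ω)
        (P.tilted fun ω => ∑ i, l i * Y (s i) ω) = Set.univ := by
      ext r
      simp only [integrableExpSet, Set.mem_ofPred_eq, Set.mem_univ, iff_true]
      rw [← mgf_pos_iff, hmgf]
      refine mgf_pos ?_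
      have := (h.integrable_exp_sum t (fun k => r * q k)).mul_const (Real.exp (r * m))
      refine this.congr (Eventually.of_forall fun ω => ?_)
      simp only
      rw [← Real.exp_add]
      simp only [hL, hm, mul_add, Finset.mul_sum, Finset.sum_add_distrib, mul_assoc]
    refine Measure.ext_of_complexMGF_eq (hLm.comp hY).aemeasurable (hLm.comp hY').aemeasurable ?_
    have := eqOn_complexMGF_of_mgf hmgf
    rw [hset] at this
    ext z
    exact this (by simp)
  have hA := charFunDual_eq_charFun_map_one (μ := (P.tilted fun ω => ∑ i, l i * Y (s i) ω).map
    (fun ω k => Y (t k) ω)) L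
  have hB := charFunDual_eq_charFun_map_one
    (μ := P.map (fun ω k => Y (t k) ω + ∑ i, l i * c (s i) (t k))) L
  rw [hA, hB, Measure.map_map hLm hY, Measure.map_map hLm hY']
  exact congrArg (fun ν => charFun ν 1) key

theorem integral_tilt (h : IsGaussProc P Y c) [IsProbabilityMeasure P] {ι κ : Type*} [Fintype ι]
    [Fintype κ] (s : ι → T) (l : ι → ℝ) (t : κ → T) {F : (κ → ℝ) → ℝ} (hF : Measurable F) :
    ∫ ω, Real.exp (∑ i, l i * Y (s i) ω) * F (fun k => Y (t k) ω) ∂P =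
      Real.exp ((∑ i, ∑ j, l i * l j * c (s i) (s j)) / 2) *
        ∫ ω, F (fun k => Y (t k) ω + ∑ i, l i * c (s i) (t k)) ∂P := by
  have hY : Measurable fun ω k => Y (t k) ω := measurable_pi_lambda _ fun k => h.meas _
  have hY' : Measurable fun ω k => Y (t k) ω + ∑ i, l i * c (s i) (t k) :=
    measurable_pi_lambda _ fun k => (h.meas _).add_const _
  have h1 := integral_map (μ := P.tilted fun ω => ∑ i, l i * Y (s i) ω) hY.aemeasurable
    hF.aestronglyMeasurable
  rw [h.tilted_map s l t, integral_map hY'.aemeasurable hF.aestronglyMeasurable,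
    integral_tilted] at h1
  rw [h1, h.integral_exp_sum s l, ← integral_const_mul]
  refine integral_congr_ae (Eventually.of_forall fun ω => ?_)
  simp only [smul_eq_mul]
  field_simp

end IsGaussProc

/-- A jointly measurable family of mollified log-correlated Gaussian fields. -/
structure IsLogField {Ω : Type*} [MeasurableSpace Ω] (P : Measure Ω) (X : Scale × Pt d → Ω → ℝ)
    (C : Scale × Pt d → Scale × Pt d → ℝ) (G : Scale → Pt d → Pt d → ℝ)
    (K : Pt d → Pt d → ℝ) (c₀ : ℝ) : Prop where
  meas : ∀ ε, Measurable fun p : Pt d × Ω => X (ε, p.1) p.2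
  gauss : IsGaussProc P X C
  cov : IsLogCov C G K c₀

/-- The density of the approximate chaos at scale `ε` and position `x`. -/
def dens {Ω : Type*} (γ : ℝ) (X : Scale × Pt d → Ω → ℝ) (C : Scale × Pt d → Scale × Pt d → ℝ)
    (ε : Scale) (x : Pt d) (ω : Ω) : ℝ :=
  Real.exp (γ * X (ε, x) ω - γ ^ 2 / 2 * C (ε, x) (ε, x))

/-- The integral of `h` against the approximate chaos at scale `ε`. -/
def chaosInt {Ω : Type*} (γ : ℝ) (X : Scale × Pt d → Ω → ℝ)
    (C : Scale × Pt d → Scale × Pt d → ℝ) (h : Pt d → ℝ) (ε : Scale) (ω : Ω) : ℝ :=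
  ∫ x, h x * dens γ X C ε x ω

theorem IsLogCov.le_log_scale {C : Scale × Pt d → Scale × Pt d → ℝ} {G : Scale → Pt d → Pt d → ℝ}
    {K : Pt d → Pt d → ℝ} {c₀ : ℝ} (h : IsLogCov C G K c₀) (s t : Scale × Pt d) :
    C s t ≤ Real.log (s.1 : ℝ)⁻¹ + c₀ :=
  h.upper s.1 t.1 s.2 t.2 s.1 s.1.2.1 s.1.2.2 (le_max_of_le_left (le_max_left _ _))

theorem IsLogCov.measurable_diag {C : Scale × Pt d → Scale × Pt d → ℝ}
    {G : Scale → Pt d → Pt d → ℝ}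
    {K : Pt d → Pt d → ℝ} {c₀ : ℝ} (h : IsLogCov C G K c₀) (ε : Scale) :
    Measurable fun x => C (ε, x) (ε, x) :=
  (h.meas ε ε).comp (measurable_id.prodMk measurable_id)

theorem dens_pos {Ω : Type*} (γ : ℝ) (X : Scale × Pt d → Ω → ℝ)
    (C : Scale × Pt d → Scale × Pt d → ℝ)
    (ε : Scale) (x : Pt d) (ω : Ω) : 0 < dens γ X C ε x ω := Real.exp_pos _

theorem dens_eq {Ω : Type*} (γ : ℝ) (X : Scale × Pt d → Ω → ℝ)
    (C : Scale × Pt d → Scale × Pt d → ℝ) (ε : Scale) (x : Pt d) (ω : Ω) :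
    dens γ X C ε x ω =
      Real.exp (-(γ ^ 2 / 2 * C (ε, x) (ε, x))) * Real.exp (γ * X (ε, x) ω) := by
  rw [dens, ← Real.exp_add]
  ring_nf

namespace IsLogField

variable {Ω : Type*} [MeasurableSpace Ω] {P : Measure Ω} {X : Scale × Pt d → Ω → ℝ}
  {C : Scale × Pt d → Scale × Pt d → ℝ} {G : Scale → Pt d → Pt d → ℝ}
  {K : Pt d → Pt d → ℝ} {c₀ γ : ℝ}

theorem measurable_dens (H : IsLogField P X C G K c₀) (ε : Scale) :
    Measurable fun p : Pt d × Ω => dens γ X C ε p.1 p.2 :=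
  (((H.meas ε).const_mul γ).sub
    (((H.cov.measurable_diag ε).comp measurable_fst).const_mul _)).exp

theorem measurable_dens_right (H : IsLogField P X C G K c₀) (ε : Scale) (x : Pt d) :
    Measurable (dens γ X C ε x) :=
  (H.measurable_dens ε).comp measurable_prodMk_left

theorem measurable_dens_left (H : IsLogField P X C G K c₀) (ε : Scale) (ω : Ω) :
    Measurable fun x => dens γ X C ε x ω :=
  (H.measurable_dens ε).comp measurable_prodMk_right

theorem integrable_dens (H : IsLogField P X C G K c₀) (ε : Scale) (x : Pt d) :
    Integrable (dens γ X C ε x) P := by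
  have := (H.gauss.integrable_exp_three γ 0 0 (ε, x) (ε, x) (ε, x)).const_mul
    (Real.exp (-(γ ^ 2 / 2 * C (ε, x) (ε, x))))
  refine this.congr (Eventually.of_forall fun ω => ?_)
  simp [dens_eq]

theorem integral_dens (H : IsLogField P X C G K c₀) (ε : Scale) (x : Pt d) :
    ∫ ω, dens γ X C ε x ω ∂P = 1 := by
  have := H.gauss.integral_exp_three γ 0 0 (ε, x) (ε, x) (ε, x)
  simp only [dens_eq, integral_const_mul]
  simp only [zero_mul, add_zero, mul_zero, ne_eq, OfNat.ofNat_ne_zero, not_false_eq_true,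
    zero_pow, zero_div] at this
  rw [this, ← Real.exp_add]
  simp

/-- Mixed exponential moment of a density and one field value. -/
theorem integral_dens_mul_exp (H : IsLogField P X C G K c₀) (ε : Scale) (x : Pt d) (b : ℝ)
    (t : Scale × Pt d) :
    Integrable (fun ω => dens γ X C ε x ω * Real.exp (b * X t ω)) P ∧
    ∫ ω, dens γ X C ε x ω * Real.exp (b * X t ω) ∂P =
      Real.exp (b ^ 2 / 2 * C t t + γ * b * C (ε, x) t) := by
  have e : (fun ω => dens γ X C ε x ω * Real.exp (b * X t ω)) = fun ω =>
      Real.exp (-(γ ^ 2 / 2 * C (ε, x) (ε, x))) *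
        Real.exp (γ * X (ε, x) ω + b * X t ω + 0 * X t ω) := by
    ext ω
    rw [dens_eq, mul_assoc, ← Real.exp_add (γ * _)]
    simp
  rw [e, integral_const_mul, H.gauss.integral_exp_three, ← Real.exp_add]
  refine ⟨(H.gauss.integrable_exp_three _ _ _ _ _ _).const_mul _, ?_⟩
  ring_nf

/-- Mixed exponential moment of a density and two field values. -/
theorem integral_dens_mul_exp_two (H : IsLogField P X C G K c₀) (ε : Scale) (x : Pt d) (a b : ℝ)
    (s t : Scale × Pt d) :
    Integrable (fun ω => dens γ X C ε x ω * Real.exp (a * X s ω + b * X t ω)) P ∧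
    ∫ ω, dens γ X C ε x ω * Real.exp (a * X s ω + b * X t ω) ∂P =
      Real.exp (a ^ 2 / 2 * C s s + b ^ 2 / 2 * C t t + a * b * C s t + γ * a * C (ε, x) s +
        γ * b * C (ε, x) t) := by
  have e : (fun ω => dens γ X C ε x ω * Real.exp (a * X s ω + b * X t ω)) = fun ω =>
      Real.exp (-(γ ^ 2 / 2 * C (ε, x) (ε, x))) *
        Real.exp (γ * X (ε, x) ω + a * X s ω + b * X t ω) := by
    ext ω
    rw [dens_eq, mul_assoc, ← Real.exp_add (γ * _)]
    ring_nf
  rw [e, integral_const_mul, H.gauss.integral_exp_three, ← Real.exp_add]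
  refine ⟨(H.gauss.integrable_exp_three _ _ _ _ _ _).const_mul _, ?_⟩
  ring_nf

/-- Mixed exponential moment of two densities and one field value. -/
theorem integral_dens_mul_dens_mul_exp (H : IsLogField P X C G K c₀) (ε ε' : Scale) (x y : Pt d)
    (b : ℝ) (t : Scale × Pt d) :
    Integrable (fun ω => dens γ X C ε x ω * dens γ X C ε' y ω * Real.exp (b * X t ω)) P ∧
    ∫ ω, dens γ X C ε x ω * dens γ X C ε' y ω * Real.exp (b * X t ω) ∂P =
      Real.exp (γ ^ 2 * C (ε, x) (ε', y) + b ^ 2 / 2 * C t t +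
        γ * b * (C (ε, x) t + C (ε', y) t)) := by
  have e : (fun ω => dens γ X C ε x ω * dens γ X C ε' y ω * Real.exp (b * X t ω)) = fun ω =>
      (Real.exp (-(γ ^ 2 / 2 * C (ε, x) (ε, x))) * Real.exp (-(γ ^ 2 / 2 * C (ε', y) (ε', y)))) *
        Real.exp (γ * X (ε, x) ω + γ * X (ε', y) ω + b * X t ω) := by
    ext ω
    rw [dens_eq, dens_eq, Real.exp_add, Real.exp_add]
    ring
  rw [e, integral_const_mul, H.gauss.integral_exp_three, ← Real.exp_add, ← Real.exp_add]
  refine ⟨(H.gauss.integrable_exp_three _ _ _ _ _ _).const_mul _, ?_⟩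
  ring_nf

variable [IsProbabilityMeasure P]

theorem integrable_prod_dens (H : IsLogField P X C G K c₀) {h : Pt d → ℝ} (hh : Integrable h)
    (ε : Scale) :
    Integrable (fun p : Pt d × Ω => h p.1 * dens γ X C ε p.1 p.2) (volume.prod P) := by
  have hm : AEStronglyMeasurable (fun p : Pt d × Ω => h p.1 * dens γ X C ε p.1 p.2)
      (volume.prod P) :=
    hh.aestronglyMeasurable.comp_fst.mul (H.measurable_dens ε).aestronglyMeasurable
  rw [integrable_prod_iff hm]
  refine ⟨Eventually.of_forall fun x =>
    (H.integrable_dens (γ := γ) ε x).const_mul (h x), ?_⟩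
  refine hh.norm.congr (Eventually.of_forall fun x => ?_)
  simp only [norm_mul, Real.norm_of_nonneg (dens_pos γ X C ε x _).le]
  rw [integral_const_mul, H.integral_dens, mul_one]

theorem integrable_chaosInt (H : IsLogField P X C G K c₀) {h : Pt d → ℝ} (hh : Integrable h)
    (ε : Scale) : Integrable (chaosInt γ X C h ε) P :=
  (H.integrable_prod_dens hh ε).integral_prod_right

theorem integral_chaosInt (H : IsLogField P X C G K c₀) {h : Pt d → ℝ} (hh : Integrable h)
    (ε : Scale) : ∫ ω, chaosInt γ X C h ε ω ∂P = ∫ x, h x := by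
  simp only [chaosInt]
  rw [← integral_integral_swap (f := fun x ω => h x * dens γ X C ε x ω)
    (H.integrable_prod_dens hh ε)]
  refine integral_congr_ae (Eventually.of_forall fun x => ?_)
  simp only
  rw [integral_const_mul, H.integral_dens, mul_one]

theorem ae_integrable_dens (H : IsLogField P X C G K c₀) {h : Pt d → ℝ} (hh : Integrable h)
    (ε : Scale) : ∀ᵐ ω ∂P, Integrable fun x => h x * dens γ X C ε x ω :=
  (H.integrable_prod_dens hh ε).prod_left_ae

theorem integral_abs_chaosInt_le (H : IsLogField P X C G K c₀) {h : Pt d → ℝ} (hh : Integrable h)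
    (ε : Scale) : ∫ ω, |chaosInt γ X C h ε ω| ∂P ≤ ∫ x, |h x| := by
  rw [← H.integral_chaosInt (γ := γ) hh.abs ε]
  refine integral_mono (H.integrable_chaosInt hh ε).abs (H.integrable_chaosInt hh.abs ε) fun ω => ?_
  refine (abs_integral_le_integral_abs).trans_eq ?_
  refine integral_congr_ae (Eventually.of_forall fun x => ?_)
  simp only [abs_mul, abs_of_pos (dens_pos γ X C ε x ω)]

theorem chaosInt_sub_ae (H : IsLogField P X C G K c₀) {h k : Pt d → ℝ} (hh : Integrable h)
    (hk : Integrable k) (ε : Scale) :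
    ∀ᵐ ω ∂P, chaosInt γ X C (h - k) ε ω = chaosInt γ X C h ε ω - chaosInt γ X C k ε ω := by
  filter_upwards [H.ae_integrable_dens (γ := γ) hh ε, H.ae_integrable_dens (γ := γ) hk ε]
    with ω h1 h2
  simp only [chaosInt]
  rw [← integral_sub h1 h2]
  simp only [Pi.sub_apply, sub_mul]

theorem integral_abs_chaosInt_sub_le (H : IsLogField P X C G K c₀) {h k : Pt d → ℝ}
    (hh : Integrable h) (hk : Integrable k) (ε : Scale) :
    ∫ ω, |chaosInt γ X C h ε ω - chaosInt γ X C k ε ω| ∂P ≤ ∫ x, |h x - k x| := by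
  refine le_trans (le_of_eq ?_) (H.integral_abs_chaosInt_le (γ := γ) (hh.sub hk) ε)
  refine integral_congr_ae ?_
  filter_upwards [H.chaosInt_sub_ae (γ := γ) hh hk ε] with ω hω
  rw [hω]

end IsLogField

/-- The scale `exp (-k)`. -/
def expScale (k : ℕ) : Scale := ⟨Real.exp (-k), Real.exp_pos _, Real.exp_le_one_iff.2 (by simp)⟩

theorem coe_expScale (k : ℕ) : (expScale k : ℝ) = Real.exp (-k) := rfl

theorem log_inv_expScale (k : ℕ) : Real.log (Real.exp (-(k : ℝ)))⁻¹ = k := by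
  rw [Real.log_inv, Real.log_exp, neg_neg]

/-- The point of the lattice of mesh `exp (-k)` with integer coordinates `n`. -/
def meshPt (k : ℕ) (n : Fin d → ℤ) : Pt d := WithLp.toLp 2 fun i => Real.exp (-k) * n i

/-- The integer coordinates of the lattice cell containing `x`. -/
def cellIdx (k : ℕ) (x : Pt d) (i : Fin d) : ℤ := ⌊Real.exp k * x i⌋

/-- The lattice approximation of `x` at mesh `exp (-k)`. -/
def cellPt (k : ℕ) (x : Pt d) : Pt d := meshPt k (cellIdx k x)

theorem measurable_cellPt (k : ℕ) : Measurable (cellPt k : Pt d → Pt d) := by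
  unfold cellPt meshPt cellIdx
  refine (WithLp.measurable_toLp 2 _).comp (measurable_pi_lambda _ fun i => ?_)
  have h1 : Measurable fun x : Pt d => x i := by fun_prop
  have h2 : Measurable fun n : ℤ => (n : ℝ) := measurable_from_top
  exact (h2.comp (Int.measurable_floor.comp (h1.const_mul _))).const_mul _

theorem dist_cellPt_le (k : ℕ) (x : Pt d) : dist x (cellPt k x) ≤ √d * Real.exp (-k) := by
  rw [EuclideanSpace.dist_eq]
  have hk : 0 < Real.exp (-(k : ℝ)) := Real.exp_pos _
  have : ∀ i, dist (x i) (cellPt k x i) ^ 2 ≤ Real.exp (-k) ^ 2 := by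
    intro i
    have h1 := Int.floor_le (Real.exp k * x i)
    have h2 := (Int.lt_floor_add_one (Real.exp k * x i)).le
    have e : Real.exp (-(k : ℝ)) * (Real.exp k * x i) = x i := by
      rw [← mul_assoc, ← Real.exp_add]; simp
    have e1 := mul_le_mul_of_nonneg_left h1 hk.le
    have e2 := mul_le_mul_of_nonneg_left h2 hk.le
    rw [e] at e1 e2
    rw [Real.dist_eq, sq_le_sq₀ (abs_nonneg _) hk.le, abs_le]
    simp only [cellPt, meshPt, cellIdx]
    constructor <;> linarith
  calc √(∑ i, dist (x i) (cellPt k x i) ^ 2) ≤ √(∑ _i : Fin d, Real.exp (-k) ^ 2) :=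
        Real.sqrt_le_sqrt (Finset.sum_le_sum fun i _ => this i)
    _ = _ := by
      rw [Finset.sum_const, Finset.card_univ, Fintype.card_fin, nsmul_eq_mul,
        Real.sqrt_mul (by positivity), Real.sqrt_sq hk.le]

/-- Only `O(exp (d k))` lattice points are needed to approximate a ball. -/
theorem exists_finset_cellPt (R : ℝ) (hR : 0 ≤ R) (k : ℕ) : ∃ S : Finset (Pt d),
    (∀ x : Pt d, ‖x‖ ≤ R → cellPt k x ∈ S) ∧
      (S.card : ℝ) ≤ (2 * R + 5) ^ d * Real.exp (d * k) := by
  classical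
  set N : ℤ := ⌈Real.exp k * R⌉ + 1 with hN
  have hk1 : 1 ≤ Real.exp (k : ℝ) := Real.one_le_exp (by positivity)
  have hNr : (N : ℝ) = ⌈Real.exp k * R⌉ + 1 := by rw [hN]; push_cast; rfl
  have hN0 : 0 ≤ N := by
    have : 0 ≤ ⌈Real.exp k * R⌉ := Int.ceil_nonneg (by positivity)
    omega
  refine ⟨(Fintype.piFinset fun _ : Fin d => Finset.Icc (-N) N).image (meshPt k), ?_, ?_⟩
  · intro x hx
    refine Finset.mem_image.2 ⟨cellIdx k x, ?_, rfl⟩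
    rw [Fintype.mem_piFinset]
    intro i
    have h1 : |x i| ≤ R := (PiLp.norm_apply_le x i).trans hx
    have h2 : |Real.exp k * x i| ≤ Real.exp k * R := by
      rw [abs_mul, abs_of_pos (Real.exp_pos _)]
      gcongr
    have h3 := abs_le.1 h2
    have h4 := Int.le_ceil (Real.exp k * R)
    rw [Finset.mem_Icc]
    constructor
    · refine Int.le_floor.2 ?_
      push_cast
      linarith
    · refine Int.floor_le_iff.2 ?_
      push_cast
      linarith
  · calc (((Fintype.piFinset fun _ : Fin d => Finset.Icc (-N) N).image (meshPt k)).card : ℝ)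
        ≤ ((Fintype.piFinset fun _ : Fin d => Finset.Icc (-N) N).card : ℝ) := by
          exact_mod_cast Finset.card_image_le
      _ = (2 * N + 1 : ℝ) ^ d := by
        rw [Fintype.card_piFinset]
        simp only [Int.card_Icc, Finset.prod_const, Finset.card_univ, Fintype.card_fin,
          Nat.cast_pow]
        congr 1
        have : ((N + 1 - -N).toNat : ℤ) = 2 * N + 1 := by omega
        exact_mod_cast this
      _ ≤ ((2 * R + 5) * Real.exp k) ^ d := by
        have h5 := (Int.ceil_lt_add_one (Real.exp k * R)).le
        have h6 : (N : ℝ) ≤ Real.exp k * R + 2 := by rw [hN]; push_cast; linarith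
        have h7 : (0 : ℝ) ≤ N := by exact_mod_cast hN0
        gcongr
        nlinarith
      _ = _ := by rw [mul_pow, ← Real.exp_nat_mul]

namespace IsLogField

variable {Ω : Type*} [MeasurableSpace Ω] {P : Measure Ω} {X : Scale × Pt d → Ω → ℝ}
  {C : Scale × Pt d → Scale × Pt d → ℝ} {G : Scale → Pt d → Pt d → ℝ}
  {K : Pt d → Pt d → ℝ} {c₀ γ : ℝ}

/-- A unit-mean exponential of the field value at `t` under the tilted law `dens γ X C ε x • P`. -/
def tiltExp (γ : ℝ) (X : Scale × Pt d → Ω → ℝ) (C : Scale × Pt d → Scale × Pt d → ℝ)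
    (s : Scale × Pt d) (a : ℝ) (t : Scale × Pt d) (ω : Ω) : ℝ :=
  Real.exp (a * X t ω - γ * a * C s t - a ^ 2 / 2 * C t t)

theorem integral_dens_mul_tiltExp (H : IsLogField P X C G K c₀) (ε : Scale) (x : Pt d) (a b : ℝ)
    (s t : Scale × Pt d) :
    Integrable (fun ω => dens γ X C ε x ω *
      ((1 - tiltExp γ X C (ε, x) a s ω) * (1 - tiltExp γ X C (ε, x) b t ω))) P ∧
    ∫ ω, dens γ X C ε x ω *
      ((1 - tiltExp γ X C (ε, x) a s ω) * (1 - tiltExp γ X C (ε, x) b t ω)) ∂P =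
      Real.exp (a * b * C s t) - 1 := by
  obtain ⟨i1, h1⟩ := H.integral_dens_mul_exp (γ := γ) ε x a s
  obtain ⟨i2, h2⟩ := H.integral_dens_mul_exp (γ := γ) ε x b t
  obtain ⟨i3, h3⟩ := H.integral_dens_mul_exp_two (γ := γ) ε x a b s t
  set p := -(γ * a * C (ε, x) s) - a ^ 2 / 2 * C s s with hp
  set q := -(γ * b * C (ε, x) t) - b ^ 2 / 2 * C t t with hq
  have e : (fun ω => dens γ X C ε x ω *
      ((1 - tiltExp γ X C (ε, x) a s ω) * (1 - tiltExp γ X C (ε, x) b t ω))) = fun ω =>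
      (dens γ X C ε x ω - Real.exp p * (dens γ X C ε x ω * Real.exp (a * X s ω))) -
        (Real.exp q * (dens γ X C ε x ω * Real.exp (b * X t ω)) -
          Real.exp (p + q) * (dens γ X C ε x ω * Real.exp (a * X s ω + b * X t ω))) := by
    ext ω
    have e1 : tiltExp γ X C (ε, x) a s ω = Real.exp p * Real.exp (a * X s ω) := by
      rw [tiltExp, ← Real.exp_add, hp]; ring_nf
    have e2 : tiltExp γ X C (ε, x) b t ω = Real.exp q * Real.exp (b * X t ω) := by
      rw [tiltExp, ← Real.exp_add, hq]; ring_nf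
    rw [e1, e2, Real.exp_add p q, Real.exp_add (a * _)]
    ring
  have j0 := H.integrable_dens (γ := γ) ε x
  have j1 := i1.const_mul (Real.exp p)
  have j2 := i2.const_mul (Real.exp q)
  have j3 := i3.const_mul (Real.exp (p + q))
  rw [e]
  refine ⟨(j0.sub j1).sub (j2.sub j3), ?_⟩
  refine (integral_sub (j0.sub j1) (j2.sub j3)).trans ?_
  simp only [Pi.sub_apply]
  rw [integral_sub j0 j1, integral_sub j2 j3,
    integral_const_mul, integral_const_mul, integral_const_mul, h1, h2, h3, H.integral_dens,
    ← Real.exp_add, ← Real.exp_add, ← Real.exp_add]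
  have e3 : p + (a ^ 2 / 2 * C s s + γ * a * C (ε, x) s) = 0 := by rw [hp]; ring
  have e4 : q + (b ^ 2 / 2 * C t t + γ * b * C (ε, x) t) = 0 := by rw [hq]; ring
  have e5 : p + q + (a ^ 2 / 2 * C s s + b ^ 2 / 2 * C t t + a * b * C s t + γ * a * C (ε, x) s +
        γ * b * C (ε, x) t) = a * b * C s t := by rw [hp, hq]; ring
  rw [e3, e4, e5, Real.exp_zero]
  ring

theorem integral_dens_mul_sum_sq (H : IsLogField P X C G K c₀) (ε : Scale) (x : Pt d) {J : ℕ}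
    (a : Fin J → ℝ) (t : Fin J → Scale × Pt d) :
    Integrable (fun ω => dens γ X C ε x ω *
      (∑ j, (1 - tiltExp γ X C (ε, x) (a j) (t j) ω)) ^ 2) P ∧
    ∫ ω, dens γ X C ε x ω * (∑ j, (1 - tiltExp γ X C (ε, x) (a j) (t j) ω)) ^ 2 ∂P =
      ∑ i, ∑ j, (Real.exp (a i * a j * C (t i) (t j)) - 1) := by
  have e : (fun ω => dens γ X C ε x ω * (∑ j, (1 - tiltExp γ X C (ε, x) (a j) (t j) ω)) ^ 2) =
      fun ω => ∑ i, ∑ j, dens γ X C ε x ω * ((1 - tiltExp γ X C (ε, x) (a i) (t i) ω) *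
        (1 - tiltExp γ X C (ε, x) (a j) (t j) ω)) := by
    ext ω
    rw [sq, Finset.sum_mul_sum, Finset.mul_sum]
    exact Finset.sum_congr rfl fun i _ => Finset.mul_sum _ _ _
  have hi : ∀ i j, Integrable (fun ω => dens γ X C ε x ω *
      ((1 - tiltExp γ X C (ε, x) (a i) (t i) ω) * (1 - tiltExp γ X C (ε, x) (a j) (t j) ω))) P :=
    fun i j => (H.integral_dens_mul_tiltExp ε x _ _ _ _).1
  rw [e]
  refine ⟨integrable_finsetSum _ fun i _ => integrable_finsetSum _ fun j _ => hi i j, ?_⟩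
  rw [integral_finsetSum _ fun i _ => integrable_finsetSum _ fun j _ => hi i j]
  refine Finset.sum_congr rfl fun i _ => ?_
  rw [integral_finsetSum _ fun j _ => hi i j]
  exact Finset.sum_congr rfl fun j _ => (H.integral_dens_mul_tiltExp ε x _ _ _ _).2

theorem measure_gt_le [IsProbabilityMeasure P] (H : IsLogField P X C G K c₀) (hγ : 0 < γ) (k : ℕ)
    (z : Pt d) (L : ℝ) :
    P.real {ω | γ * k + L < X (expScale k, z) ω} ≤
      Real.exp (-(γ ^ 2 / 2) * k) * Real.exp (γ ^ 2 / 2 * c₀ - γ * L) := by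
  have h0 : Integrable (fun ω => Real.exp (γ * X (expScale k, z) ω)) P := by
    simpa using H.gauss.integrable_exp_three γ 0 0 (expScale k, z) (expScale k, z) (expScale k, z)
  have h1 := measure_ge_le_exp_mul_mgf (μ := P) (X := X (expScale k, z)) (γ * k + L) hγ.le h0
  have h2 : mgf (X (expScale k, z)) P γ =
      Real.exp (γ ^ 2 / 2 * C (expScale k, z) (expScale k, z)) := by
    have := H.gauss.integral_exp_three γ 0 0 (expScale k, z) (expScale k, z) (expScale k, z)
    simpa [mgf] using this
  have h3 : C (expScale k, z) (expScale k, z) ≤ k + c₀ := by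
    have := H.cov.le_log_scale (expScale k, z) (expScale k, z)
    rwa [coe_expScale, log_inv_expScale] at this
  have h4 : P.real {ω | γ * k + L < X (expScale k, z) ω} ≤
      P.real {ω | γ * k + L ≤ X (expScale k, z) ω} :=
    measureReal_mono (fun ω hω => le_of_lt (Set.mem_ofPred_eq ▸ hω)) (measure_ne_top _ _)
  refine h4.trans (h1.trans ?_)
  rw [h2, ← Real.exp_add, ← Real.exp_add]
  refine Real.exp_le_exp.2 ?_
  have : γ ^ 2 / 2 * C (expScale k, z) (expScale k, z) ≤ γ ^ 2 / 2 * (k + c₀) := by gcongr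
  linarith

theorem cov_cellPt_le (H : IsLogField P X C G K c₀) (s : Scale × Pt d) (k : ℕ) (z : Pt d) :
    C s (expScale k, z) ≤ k + c₀ := by
  have := H.cov.le_log_scale (expScale k, z) s
  rwa [coe_expScale, log_inv_expScale, H.gauss.symm] at this

theorem le_cov_of_le (H : IsLogField P X C G K c₀) (ε ε' : Scale) (x y : Pt d) (k : ℕ)
    (h : max (max (ε : ℝ) ε') (dist x y) ≤ (1 + √d) * Real.exp (-k)) :
    k - (Real.log (1 + √d) + c₀) ≤ C (ε, x) (ε', y) := by
  have := H.cov.lower ε ε' x y _ h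
  rw [mul_inv, Real.log_mul (by positivity) (by positivity), log_inv_expScale, Real.log_inv] at this
  linarith

theorem le_cov_cellPt (H : IsLogField P X C G K c₀) (ε : Scale) (x : Pt d) (k : ℕ)
    (hε : (ε : ℝ) ≤ Real.exp (-k)) :
    k - (Real.log (1 + √d) + c₀) ≤ C (ε, x) (expScale k, cellPt k x) := by
  refine H.le_cov_of_le _ _ _ _ k ?_
  have h1 := dist_cellPt_le k x
  have h2 : 0 ≤ √d * Real.exp (-(k : ℝ)) := by positivity
  have h3 := Real.exp_pos (-(k : ℝ))
  rw [coe_expScale]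
  refine max_le (max_le ?_ ?_) ?_ <;> linarith

end IsLogField

namespace IsLogField

variable {Ω : Type*} [MeasurableSpace Ω] {P : Measure Ω} {X : Scale × Pt d → Ω → ℝ}
  {C : Scale × Pt d → Scale × Pt d → ℝ} {G : Scale → Pt d → Pt d → ℝ}
  {K : Pt d → Pt d → ℝ} {c₀ γ : ℝ}

theorem tiltExp_le (H : IsLogField P X C G K c₀) (hγ : 0 < γ) {ε : Scale} {x : Pt d} {k : ℕ}
    {w L : ℝ} (hw : 0 < w) (hwk : w ^ 2 = k) (hk : 4 * c₀ ≤ k) (hε : (ε : ℝ) ≤ Real.exp (-k))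
    (hwL : 8 * (L + γ * (Real.log (1 + √d) + c₀)) ≤ w) {ω : Ω}
    (hω : X (expScale k, cellPt k x) ω ≤ γ * k + L) :
    tiltExp γ X C (ε, x) w⁻¹ (expScale k, cellPt k x) ω ≤ 4 / 5 := by
  set t : Scale × Pt d := (expScale k, cellPt k x) with ht
  have hk0 : (0 : ℝ) < k := hwk ▸ by positivity
  have h1 := H.le_cov_cellPt ε x k hε
  have h2 : k - c₀ ≤ C t t := by
    have := H.cov.lower (expScale k) (expScale k) (cellPt k x) (cellPt k x) (Real.exp (-k))
      (by simp [coe_expScale, (Real.exp_pos _).le])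
    rwa [log_inv_expScale] at this
  have h3 : X t ω - γ * C (ε, x) t ≤ w / 8 := by
    have : γ * (k - (Real.log (1 + √d) + c₀)) ≤ γ * C (ε, x) t := by gcongr
    linarith
  have h4 : w⁻¹ * X t ω - γ * w⁻¹ * C (ε, x) t - w⁻¹ ^ 2 / 2 * C t t ≤ -(1 / 4) := by
    have e1 : w⁻¹ * X t ω - γ * w⁻¹ * C (ε, x) t = w⁻¹ * (X t ω - γ * C (ε, x) t) := by ring
    have e2 : w⁻¹ * (X t ω - γ * C (ε, x) t) ≤ w⁻¹ * (w / 8) := by gcongr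
    have e3 : w⁻¹ * (w / 8) = 1 / 8 := by field_simp
    have e4 : (3 : ℝ) / 8 ≤ w⁻¹ ^ 2 / 2 * C t t := by
      rw [inv_pow, hwk]
      have : (k : ℝ)⁻¹ / 2 * (3 / 4 * k) ≤ (k : ℝ)⁻¹ / 2 * C t t := by
        gcongr
        linarith
      refine le_trans (le_of_eq ?_) this
      field_simp
      norm_num
    linarith
  refine (Real.exp_le_exp.2 h4).trans ?_
  rw [Real.exp_neg]
  have := Real.add_one_le_exp (1 / 4 : ℝ)
  rw [inv_le_comm₀ (Real.exp_pos _) (by norm_num)]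
  linarith

theorem setIntegral_dens_le (H : IsLogField P X C G K c₀) {ε : Scale} {x : Pt d} {J n : ℕ}
    (hJ : 0 < J) (hn : 2 ≤ n) {a : Fin J → ℝ} {t : Fin J → Scale × Pt d} {A : Set Ω}
    (hAm : MeasurableSet A)
    (hA : ∀ ω ∈ A, ∀ j, tiltExp γ X C (ε, x) (a j) (t j) ω ≤ 4 / 5)
    (hρ : ∀ i j, a i * a j * C (t i) (t j) ≤ if i = j then (2 : ℝ) else 2 / (n : ℝ)) :
    ∫ ω in A, dens γ X C ε x ω ∂P ≤ 175 / J + 100 / n := by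
  have hJ' : (0 : ℝ) < J := by exact_mod_cast hJ
  have hn' : (2 : ℝ) ≤ n := by exact_mod_cast hn
  obtain ⟨hi, hv⟩ := H.integral_dens_mul_sum_sq (γ := γ) ε x a t
  have h1 : ∫ ω in A, dens γ X C ε x ω ∂P ≤ ∫ ω in A, 25 / J ^ 2 * (dens γ X C ε x ω *
      (∑ j, (1 - tiltExp γ X C (ε, x) (a j) (t j) ω)) ^ 2) ∂P := by
    refine setIntegral_mono_on (H.integrable_dens ε x).integrableOn
      (hi.const_mul _).integrableOn hAm fun ω hω => ?_
    have h2 : (J : ℝ) / 5 ≤ ∑ j, (1 - tiltExp γ X C (ε, x) (a j) (t j) ω) := by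
      have : ∑ _j : Fin J, (1 / 5 : ℝ) ≤ ∑ j, (1 - tiltExp γ X C (ε, x) (a j) (t j) ω) :=
        Finset.sum_le_sum fun j _ => by linarith [hA ω hω j]
      simpa [div_eq_mul_inv] using this
    have h3 : ((J : ℝ) / 5) ^ 2 ≤ (∑ j, (1 - tiltExp γ X C (ε, x) (a j) (t j) ω)) ^ 2 := by
      gcongr
    have h4 := dens_pos γ X C ε x ω
    calc dens γ X C ε x ω = 25 / J ^ 2 * (dens γ X C ε x ω * ((J : ℝ) / 5) ^ 2) := by
          field_simp; norm_num
      _ ≤ _ := by gcongr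
  have h2 : ∫ ω in A, 25 / J ^ 2 * (dens γ X C ε x ω *
      (∑ j, (1 - tiltExp γ X C (ε, x) (a j) (t j) ω)) ^ 2) ∂P ≤
      25 / J ^ 2 * ∑ i, ∑ j, (Real.exp (a i * a j * C (t i) (t j)) - 1) := by
    rw [← hv, ← integral_const_mul]
    exact setIntegral_le_integral (hi.const_mul _) (Eventually.of_forall fun ω =>
      mul_nonneg (by positivity) (mul_nonneg (dens_pos γ X C ε x ω).le (sq_nonneg _)))
  have h3 : ∀ i j, Real.exp (a i * a j * C (t i) (t j)) - 1 ≤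
      (if i = j then 7 else 0) + 4 / (n : ℝ) := by
    intro i j
    have h4 := hρ i j
    have h5 : (0 : ℝ) ≤ 4 / n := by positivity
    split_ifs at h4 ⊢ with hij
    · have h6 := Real.exp_le_exp.2 h4
      have h7 : Real.exp 2 ≤ 8 := by
        have := Real.exp_one_lt_d9
        have e : Real.exp 2 = Real.exp 1 * Real.exp 1 := by rw [← Real.exp_add]; norm_num
        rw [e]
        nlinarith [Real.exp_pos 1]
      linarith
    · have h6 := Real.exp_le_exp.2 h4
      have h7 : |2 / (n : ℝ)| ≤ 1 := by
        rw [abs_of_nonneg (by positivity), div_le_one (by linarith)]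
        exact hn'
      have h8 := (le_abs_self _).trans (Real.abs_exp_sub_one_le h7)
      rw [abs_of_nonneg (by positivity)] at h8
      have : 2 * (2 / (n : ℝ)) = 4 / n := by ring
      linarith
  have h4 : ∑ i, ∑ j, (Real.exp (a i * a j * C (t i) (t j)) - 1) ≤ 7 * J + J ^ 2 * (4 / n) := by
    refine (Finset.sum_le_sum fun i _ => Finset.sum_le_sum fun j _ => h3 i j).trans_eq ?_
    simp [Finset.sum_add_distrib]
    ring
  calc _ ≤ 25 / J ^ 2 * ∑ i, ∑ j, (Real.exp (a i * a j * C (t i) (t j)) - 1) := h1.trans h2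
    _ ≤ 25 / J ^ 2 * (7 * J + J ^ 2 * (4 / n)) := by gcongr
    _ = _ := by field_simp; ring

/-- For `γ² ≥ 2d` the tilted laws concentrate on an event of small probability. -/
theorem exists_bad [IsProbabilityMeasure P] (H : IsLogField P X C G K c₀) (hγ : 0 < γ)
    (hγd : (d : ℝ) ≤ γ ^ 2 / 2) {η R : ℝ} (hη : 0 < η) (hR : 0 ≤ R) :
    ∃ A, MeasurableSet A ∧ P.real A ≤ η ∧ ∀ᶠ ε in smallScale, ∀ x : Pt d, ‖x‖ ≤ R →
      ∫ ω in Aᶜ, dens γ X C ε x ω ∂P ≤ η := by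
  obtain ⟨J, hJ⟩ := exists_nat_ge (350 / η + 1)
  have hJ1 : (1 : ℝ) ≤ J := le_trans (by have : 0 < 350 / η := by positivity
                                         linarith) hJ
  have hJ0 : 0 < J := by exact_mod_cast (zero_lt_one.trans_le hJ1)
  have hJη : 175 / (J : ℝ) ≤ η / 2 := by
    have : 350 / η ≤ J := by linarith
    rw [div_le_iff₀ hη] at this
    rw [div_le_iff₀ (by linarith)]
    linarith
  obtain ⟨L, hL⟩ : ∃ L : ℝ, J * (2 * R + 5) ^ d * Real.exp (γ ^ 2 / 2 * c₀ - γ * L) ≤ η := by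
    have h1 : Tendsto (fun L : ℝ => J * (2 * R + 5) ^ d * Real.exp (γ ^ 2 / 2 * c₀ - γ * L)) atTop
        (𝓝 (J * (2 * R + 5) ^ d * 0)) := by
      refine (Real.tendsto_exp_atBot.comp ?_).const_mul _
      exact tendsto_atBot_add_const_left _ _
        (tendsto_neg_atTop_atBot.comp (tendsto_id.const_mul_atTop hγ))
    rw [mul_zero] at h1
    exact (h1.eventually_le_const hη).exists
  obtain ⟨n, hn⟩ := exists_nat_ge
    (max (max 2 (200 / η)) (max (4 * c₀) (8 * (L + γ * (Real.log (1 + √d) + c₀)))))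
  simp only [max_le_iff] at hn
  obtain ⟨⟨hn2, hnη⟩, hnc, hnL⟩ := hn
  have hn2' : 2 ≤ n := by exact_mod_cast hn2
  have hnη' : 100 / (n : ℝ) ≤ η / 2 := by
    rw [div_le_iff₀ hη] at hnη
    rw [div_le_iff₀ (by linarith)]
    linarith
  set k : Fin J → ℕ := fun j => n ^ (2 * (j.1 + 1)) with hk
  set w : Fin J → ℝ := fun j => (n : ℝ) ^ (j.1 + 1) with hw
  have hwk : ∀ j, w j ^ 2 = k j := fun j => by simp only [hw, hk]; push_cast; ring
  have hnw : ∀ j, (n : ℝ) ≤ w j := fun j => le_self_pow₀ (by linarith) (by omega)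
  have hnk : ∀ j, (n : ℝ) ≤ k j := fun j => by
    rw [← hwk]; nlinarith [hnw j]
  have hw0 : ∀ j, 0 < w j := fun j => by linarith [hnw j]
  choose S hS hScard using fun j : Fin J => exists_finset_cellPt (d := d) R hR (k j)
  set A : Set Ω := ⋃ j, ⋃ c ∈ S j, {ω | γ * k j + L < X (expScale (k j), c) ω} with hAdef
  have hAm : MeasurableSet A := MeasurableSet.iUnion fun j => Finset.measurableSet_biUnion _
    fun c _ => measurableSet_lt measurable_const (H.gauss.meas _)
  refine ⟨A, hAm, ?_, ?_⟩
  · have h1 : ∀ j, P.real (⋃ c ∈ S j, {ω | γ * k j + L < X (expScale (k j), c) ω}) ≤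
        (2 * R + 5) ^ d * Real.exp (γ ^ 2 / 2 * c₀ - γ * L) := by
      intro j
      refine (measureReal_biUnion_finset_le _ _).trans ?_
      refine (Finset.sum_le_sum fun c _ => H.measure_gt_le hγ (k j) c L).trans ?_
      rw [Finset.sum_const, nsmul_eq_mul]
      calc ((S j).card : ℝ) * (Real.exp (-(γ ^ 2 / 2) * k j) *
            Real.exp (γ ^ 2 / 2 * c₀ - γ * L))
          ≤ ((2 * R + 5) ^ d * Real.exp (d * k j)) * (Real.exp (-(γ ^ 2 / 2) * k j) *
            Real.exp (γ ^ 2 / 2 * c₀ - γ * L)) := by gcongr; exact hScard j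
        _ = (2 * R + 5) ^ d * Real.exp ((d - γ ^ 2 / 2) * k j) *
            Real.exp (γ ^ 2 / 2 * c₀ - γ * L) := by
            have : (d - γ ^ 2 / 2) * (k j : ℝ) = d * k j + -(γ ^ 2 / 2) * k j := by ring
            rw [this, Real.exp_add]; ring
        _ ≤ (2 * R + 5) ^ d * 1 * Real.exp (γ ^ 2 / 2 * c₀ - γ * L) := by
            gcongr
            refine Real.exp_le_one_iff.2 (mul_nonpos_of_nonpos_of_nonneg (by linarith) ?_)
            positivity
        _ = _ := by ring
    refine (measureReal_iUnion_fintype_le _).trans ?_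
    refine (Finset.sum_le_sum fun j _ => h1 j).trans ?_
    simpa [mul_assoc] using hL
  · filter_upwards [eventually_smallScale_le (Real.exp_pos (-((n ^ (2 * J) : ℕ) : ℝ)))]
      with ε hε x hx
    refine (H.setIntegral_dens_le (γ := γ) hJ0 hn2' (a := fun j => (w j)⁻¹)
      (t := fun j => (expScale (k j), cellPt (k j) x)) hAm.compl ?_ ?_).trans (by linarith)
    · intro ω hω j
      refine H.tiltExp_le hγ (hw0 j) (hwk j) (hnc.trans (hnk j)) (hε.trans ?_)
        (hnL.trans (hnw j)) ?_
      · have : k j ≤ n ^ (2 * J) := Nat.pow_le_pow_right (by omega) (by omega)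
        gcongr
      · by_contra! hc
        exact hω (Set.mem_iUnion.2 ⟨j, Set.mem_iUnion₂.2 ⟨_, hS j x hx, hc⟩⟩)
    · have key : ∀ i j : Fin J, C (expScale (k i), cellPt (k i) x)
          (expScale (k j), cellPt (k j) x) ≤ 5 / 4 * w i ^ 2 := fun i j => by
        have h1 := H.cov_cellPt_le (expScale (k j), cellPt (k j) x) (k i) (cellPt (k i) x)
        rw [H.gauss.symm] at h1
        have h2 := hnk i
        rw [hwk]
        linarith
      have hlt : ∀ i j : Fin J, i < j → (w i)⁻¹ * (w j)⁻¹ * (5 / 4 * w i ^ 2) ≤ 2 / n := by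
        intro i j hij
        have h1 : w i * n ≤ w j := by
          simp only [hw]
          rw [← pow_succ]
          exact pow_le_pow_right₀ (by linarith) (by have := Fin.lt_def.1 hij; omega)
        have h2 := hw0 i
        have h3 := hw0 j
        rw [show (w i)⁻¹ * (w j)⁻¹ * (5 / 4 * w i ^ 2) = (5 / 4 * w i) / w j by field_simp,
          div_le_div_iff₀ h3 (by linarith)]
        nlinarith
      intro i j
      have hpos : 0 ≤ (w i)⁻¹ * (w j)⁻¹ := by
        have := hw0 i
        have := hw0 j
        positivity
      split_ifs with hij
      · subst hij
        refine (mul_le_mul_of_nonneg_left (key i i) hpos).trans ?_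
        have := hw0 i
        rw [show (w i)⁻¹ * (w i)⁻¹ * (5 / 4 * w i ^ 2) = 5 / 4 by field_simp]
        norm_num
      · rcases lt_or_gt_of_ne hij with h | h
        · exact (mul_le_mul_of_nonneg_left (key i j) hpos).trans (hlt i j h)
        · rw [H.gauss.symm]
          refine (mul_le_mul_of_nonneg_left (key j i) hpos).trans ?_
          rw [mul_comm (w i)⁻¹]
          exact hlt j i h

theorem tendstoInMeasure_chaosInt_zero [IsProbabilityMeasure P] (H : IsLogField P X C G K c₀)
    (hγ : 0 < γ) (hγd : (d : ℝ) ≤ γ ^ 2 / 2) {h : Pt d → ℝ} (hh : Integrable h) :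
    TendstoInMeasure P (fun ε => chaosInt γ X C h ε) smallScale fun _ => 0 := by
  rw [tendstoInMeasure_iff_measureReal_norm]
  intro δ hδ
  simp only [sub_zero, Real.norm_eq_abs]
  have htail : Tendsto (fun n : ℕ => ∫ x in {x : Pt d | (n : ℝ) < ‖x‖}, |h x|) atTop (𝓝 0) := by
    have h1 := tendsto_setIntegral_of_antitone (μ := volume) (f := fun x => |h x|)
      (s := fun n : ℕ => {x : Pt d | (n : ℝ) < ‖x‖})
      (fun n => measurableSet_lt measurable_const measurable_norm)
      (fun m n hmn x hx => lt_of_le_of_lt (Nat.cast_le.2 hmn) (Set.mem_ofPred_eq ▸ hx))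
      ⟨0, hh.abs.integrableOn⟩
    have h2 : (⋂ n : ℕ, {x : Pt d | (n : ℝ) < ‖x‖}) = ∅ := by
      refine Set.eq_empty_of_forall_notMem fun x hx => ?_
      obtain ⟨n, hn⟩ := exists_nat_ge ‖x‖
      exact absurd (Set.mem_iInter.1 hx n) (not_lt.2 hn)
    rwa [h2, setIntegral_empty] at h1
  rw [Metric.tendsto_nhds]
  intro e he
  set I := ∫ x, |h x| with hI
  have hI0 : 0 ≤ I := integral_nonneg fun x => abs_nonneg _
  obtain ⟨N, hN⟩ := (htail.eventually_le_const (show 0 < e * δ / 4 by positivity)).exists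
  set η := min (e / 4) (e * δ / (4 * (I + 1))) with hη
  have hη0 : 0 < η := lt_min (by positivity) (by positivity)
  have hηI : η * I ≤ e * δ / 4 := by
    have h1 : η * (I + 1) ≤ e * δ / (4 * (I + 1)) * (I + 1) := by
      gcongr
      exact min_le_right _ _
    have h2 : e * δ / (4 * (I + 1)) * (I + 1) = e * δ / 4 := by field_simp
    nlinarith
  obtain ⟨A, hAm, hPA, hA⟩ := H.exists_bad hγ hγd hη0 (Nat.cast_nonneg (α := ℝ) N)
  filter_upwards [hA] with ε hε
  have hJi := (H.integrable_chaosInt (γ := γ) hh ε).abs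
  have hpi := H.integrable_prod_dens (γ := γ) hh.abs ε
  have hpi' : Integrable (fun p : Pt d × Ω => |h p.1| * dens γ X C ε p.1 p.2)
      (volume.prod (P.restrict Aᶜ)) := by
    rw [← Measure.restrict_univ (μ := (volume : Measure (Pt d))), Measure.prod_restrict]
    exact hpi.integrableOn
  have h1 : ∫ ω in Aᶜ, |chaosInt γ X C h ε ω| ∂P ≤ e * δ / 2 := by
    calc ∫ ω in Aᶜ, |chaosInt γ X C h ε ω| ∂P
        ≤ ∫ ω in Aᶜ, (∫ x, |h x| * dens γ X C ε x ω) ∂P := by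
          refine integral_mono hJi.integrableOn hpi'.integral_prod_right fun ω => ?_
          refine abs_integral_le_integral_abs.trans_eq ?_
          simp only [abs_mul, abs_of_pos (dens_pos γ X C ε _ ω)]
      _ = ∫ x, (∫ ω in Aᶜ, |h x| * dens γ X C ε x ω ∂P) :=
          (integral_integral_swap (f := fun x ω => |h x| * dens γ X C ε x ω) hpi').symm
      _ ≤ ∫ x, (η * |h x| + {x : Pt d | (N : ℝ) < ‖x‖}.indicator (fun x => |h x|) x) := by
          refine integral_mono hpi'.integral_prod_left ((hh.abs.const_mul _).add
            (hh.abs.indicator (measurableSet_lt measurable_const measurable_norm))) fun x => ?_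
          simp only
          rw [integral_const_mul]
          by_cases hx : ‖x‖ ≤ N
          · rw [Set.indicator_of_notMem (by simpa using hx), add_zero, mul_comm]
            exact mul_le_mul_of_nonneg_right (hε x hx) (abs_nonneg _)
          · rw [Set.indicator_of_mem (by simpa using hx)]
            have h2 : ∫ ω in Aᶜ, dens γ X C ε x ω ∂P ≤ 1 := by
              rw [← H.integral_dens (γ := γ) ε x]
              exact setIntegral_le_integral (H.integrable_dens ε x)
                (Eventually.of_forall fun ω => (dens_pos γ X C ε x ω).le)
            have h3 := mul_le_mul_of_nonneg_left h2 (abs_nonneg (h x))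
            have h4 := mul_nonneg hη0.le (abs_nonneg (h x))
            linarith
      _ ≤ e * δ / 2 := by
          rw [integral_add (hh.abs.const_mul _) (hh.abs.indicator
            (measurableSet_lt measurable_const measurable_norm)), integral_const_mul,
            integral_indicator (measurableSet_lt measurable_const measurable_norm)]
          linarith
  have h2 : δ * P.real ({ω | δ ≤ |chaosInt γ X C h ε ω|} ∩ Aᶜ) ≤
      ∫ ω in Aᶜ, |chaosInt γ X C h ε ω| ∂P := by
    have := mul_meas_ge_le_integral_of_nonneg (μ := P.restrict Aᶜ)
      (Eventually.of_forall fun ω => abs_nonneg (chaosInt γ X C h ε ω)) hJi.integrableOn δ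
    rwa [measureReal_restrict_apply' hAm.compl] at this
  have h3 : P.real ({ω | δ ≤ |chaosInt γ X C h ε ω|} ∩ Aᶜ) ≤ e / 2 := by
    have : δ * P.real ({ω | δ ≤ |chaosInt γ X C h ε ω|} ∩ Aᶜ) ≤ δ * (e / 2) := by linarith
    exact le_of_mul_le_mul_left this hδ
  have h4 : P.real {ω | δ ≤ |chaosInt γ X C h ε ω|} ≤
      P.real A + P.real ({ω | δ ≤ |chaosInt γ X C h ε ω|} ∩ Aᶜ) := by
    refine (measureReal_mono (fun ω hω => ?_) (measure_ne_top _ _)).trans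
      (measureReal_union_le _ _)
    by_cases hωA : ω ∈ A
    · exact Or.inl hωA
    · exact Or.inr ⟨hω, hωA⟩
  rw [Real.dist_eq, sub_zero, abs_of_nonneg measureReal_nonneg]
  have : η ≤ e / 4 := min_le_left _ _
  linarith

end IsLogField

/-- The partial damping factor `exp (-∑ k < N, exp (t k))`. -/
def partialDamp (N : ℕ) (t : ℕ → ℝ) : ℝ := Real.exp (-∑ k ∈ Finset.range N, Real.exp (t k))

/-- The damping factor `exp (-∑ exp (t k))`, equal to `0` when the series diverges. -/
def damp (t : ℕ → ℝ) : ℝ := ⨅ N, partialDamp N t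

theorem partialDamp_pos (N : ℕ) (t : ℕ → ℝ) : 0 < partialDamp N t := Real.exp_pos _

theorem partialDamp_le_one (N : ℕ) (t : ℕ → ℝ) : partialDamp N t ≤ 1 :=
  Real.exp_le_one_iff.2 (neg_nonpos.2 (Finset.sum_nonneg fun _ _ => (Real.exp_pos _).le))

theorem bddBelow_partialDamp (t : ℕ → ℝ) : BddBelow (Set.range fun N => partialDamp N t) :=
  ⟨0, by rintro _ ⟨N, rfl⟩; exact (partialDamp_pos N t).le⟩

theorem antitone_partialDamp (t : ℕ → ℝ) : Antitone fun N => partialDamp N t := by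
  intro m n hmn
  refine Real.exp_le_exp.2 (neg_le_neg ?_)
  exact Finset.sum_le_sum_of_subset_of_nonneg (Finset.range_mono hmn)
    fun _ _ _ => (Real.exp_pos _).le

theorem tendsto_partialDamp (t : ℕ → ℝ) :
    Tendsto (fun N => partialDamp N t) atTop (𝓝 (damp t)) :=
  tendsto_atTop_ciInf (antitone_partialDamp t) (bddBelow_partialDamp t)

theorem damp_le_partialDamp (N : ℕ) (t : ℕ → ℝ) : damp t ≤ partialDamp N t :=
  ciInf_le (bddBelow_partialDamp t) N

theorem damp_nonneg (t : ℕ → ℝ) : 0 ≤ damp t := le_ciInf fun N => (partialDamp_pos N t).le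

theorem damp_le_one (t : ℕ → ℝ) : damp t ≤ 1 :=
  (damp_le_partialDamp 0 t).trans (partialDamp_le_one 0 t)

theorem damp_le (p k : ℕ) (t : ℕ → ℝ) : damp t ≤ p.factorial * Real.exp (-(p * t k)) := by
  have h1 : damp t ≤ Real.exp (-Real.exp (t k)) := by
    refine (damp_le_partialDamp (k + 1) t).trans (Real.exp_le_exp.2 (neg_le_neg ?_))
    exact Finset.single_le_sum (f := fun k => Real.exp (t k)) (fun _ _ => (Real.exp_pos _).le)
      (Finset.self_mem_range_succ k)
  refine h1.trans ?_
  have h2 := Real.pow_div_factorial_le_exp _ (Real.exp_pos (t k)).le p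
  rw [← Real.exp_nat_mul] at h2
  rw [Real.exp_neg, Real.exp_neg, ← div_eq_mul_inv, inv_le_comm₀ (Real.exp_pos _) (by positivity),
    inv_div]
  exact h2

theorem damp_eq {t : ℕ → ℝ} (ht : Summable fun k => Real.exp (t k)) :
    damp t = Real.exp (-∑' k, Real.exp (t k)) :=
  tendsto_nhds_unique (tendsto_partialDamp t)
    ((Real.continuous_exp.tendsto _).comp ht.hasSum.tendsto_sum_nat.neg)

theorem tendsto_damp {ι : Type*} {l : Filter ι} {t : ι → ℕ → ℝ} {t₀ u : ℕ → ℝ}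
    (hu : Summable fun k => Real.exp (u k)) (htu : ∀ᶠ i in l, ∀ k, t i k ≤ u k)
    (h₀ : ∀ k, t₀ k ≤ u k) (ht : ∀ k, Tendsto (fun i => t i k) l (𝓝 (t₀ k))) :
    Tendsto (fun i => damp (t i)) l (𝓝 (damp t₀)) := by
  have hs : ∀ {v : ℕ → ℝ}, (∀ k, v k ≤ u k) → Summable fun k => Real.exp (v k) := fun hv =>
    Summable.of_nonneg_of_le (fun k => (Real.exp_pos _).le) (fun k => Real.exp_le_exp.2 (hv k)) hu
  rw [damp_eq (hs h₀)]
  have h1 : Tendsto (fun i => ∑' k, Real.exp (t i k)) l (𝓝 (∑' k, Real.exp (t₀ k))) := by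
    refine tendsto_tsum_of_dominated_convergence hu
      (fun k => (Real.continuous_exp.tendsto _).comp (ht k)) ?_
    filter_upwards [htu] with i hi k
    rw [Real.norm_of_nonneg (Real.exp_pos _).le]
    exact Real.exp_le_exp.2 (hi k)
  refine ((Real.continuous_exp.tendsto _).comp h1.neg).congr' ?_
  filter_upwards [htu] with i hi
  rw [Function.comp, damp_eq (hs hi)]

theorem measurable_partialDamp {α : Type*} [MeasurableSpace α] {t : α → ℕ → ℝ}
    (ht : ∀ k, Measurable fun a => t a k) (N : ℕ) : Measurable fun a => partialDamp N (t a) :=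
  (Finset.measurable_sum _ fun k _ => (ht k).exp).neg.exp

theorem measurable_damp {α : Type*} [MeasurableSpace α] {t : α → ℕ → ℝ}
    (ht : ∀ k, Measurable fun a => t a k) : Measurable fun a => damp (t a) :=
  measurable_of_tendsto_metrizable (fun N => measurable_partialDamp ht N)
    (tendsto_pi_nhds.2 fun a => tendsto_partialDamp (t a))

/-- The point of index `k` in the multiscale lattice approximation of `x`. -/
def latPt (k : ℕ) (x : Pt d) : Scale × Pt d := (expScale k, cellPt k x)

/-- The exponents entering the cutoff at `x`, after a shift of the field by `μ`. -/
def cutoffExp {Ω : Type*} (β α : ℝ) (k₀ : ℕ) (X : Scale × Pt d → Ω → ℝ) (μ : ℕ → ℝ) (x : Pt d)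
    (ω : Ω) (k : ℕ) : ℝ :=
  β * (X (latPt (k₀ + k) x) ω - α * (k₀ + k : ℕ) + μ k)

/-- A smooth cutoff penalising points where the field grows faster than `α k` along the scales
`exp (-k)`, `k ≥ k₀`, after a shift of the field by `μ`. -/
def cutoff {Ω : Type*} (β α : ℝ) (k₀ : ℕ) (X : Scale × Pt d → Ω → ℝ) (μ : ℕ → ℝ) (x : Pt d)
    (ω : Ω) : ℝ :=
  damp (cutoffExp β α k₀ X μ x ω)

/-- The shift at `x` induced by tilting the field towards two given points. -/
def tiltShift (γ : ℝ) (k₀ : ℕ) (c : Scale × Pt d → ℝ) (x : Pt d) (k : ℕ) : ℝ :=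
  γ * c (latPt (k₀ + k) x)

theorem cutoff_nonneg {Ω : Type*} {β α : ℝ} {k₀ : ℕ} {X : Scale × Pt d → Ω → ℝ} {μ : ℕ → ℝ}
    {x : Pt d} {ω : Ω} : 0 ≤ cutoff β α k₀ X μ x ω := damp_nonneg _

theorem cutoff_le_one {Ω : Type*} {β α : ℝ} {k₀ : ℕ} {X : Scale × Pt d → Ω → ℝ} {μ : ℕ → ℝ}
    {x : Pt d} {ω : Ω} : cutoff β α k₀ X μ x ω ≤ 1 := damp_le_one _

theorem cutoff_mul_le_one {Ω : Type*} {β α : ℝ} {k₀ : ℕ} {X : Scale × Pt d → Ω → ℝ}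
    (x y : Pt d) (μ μ' : ℕ → ℝ) (ω : Ω) :
    cutoff β α k₀ X μ x ω * cutoff β α k₀ X μ' y ω ≤ 1 :=
  mul_le_one₀ (damp_le_one _) (damp_nonneg _) (damp_le_one _)

theorem cutoff_mul_nonneg {Ω : Type*} {β α : ℝ} {k₀ : ℕ} {X : Scale × Pt d → Ω → ℝ}
    (x y : Pt d) (μ μ' : ℕ → ℝ) (ω : Ω) :
    0 ≤ cutoff β α k₀ X μ x ω * cutoff β α k₀ X μ' y ω :=
  mul_nonneg (damp_nonneg _) (damp_nonneg _)

namespace IsLogField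

variable {Ω : Type*} [MeasurableSpace Ω] {P : Measure Ω} {X : Scale × Pt d → Ω → ℝ}
  {C : Scale × Pt d → Scale × Pt d → ℝ} {G : Scale → Pt d → Pt d → ℝ}
  {K : Pt d → Pt d → ℝ} {c₀ γ β α τ : ℝ} {k₀ : ℕ}

theorem measurable_latPt (H : IsLogField P X C G K c₀) (k : ℕ) :
    Measurable fun p : Pt d × Ω => X (latPt k p.1) p.2 :=
  (H.meas (expScale k)).comp (((measurable_cellPt k).comp measurable_fst).prodMk measurable_snd)

theorem measurable_cutoff (H : IsLogField P X C G K c₀) (μ : ℕ → ℝ) :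
    Measurable fun p : Pt d × Ω => cutoff β α k₀ X μ p.1 p.2 :=
  measurable_damp fun _ => (((H.measurable_latPt _).sub_const _).add_const _).const_mul _

theorem measurable_cutoff_right (H : IsLogField P X C G K c₀) (μ : ℕ → ℝ) (x : Pt d) :
    Measurable (cutoff β α k₀ X μ x) :=
  measurable_damp fun _ => (((H.gauss.meas _).sub_const _).add_const _).const_mul _

theorem measurable_partialCutoff (H : IsLogField P X C G K c₀) (μ : ℕ → ℝ) (x : Pt d) (N : ℕ) :
    Measurable fun ω => partialDamp N (cutoffExp β α k₀ X μ x ω) :=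
  measurable_partialDamp (fun _ => (((H.gauss.meas _).sub_const _).add_const _).const_mul _) N

theorem integrable_dens_mul_dens (H : IsLogField P X C G K c₀) (ε ε' : Scale) (x y : Pt d) :
    Integrable (fun ω => dens γ X C ε x ω * dens γ X C ε' y ω) P := by
  simpa using (H.integral_dens_mul_dens_mul_exp (γ := γ) ε ε' x y 0 (ε, x)).1

theorem integral_dens_mul_dens (H : IsLogField P X C G K c₀) (ε ε' : Scale) (x y : Pt d) :
    ∫ ω, dens γ X C ε x ω * dens γ X C ε' y ω ∂P = Real.exp (γ ^ 2 * C (ε, x) (ε', y)) := by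
  simpa using (H.integral_dens_mul_dens_mul_exp (γ := γ) ε ε' x y 0 (ε, x)).2

theorem integral_dens_mul_partialDamp [IsProbabilityMeasure P] (H : IsLogField P X C G K c₀)
    (ε ε' : Scale) (x y : Pt d)
    (N : ℕ) :
    ∫ ω, dens γ X C ε x ω * dens γ X C ε' y ω *
      (partialDamp N (cutoffExp β α k₀ X 0 x ω) * partialDamp N (cutoffExp β α k₀ X 0 y ω)) ∂P =
    Real.exp (γ ^ 2 * C (ε, x) (ε', y)) * ∫ ω,
      partialDamp N (cutoffExp β α k₀ X
        (tiltShift γ k₀ (fun t => C (ε, x) t + C (ε', y) t) x) x ω) *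
      partialDamp N (cutoffExp β α k₀ X
        (tiltShift γ k₀ (fun t => C (ε, x) t + C (ε', y) t) y) y ω) ∂P := by
  set F : (Fin N ⊕ Fin N → ℝ) → ℝ := fun z =>
    Real.exp (-∑ k : Fin N, Real.exp (β * (z (Sum.inl k) - α * (k₀ + k : ℕ)))) *
    Real.exp (-∑ k : Fin N, Real.exp (β * (z (Sum.inr k) - α * (k₀ + k : ℕ)))) with hF
  have hFm : Measurable F := by
    refine Measurable.mul ?_ ?_ <;>
    · refine (Finset.measurable_sum _ fun k _ => ?_).neg.exp
      exact (((measurable_pi_apply _).sub_const _).const_mul _).exp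
  have key := H.gauss.integral_tilt ![(ε, x), (ε', y)] ![γ, γ]
    (Sum.elim (fun k : Fin N => latPt (k₀ + k) x) fun k : Fin N => latPt (k₀ + k) y) hFm
  simp only [Fin.sum_univ_two, Matrix.cons_val] at key
  have e1 : ∀ ω, dens γ X C ε x ω * dens γ X C ε' y ω *
      (partialDamp N (cutoffExp β α k₀ X 0 x ω) * partialDamp N (cutoffExp β α k₀ X 0 y ω)) =
      Real.exp (-(γ ^ 2 / 2 * C (ε, x) (ε, x)) - γ ^ 2 / 2 * C (ε', y) (ε', y)) *
      (Real.exp (γ * X (ε, x) ω + γ * X (ε', y) ω) * F fun k =>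
        X (Sum.elim (fun k : Fin N => latPt (k₀ + k) x) (fun k : Fin N => latPt (k₀ + k) y) k)
          ω) := by
    intro ω
    rw [dens, dens, ← Real.exp_add, ← mul_assoc (Real.exp (-(_) - _)), ← Real.exp_add, hF]
    simp only [partialDamp, cutoffExp, Sum.elim_inl, Sum.elim_inr, Finset.sum_range, Pi.zero_apply,
      add_zero]
    congr 2
    ring
  simp only [e1]
  rw [integral_const_mul, key, ← mul_assoc, ← Real.exp_add, H.gauss.symm (ε', y) (ε, x)]
  congr 1
  · congr 1
    ring
  · refine integral_congr_ae (Eventually.of_forall fun ω => ?_)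
    simp only [hF, partialDamp, cutoffExp, tiltShift, Sum.elim_inl, Sum.elim_inr, Finset.sum_range]
    congr 3 <;>
    · refine Finset.sum_congr rfl fun k _ => ?_
      ring_nf

/-- **Girsanov formula** for the two-point function of the truncated chaos. -/
theorem integral_dens_mul_cutoff [IsProbabilityMeasure P] (H : IsLogField P X C G K c₀)
    (ε ε' : Scale) (x y : Pt d) :
    ∫ ω, dens γ X C ε x ω * dens γ X C ε' y ω *
      (cutoff β α k₀ X 0 x ω * cutoff β α k₀ X 0 y ω) ∂P =
    Real.exp (γ ^ 2 * C (ε, x) (ε', y)) * ∫ ω,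
      cutoff β α k₀ X (tiltShift γ k₀ (fun t => C (ε, x) t + C (ε', y) t) x) x ω *
      cutoff β α k₀ X (tiltShift γ k₀ (fun t => C (ε, x) t + C (ε', y) t) y) y ω ∂P := by
  have hb : ∀ (N : ℕ) (μ μ' : ℕ → ℝ) (ω : Ω), |partialDamp N (cutoffExp β α k₀ X μ x ω) *
      partialDamp N (cutoffExp β α k₀ X μ' y ω)| ≤ 1 := fun N μ μ' ω => by
    rw [abs_of_nonneg (mul_pos (partialDamp_pos _ _) (partialDamp_pos _ _)).le]
    exact mul_le_one₀ (partialDamp_le_one _ _) (partialDamp_pos _ _).le (partialDamp_le_one _ _)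
  have h1 : Tendsto (fun N => ∫ ω, dens γ X C ε x ω * dens γ X C ε' y ω *
      (partialDamp N (cutoffExp β α k₀ X 0 x ω) * partialDamp N (cutoffExp β α k₀ X 0 y ω)) ∂P)
      atTop (𝓝 (∫ ω, dens γ X C ε x ω * dens γ X C ε' y ω *
      (cutoff β α k₀ X 0 x ω * cutoff β α k₀ X 0 y ω) ∂P)) := by
    refine tendsto_integral_of_dominated_convergence _ (fun N => ?_)
      (H.integrable_dens_mul_dens (γ := γ) ε ε' x y) (fun N => Eventually.of_forall fun ω => ?_)
      (Eventually.of_forall fun ω => ?_)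
    · exact (((H.measurable_dens_right ε x).mul (H.measurable_dens_right ε' y)).mul
        ((H.measurable_partialCutoff 0 x N).mul
          (H.measurable_partialCutoff 0 y N))).aestronglyMeasurable
    · have h0 := (mul_pos (dens_pos γ X C ε x ω) (dens_pos γ X C ε' y ω)).le
      rw [norm_mul, Real.norm_of_nonneg h0]
      exact mul_le_of_le_one_right h0 (hb _ _ _ _)
    · exact ((tendsto_partialDamp _).mul (tendsto_partialDamp _)).const_mul _
  have h2 : Tendsto (fun N => ∫ ω, partialDamp N (cutoffExp β α k₀ X
        (tiltShift γ k₀ (fun t => C (ε, x) t + C (ε', y) t) x) x ω) *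
      partialDamp N (cutoffExp β α k₀ X
        (tiltShift γ k₀ (fun t => C (ε, x) t + C (ε', y) t) y) y ω) ∂P) atTop (𝓝 (∫ ω,
      cutoff β α k₀ X (tiltShift γ k₀ (fun t => C (ε, x) t + C (ε', y) t) x) x ω *
      cutoff β α k₀ X (tiltShift γ k₀ (fun t => C (ε, x) t + C (ε', y) t) y) y ω ∂P)) := by
    refine tendsto_integral_of_dominated_convergence (fun _ => 1) (fun N => ?_)
      (integrable_const _) (fun N => Eventually.of_forall fun ω => hb _ _ _ _)
      (Eventually.of_forall fun ω => (tendsto_partialDamp _).mul (tendsto_partialDamp _))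
    exact ((H.measurable_partialCutoff _ x N).mul
      (H.measurable_partialCutoff _ y N)).aestronglyMeasurable
  refine tendsto_nhds_unique h1 ?_
  simp only [H.integral_dens_mul_partialDamp]
  exact h2.const_mul _

/-- The field does not exceed linear growth along scales, almost surely. -/
theorem ae_summable_exp (H : IsLogField P X C G K c₀) (hβ : 0 < β) (hβτ : β ≤ τ) (x : Pt d)
    (B : ℝ) : ∀ᵐ ω ∂P, Summable fun k : ℕ =>
      Real.exp (β * (X (latPt (k₀ + k) x) ω - τ * (k₀ + k : ℕ) + B)) := by
  have hi : ∀ t, Integrable (fun ω => Real.exp (β * X t ω)) P := fun t => by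
    simpa using H.gauss.integrable_exp_three β 0 0 t t t
  have hv : ∀ t, ∫ ω, Real.exp (β * X t ω) ∂P = Real.exp (β ^ 2 / 2 * C t t) := fun t => by
    simpa using H.gauss.integral_exp_three β 0 0 t t t
  set A : ℕ → ℝ := fun k => Real.exp (β * (-(τ * (k₀ + k : ℕ)) + B)) with hA
  have e : ∀ (k : ℕ) ω, Real.exp (β * (X (latPt (k₀ + k) x) ω - τ * (k₀ + k : ℕ) + B)) =
      A k * Real.exp (β * X (latPt (k₀ + k) x) ω) := by
    intro k ω
    rw [hA, ← Real.exp_add]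
    ring_nf
  have hi' : ∀ k : ℕ, Integrable (fun ω =>
      Real.exp (β * (X (latPt (k₀ + k) x) ω - τ * (k₀ + k : ℕ) + B))) P := fun k => by
    simp only [e]
    exact (hi _).const_mul _
  have hs : Summable fun k : ℕ => ∫ ω,
      Real.exp (β * (X (latPt (k₀ + k) x) ω - τ * (k₀ + k : ℕ) + B)) ∂P := by
    refine Summable.of_nonneg_of_le (fun k => integral_nonneg fun ω => (Real.exp_pos _).le)
      (fun k => ?_) ((summable_geometric_of_lt_one (Real.exp_pos (-(β * τ / 2))).le
        (Real.exp_lt_one_iff.2 (neg_lt_zero.2 (by nlinarith)))).mul_left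
        (Real.exp (β ^ 2 / 2 * c₀ + β * B)))
    simp only [e, integral_const_mul, hv, hA]
    rw [← Real.exp_add, ← Real.exp_nat_mul, ← Real.exp_add]
    refine Real.exp_le_exp.2 ?_
    have h1 : C (latPt (k₀ + k) x) (latPt (k₀ + k) x) ≤ (k₀ + k : ℕ) + c₀ :=
      H.cov_cellPt_le (latPt (k₀ + k) x) (k₀ + k) (cellPt (k₀ + k) x)
    have h2 : β ^ 2 / 2 * C (latPt (k₀ + k) x) (latPt (k₀ + k) x) ≤
        β ^ 2 / 2 * ((k₀ + k : ℕ) + c₀) := by gcongr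
    have h3 : (k : ℝ) ≤ (k₀ + k : ℕ) := by exact_mod_cast Nat.le_add_left k k₀
    have h4 : β ^ 2 / 2 * ((k₀ + k : ℕ) : ℝ) ≤ β * τ / 2 * (k₀ + k : ℕ) := by
      have : β ^ 2 / 2 ≤ β * τ / 2 := by nlinarith
      gcongr
    have h5 : β * τ / 2 * k ≤ β * τ / 2 * (k₀ + k : ℕ) := by
      have : 0 ≤ β * τ / 2 := by nlinarith
      gcongr
    nlinarith
  have h := summable_norm_of_tsum_eLpNorm_ne_top (μ := P) le_rfl
    (fun k => (hi' k).aestronglyMeasurable) ?_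
  · filter_upwards [h] with ω hω
    simpa only [Real.norm_of_nonneg (Real.exp_pos _).le] using hω
  · have h1 : ∀ k : ℕ, eLpNorm (fun ω =>
        Real.exp (β * (X (latPt (k₀ + k) x) ω - τ * (k₀ + k : ℕ) + B))) 1 P = ENNReal.ofReal (∫ ω,
          Real.exp (β * (X (latPt (k₀ + k) x) ω - τ * (k₀ + k : ℕ) + B)) ∂P) := fun k => by
      rw [eLpNorm_one_eq_lintegral_enorm, ← ofReal_integral_norm_eq_lintegral_enorm (hi' k)]
      simp only [Real.norm_of_nonneg (Real.exp_pos _).le]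
    simp only [h1]
    exact hs.tsum_ofReal_ne_top

/-- The cutoff removes little mass from the approximate chaos, uniformly in the scale. -/
theorem exists_integral_dens_mul_one_sub_cutoff_le [IsProbabilityMeasure P]
    (H : IsLogField P X C G K c₀) (hγ : 0 < γ) (hβ : 0 < β) (hβτ : β ≤ τ) {η : ℝ} (hη : 0 < η) :
    ∃ k₀, ∀ (ε : Scale) (x : Pt d),
      ∫ ω, dens γ X C ε x ω * (1 - cutoff β (γ + τ) k₀ X 0 x ω) ∂P ≤ η := by
  set q := Real.exp (-(β * τ / 2)) with hq
  have hq1 : q < 1 := Real.exp_lt_one_iff.2 (neg_lt_zero.2 (by nlinarith))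
  have hq0 : 0 < q := Real.exp_pos _
  set A := Real.exp ((β ^ 2 / 2 + γ * β) * c₀) with hA
  have hlim : Tendsto (fun k₀ : ℕ => A * q ^ k₀ * (1 - q)⁻¹) atTop (𝓝 (A * 0 * (1 - q)⁻¹)) :=
    ((tendsto_pow_atTop_nhds_zero_of_lt_one hq0.le hq1).const_mul _).mul_const _
  rw [mul_zero, zero_mul] at hlim
  obtain ⟨k₀, hk₀⟩ := (hlim.eventually_le_const hη).exists
  refine ⟨k₀, fun ε x => le_trans ?_ hk₀⟩
  have hterm : ∀ k : ℕ, Integrable (fun ω => dens γ X C ε x ω *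
      Real.exp (cutoffExp β (γ + τ) k₀ X 0 x ω k)) P ∧
      ∫ ω, dens γ X C ε x ω * Real.exp (cutoffExp β (γ + τ) k₀ X 0 x ω k) ∂P ≤
        A * q ^ k₀ * q ^ k := by
    intro k
    set t := latPt (k₀ + k) x with ht
    obtain ⟨i1, h1⟩ := H.integral_dens_mul_exp (γ := γ) ε x β t
    have e : (fun ω => dens γ X C ε x ω * Real.exp (cutoffExp β (γ + τ) k₀ X 0 x ω k)) =
        fun ω => Real.exp (-(β * (γ + τ) * (k₀ + k : ℕ))) *
          (dens γ X C ε x ω * Real.exp (β * X t ω)) := by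
      ext ω
      rw [cutoffExp, ← ht, mul_left_comm, ← Real.exp_add, Pi.zero_apply]
      ring_nf
    rw [e, integral_const_mul, h1]
    refine ⟨i1.const_mul _, ?_⟩
    rw [mul_assoc A, ← pow_add, hA, hq, ← Real.exp_nat_mul, ← Real.exp_add, ← Real.exp_add]
    refine Real.exp_le_exp.2 ?_
    have h2 : C t t ≤ (k₀ + k : ℕ) + c₀ := H.cov_cellPt_le t (k₀ + k) (cellPt (k₀ + k) x)
    have h3 : C (ε, x) t ≤ (k₀ + k : ℕ) + c₀ := H.cov_cellPt_le (ε, x) (k₀ + k) _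
    have h4 : β ^ 2 / 2 * C t t ≤ β ^ 2 / 2 * ((k₀ + k : ℕ) + c₀) := by gcongr
    have h5 : γ * β * C (ε, x) t ≤ γ * β * ((k₀ + k : ℕ) + c₀) := by gcongr
    have h6 : β ^ 2 / 2 * ((k₀ + k : ℕ) : ℝ) ≤ β * τ / 2 * (k₀ + k : ℕ) := by
      have : β ^ 2 / 2 ≤ β * τ / 2 := by nlinarith
      gcongr
    nlinarith
  have hmd := H.measurable_dens_right (γ := γ) ε x
  have hmp := H.measurable_partialCutoff (β := β) (α := γ + τ) (k₀ := k₀) 0 x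
  have hlim2 : Tendsto (fun N => ∫ ω, dens γ X C ε x ω *
      (1 - partialDamp N (cutoffExp β (γ + τ) k₀ X 0 x ω)) ∂P) atTop
      (𝓝 (∫ ω, dens γ X C ε x ω * (1 - cutoff β (γ + τ) k₀ X 0 x ω) ∂P)) := by
    refine tendsto_integral_of_dominated_convergence _
      (fun N => (hmd.mul (measurable_const.sub (hmp N))).aestronglyMeasurable)
      (H.integrable_dens (γ := γ) ε x) (fun N => Eventually.of_forall fun ω => ?_)
      (Eventually.of_forall fun ω => ((tendsto_partialDamp _).const_sub 1).const_mul _)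
    have h1 := partialDamp_pos N (cutoffExp β (γ + τ) k₀ X 0 x ω)
    have h2 := partialDamp_le_one N (cutoffExp β (γ + τ) k₀ X 0 x ω)
    have h3 := dens_pos γ X C ε x ω
    rw [Real.norm_of_nonneg (mul_nonneg h3.le (by linarith))]
    exact mul_le_of_le_one_right h3.le (by linarith)
  refine le_of_tendsto' hlim2 fun N => ?_
  calc ∫ ω, dens γ X C ε x ω * (1 - partialDamp N (cutoffExp β (γ + τ) k₀ X 0 x ω)) ∂P
      ≤ ∫ ω, ∑ k ∈ Finset.range N, dens γ X C ε x ω *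
          Real.exp (cutoffExp β (γ + τ) k₀ X 0 x ω k) ∂P := by
        refine integral_mono_of_nonneg (Eventually.of_forall fun ω => ?_)
          (integrable_finsetSum _ fun k _ => (hterm k).1) (Eventually.of_forall fun ω => ?_)
        · exact mul_nonneg (dens_pos γ X C ε x ω).le (sub_nonneg.2 (partialDamp_le_one _ _))
        · simp only
          rw [← Finset.mul_sum]
          refine mul_le_mul_of_nonneg_left ?_ (dens_pos γ X C ε x ω).le
          have := Real.add_one_le_exp
            (-∑ k ∈ Finset.range N, Real.exp (cutoffExp β (γ + τ) k₀ X 0 x ω k))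
          rw [partialDamp]
          linarith
    _ = ∑ k ∈ Finset.range N, ∫ ω, dens γ X C ε x ω *
          Real.exp (cutoffExp β (γ + τ) k₀ X 0 x ω k) ∂P :=
        integral_finsetSum _ fun k _ => (hterm k).1
    _ ≤ ∑ k ∈ Finset.range N, A * q ^ k₀ * q ^ k := Finset.sum_le_sum fun k _ => (hterm k).2
    _ = A * q ^ k₀ * ∑ k ∈ Finset.range N, q ^ k := by rw [Finset.mul_sum]
    _ ≤ A * q ^ k₀ * (1 - q)⁻¹ := by
        gcongr
        rw [← tsum_geometric_of_lt_one hq0.le hq1]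
        exact (summable_geometric_of_lt_one hq0.le hq1).sum_le_tsum _ fun k _ => by positivity

end IsLogField

namespace IsLogField

variable {Ω : Type*} [MeasurableSpace Ω] {P : Measure Ω} {X : Scale × Pt d → Ω → ℝ}
  {C : Scale × Pt d → Scale × Pt d → ℝ} {G : Scale → Pt d → Pt d → ℝ}
  {K : Pt d → Pt d → ℝ} {c₀ γ β τ : ℝ} {k₀ p : ℕ}

theorem integrable_dens_mul_cutoff (H : IsLogField P X C G K c₀) {α : ℝ} (ε ε' : Scale)
    (x y : Pt d) :
    Integrable (fun ω => dens γ X C ε x ω * dens γ X C ε' y ω *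
      (cutoff β α k₀ X 0 x ω * cutoff β α k₀ X 0 y ω)) P := by
  refine (H.integrable_dens_mul_dens (γ := γ) ε ε' x y).mul_bdd (c := 1)
    ((H.measurable_cutoff_right 0 x).mul (H.measurable_cutoff_right 0 y)).aestronglyMeasurable
    (Eventually.of_forall fun ω => ?_)
  rw [Real.norm_of_nonneg (cutoff_mul_nonneg _ _ _ _ _)]
  exact cutoff_mul_le_one _ _ _ _ _

/-- The two-point function of the truncated chaos has a locally integrable singularity. -/
theorem exists_two_point_le (H : IsLogField P X C G K c₀) (hγ : 0 < γ) (hτγ : τ ≤ γ) (hτ : 0 < τ)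
    (hp : p * β = γ - τ) : ∃ M, 0 ≤ M ∧ ∀ (ε ε' : Scale) (x y : Pt d), x ≠ y →
      ∫ ω, dens γ X C ε x ω * dens γ X C ε' y ω *
        (cutoff β (γ + τ) k₀ X 0 x ω * cutoff β (γ + τ) k₀ X 0 y ω) ∂P ≤
      M * Real.exp ((γ ^ 2 - (γ - τ) ^ 2 / 2) * logPlus (x - y)) := by
  set s := γ ^ 2 - (γ - τ) ^ 2 / 2 with hs
  have hs0 : 0 ≤ s := by rw [hs]; nlinarith
  set C1 := Real.log (1 + √d) + c₀ with hC1
  set κ := γ ^ 2 * (1 + c₀) + (γ - τ) ^ 2 / 2 * c₀ + 2 * γ * (γ - τ) * C1 with hκ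
  refine ⟨Real.exp (γ ^ 2 * (k₀ + c₀)) + p.factorial * Real.exp κ, by positivity,
    fun ε ε' x y hxy => ?_⟩
  have hL : 0 ≤ logPlus (x - y) := logPlus_nonneg _
  have hdd : ∀ ω, 0 ≤ dens γ X C ε x ω * dens γ X C ε' y ω := fun ω =>
    (mul_pos (dens_pos γ X C ε x ω) (dens_pos γ X C ε' y ω)).le
  set r := max (max (ε : ℝ) ε') (dist x y) with hr
  have hr0 : 0 < r := lt_max_of_lt_left (lt_max_of_lt_left ε.2.1)
  rcases lt_or_ge (Real.exp (-(k₀ : ℝ))) r with hlt | hle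
  · have h1 : C (ε, x) (ε', y) ≤ k₀ + c₀ := by
      have := H.cov.upper ε ε' x y (Real.exp (-(k₀ : ℝ))) (Real.exp_pos _)
        (Real.exp_le_one_iff.2 (by simp)) hlt.le
      rwa [log_inv_expScale] at this
    calc ∫ ω, dens γ X C ε x ω * dens γ X C ε' y ω *
        (cutoff β (γ + τ) k₀ X 0 x ω * cutoff β (γ + τ) k₀ X 0 y ω) ∂P
        ≤ ∫ ω, dens γ X C ε x ω * dens γ X C ε' y ω ∂P :=
          integral_mono (H.integrable_dens_mul_cutoff ε ε' x y)
            (H.integrable_dens_mul_dens ε ε' x y) fun ω =>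
            mul_le_of_le_one_right (hdd ω) (cutoff_mul_le_one _ _ _ _ _)
      _ = Real.exp (γ ^ 2 * C (ε, x) (ε', y)) := H.integral_dens_mul_dens ε ε' x y
      _ ≤ Real.exp (γ ^ 2 * (k₀ + c₀)) := by gcongr
      _ ≤ Real.exp (γ ^ 2 * (k₀ + c₀)) + p.factorial * Real.exp κ :=
          le_add_of_nonneg_right (by positivity)
      _ ≤ _ := le_mul_of_one_le_right (by positivity) (Real.one_le_exp (by positivity))
  · set n := ⌊Real.log r⁻¹⌋₊ with hn
    have hk0 : (k₀ : ℝ) ≤ Real.log r⁻¹ := by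
      rw [← log_inv_expScale k₀]
      exact Real.log_le_log (by positivity) (inv_anti₀ hr0 hle)
    have hlog0 : 0 ≤ Real.log r⁻¹ := le_trans (Nat.cast_nonneg _) hk0
    have hkn : k₀ ≤ n := Nat.le_floor hk0
    obtain ⟨k, hk⟩ := Nat.exists_eq_add_of_le hkn
    have hn1 : (n : ℝ) ≤ Real.log r⁻¹ := Nat.floor_le hlog0
    have hn2 : Real.log r⁻¹ ≤ n + 1 := (Nat.lt_floor_add_one _).le
    have hrn : r ≤ Real.exp (-(n : ℝ)) := by
      rw [← Real.log_le_iff_le_exp hr0]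
      rw [Real.log_inv] at hn1
      linarith
    have hr1 : r ≤ 1 := hrn.trans (Real.exp_le_one_iff.2 (by simp))
    have hεn : (ε : ℝ) ≤ Real.exp (-(n : ℝ)) :=
      ((le_max_left _ _).trans (le_max_left _ _)).trans hrn
    have hεn' : (ε' : ℝ) ≤ Real.exp (-(n : ℝ)) :=
      ((le_max_right _ _).trans (le_max_left _ _)).trans hrn
    have hdn : dist x y ≤ Real.exp (-(n : ℝ)) := (le_max_right _ _).trans hrn
    set t := latPt n x with ht
    have hC : C (ε, x) (ε', y) ≤ n + 1 + c₀ := by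
      have := H.cov.upper ε ε' x y r hr0 hr1 le_rfl
      linarith
    have hCt : C t t ≤ n + c₀ := H.cov_cellPt_le t n (cellPt n x)
    have hCx : n - C1 ≤ C (ε, x) t := H.le_cov_cellPt ε x n hεn
    have hCy : n - C1 ≤ C (ε', y) t := by
      refine H.le_cov_of_le ε' (expScale n) y (cellPt n x) n ?_
      have h1 := dist_cellPt_le n x
      have h2 := dist_triangle y x (cellPt n x)
      rw [dist_comm y x] at h2
      have h3 : 0 ≤ √(d : ℝ) * Real.exp (-(n : ℝ)) := by positivity
      refine max_le (max_le ?_ ?_) ?_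
      · linarith
      · rw [coe_expScale]; linarith
      · linarith
    obtain ⟨i1, e1⟩ := H.integral_dens_mul_dens_mul_exp (γ := γ) ε ε' x y (-(γ - τ)) t
    have hcut : ∀ ω, cutoff β (γ + τ) k₀ X 0 x ω * cutoff β (γ + τ) k₀ X 0 y ω ≤
        p.factorial * Real.exp ((γ - τ) * (γ + τ) * n) * Real.exp (-(γ - τ) * X t ω) := by
      intro ω
      refine (mul_le_of_le_one_right (damp_nonneg _) (damp_le_one _)).trans
        ((damp_le p k _).trans_eq ?_)
      rw [mul_assoc, ← Real.exp_add, cutoffExp, ← hk, ← mul_assoc, hp, ← ht, Pi.zero_apply]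
      ring_nf
    calc ∫ ω, dens γ X C ε x ω * dens γ X C ε' y ω *
        (cutoff β (γ + τ) k₀ X 0 x ω * cutoff β (γ + τ) k₀ X 0 y ω) ∂P
        ≤ ∫ ω, p.factorial * Real.exp ((γ - τ) * (γ + τ) * n) *
            (dens γ X C ε x ω * dens γ X C ε' y ω * Real.exp (-(γ - τ) * X t ω)) ∂P := by
          refine integral_mono (H.integrable_dens_mul_cutoff ε ε' x y) (i1.const_mul _) fun ω => ?_
          refine (mul_le_mul_of_nonneg_left (hcut ω) (hdd ω)).trans_eq ?_
          ring
      _ ≤ p.factorial * Real.exp (s * n + κ) := by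
          rw [integral_const_mul, e1, mul_assoc, ← Real.exp_add]
          refine mul_le_mul_of_nonneg_left (Real.exp_le_exp.2 ?_) (by positivity)
          have h0 : 0 ≤ γ * (γ - τ) := mul_nonneg hγ.le (sub_nonneg.2 hτγ)
          have h1 : γ ^ 2 * C (ε, x) (ε', y) ≤ γ ^ 2 * (n + 1 + c₀) := by gcongr
          have h2 : (γ - τ) ^ 2 / 2 * C t t ≤ (γ - τ) ^ 2 / 2 * (n + c₀) := by gcongr
          have h3 : γ * (γ - τ) * (2 * (n - C1)) ≤ γ * (γ - τ) * (C (ε, x) t + C (ε', y) t) := by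
            gcongr
            linarith
          rw [neg_sq, hs, hκ]
          nlinarith
      _ ≤ p.factorial * Real.exp κ * Real.exp (s * logPlus (x - y)) := by
          rw [mul_assoc, ← Real.exp_add, add_comm κ]
          gcongr
          refine hn1.trans (le_logPlus_of_le (sub_ne_zero.2 hxy) ?_)
          rw [← dist_eq_norm]
          exact le_max_right _ _
      _ ≤ _ := by
          gcongr
          exact le_add_of_nonneg_left (by positivity)

end IsLogField

namespace IsLogField

variable {Ω : Type*} [MeasurableSpace Ω] {P : Measure Ω} {X : Scale × Pt d → Ω → ℝ}
  {C : Scale × Pt d → Scale × Pt d → ℝ} {G : Scale → Pt d → Pt d → ℝ}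
  {K : Pt d → Pt d → ℝ} {c₀ γ β τ : ℝ} {k₀ : ℕ}

/-- The covariances of two distinct points with a nearby lattice point grow linearly along the
scales, with slope `1` only. -/
theorem exists_cov_add_le (H : IsLogField P X C G K c₀) {x y : Pt d} (hxy : x ≠ y) :
    ∃ B, ∀ (ε ε' : Scale) (k : ℕ),
      C (ε, x) (latPt k x) + C (ε', y) (latPt k x) ≤ k + B ∧
      C (ε, x) (latPt k y) + C (ε', y) (latPt k y) ≤ k + B := by
  set r := min 1 (dist x y / (1 + √d)) with hr
  have hd0 : 0 < 1 + √(d : ℝ) := by positivity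
  have hr0 : 0 < r := lt_min one_pos (div_pos (dist_pos.2 hxy) hd0)
  have key : ∀ (ε : Scale) (u v : Pt d) (k : ℕ), dist u v = dist x y →
      C (ε, v) (latPt k u) ≤ Real.log r⁻¹ + c₀ := by
    intro ε u v k huv
    refine H.cov.upper ε (expScale k) v (cellPt k u) r hr0 (min_le_left _ _) ?_
    refine (min_le_right _ _).trans ((div_le_iff₀ hd0).2 ?_)
    rw [← huv]
    have h1 := dist_cellPt_le k u
    have h2 := dist_triangle u (cellPt k u) v
    rw [dist_comm (cellPt k u) v] at h2
    set m := max (max (ε : ℝ) (expScale k)) (dist v (cellPt k u)) with hm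
    have h3 : Real.exp (-(k : ℝ)) ≤ m := by
      rw [← coe_expScale]
      exact (le_max_right _ _).trans (le_max_left _ _)
    have h4 : dist v (cellPt k u) ≤ m := le_max_right _ _
    have h5 : √(d : ℝ) * Real.exp (-(k : ℝ)) ≤ √d * m := by gcongr
    linarith
  refine ⟨2 * c₀ + Real.log r⁻¹, fun ε ε' k => ⟨?_, ?_⟩⟩
  · have h1 : C (ε, x) (latPt k x) ≤ k + c₀ := H.cov_cellPt_le _ k _
    have h2 := key ε' x y k rfl
    linarith
  · have h1 : C (ε', y) (latPt k y) ≤ k + c₀ := H.cov_cellPt_le _ k _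
    have h2 := key ε y x k (dist_comm _ _)
    linarith

theorem tendsto_integral_cutoff [IsProbabilityMeasure P] (H : IsLogField P X C G K c₀)
    (hγ : 0 < γ) (hβ : 0 < β) (hβτ : β ≤ τ) {ι : Type*} {l : Filter ι} [l.NeBot]
    [l.IsCountablyGenerated] {c : ι → Scale × Pt d → ℝ} {c' : Scale × Pt d → ℝ} {x y : Pt d}
    {B : ℝ} (hB : ∀ i k, c i (latPt k x) ≤ k + B ∧ c i (latPt k y) ≤ k + B)
    (hx : ∀ k, Tendsto (fun i => c i (latPt k x)) l (𝓝 (c' (latPt k x))))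
    (hy : ∀ k, Tendsto (fun i => c i (latPt k y)) l (𝓝 (c' (latPt k y)))) :
    Tendsto (fun i => ∫ ω, cutoff β (γ + τ) k₀ X (tiltShift γ k₀ (c i) x) x ω *
      cutoff β (γ + τ) k₀ X (tiltShift γ k₀ (c i) y) y ω ∂P) l
      (𝓝 (∫ ω, cutoff β (γ + τ) k₀ X (tiltShift γ k₀ c' x) x ω *
        cutoff β (γ + τ) k₀ X (tiltShift γ k₀ c' y) y ω ∂P)) := by
  have key : ∀ z, (∀ i k, c i (latPt k z) ≤ k + B) →
      (∀ k, Tendsto (fun i => c i (latPt k z)) l (𝓝 (c' (latPt k z)))) →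
      ∀ᵐ ω ∂P, Tendsto (fun i => cutoff β (γ + τ) k₀ X (tiltShift γ k₀ (c i) z) z ω) l
        (𝓝 (cutoff β (γ + τ) k₀ X (tiltShift γ k₀ c' z) z ω)) := by
    intro z hBz hz
    have hle : ∀ (a : ℝ) (k : ℕ) (ω : Ω), a ≤ k₀ + k + B →
        β * (X (latPt (k₀ + k) z) ω - (γ + τ) * (k₀ + k : ℕ) + γ * a) ≤
          β * (X (latPt (k₀ + k) z) ω - τ * (k₀ + k : ℕ) + γ * B) := by
      intro a k ω ha
      refine mul_le_mul_of_nonneg_left ?_ hβ.le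
      have := mul_le_mul_of_nonneg_left ha hγ.le
      push_cast
      linarith
    filter_upwards [H.ae_summable_exp (k₀ := k₀) hβ hβτ z (γ * B)] with ω hω
    refine tendsto_damp hω (Eventually.of_forall fun i k => hle _ k ω ?_) (fun k => hle _ k ω ?_)
      fun k => (((hz (k₀ + k)).const_mul γ).const_add _).const_mul β
    · exact_mod_cast hBz i (k₀ + k)
    · exact_mod_cast le_of_tendsto' (hz (k₀ + k)) fun i => hBz i (k₀ + k)
  refine tendsto_integral_filter_of_dominated_convergence (fun _ => 1)
    (Eventually.of_forall fun i => ((H.measurable_cutoff_right _ x).mul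
      (H.measurable_cutoff_right _ y)).aestronglyMeasurable)
    (Eventually.of_forall fun i => Eventually.of_forall fun ω => ?_) (integrable_const _) ?_
  · rw [Real.norm_of_nonneg (cutoff_mul_nonneg _ _ _ _ _)]
    exact cutoff_mul_le_one _ _ _ _ _
  · filter_upwards [key x (fun i k => (hB i k).1) hx, key y (fun i k => (hB i k).2) hy]
      with ω h1 h2 using h1.mul h2

theorem measurable_integral_cutoff [IsProbabilityMeasure P] (H : IsLogField P X C G K c₀) {α : ℝ}
    {c : Pt d × Pt d → Scale × Pt d → ℝ} (h1 : ∀ k, Measurable fun p => c p (latPt k p.1))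
    (h2 : ∀ k, Measurable fun p => c p (latPt k p.2)) :
    Measurable fun p : Pt d × Pt d => ∫ ω, cutoff β α k₀ X (tiltShift γ k₀ (c p) p.1) p.1 ω *
      cutoff β α k₀ X (tiltShift γ k₀ (c p) p.2) p.2 ω ∂P := by
  refine StronglyMeasurable.measurable (StronglyMeasurable.integral_prod_right'
    (f := fun q : (Pt d × Pt d) × Ω =>
      cutoff β α k₀ X (tiltShift γ k₀ (c q.1) q.1.1) q.1.1 q.2 *
      cutoff β α k₀ X (tiltShift γ k₀ (c q.1) q.1.2) q.1.2 q.2) ?_)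
  refine (Measurable.mul ?_ ?_).stronglyMeasurable
  · exact measurable_damp fun k => ((((H.measurable_latPt (k₀ + k)).comp
      ((measurable_fst.comp measurable_fst).prodMk measurable_snd)).sub_const _).add
      (((h1 (k₀ + k)).comp measurable_fst).const_mul _)).const_mul _
  · exact measurable_damp fun k => ((((H.measurable_latPt (k₀ + k)).comp
      ((measurable_snd.comp measurable_fst).prodMk measurable_snd)).sub_const _).add
      (((h2 (k₀ + k)).comp measurable_fst).const_mul _)).const_mul _

theorem ae_tendsto_latPt (H : IsLogField P X C G K c₀) :
    ∀ᵐ x : Pt d, ∀ (k : ℕ) (z : Pt d), Tendsto (fun ε => C (ε, x) (latPt k z)) smallScale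
      (𝓝 (G (expScale k) x (cellPt k z))) := by
  have h : ∀ᵐ x : Pt d, ∀ (k : ℕ) (n : Fin d → ℤ),
      Tendsto (fun ε => C (ε, x) (expScale k, meshPt k n)) smallScale
      (𝓝 (G (expScale k) x (meshPt k n))) :=
    ae_all_iff.2 fun k => ae_all_iff.2 fun n => H.cov.lim1 _ _
  filter_upwards [h] with x hx k z using hx k _

end IsLogField

theorem ae_prod_of_forall_ae_tendsto {α : Type*} [MeasurableSpace α] {μ ν : Measure α} [SFinite μ]
    [SFinite ν] {F : ℕ → α × α → ℝ} {f : α × α → ℝ} (hF : ∀ n, Measurable (F n))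
    (hf : Measurable f) (h : ∀ x, ∀ᵐ y ∂ν, Tendsto (fun n => F n (x, y)) atTop (𝓝 (f (x, y)))) :
    ∀ᵐ p ∂μ.prod ν, Tendsto (fun n => F n p) atTop (𝓝 (f p)) :=
  (Measure.ae_prod_iff_ae_ae (measurableSet_tendsto_fun hF hf)).2 (Eventually.of_forall h)

theorem ae_prod_of_forall_ae_tendsto' {α : Type*} [MeasurableSpace α] {μ ν : Measure α} [SFinite μ]
    [SFinite ν] {F : ℕ → α × α → ℝ} {f : α × α → ℝ} (hF : ∀ n, Measurable (F n))
    (hf : Measurable f) (h : ∀ y, ∀ᵐ x ∂μ, Tendsto (fun n => F n (x, y)) atTop (𝓝 (f (x, y)))) :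
    ∀ᵐ p ∂μ.prod ν, Tendsto (fun n => F n p) atTop (𝓝 (f p)) := by
  have := ae_prod_of_forall_ae_tendsto (μ := ν) (ν := μ) (F := fun n p => F n p.swap)
    (f := fun p => f p.swap) (fun n => (hF n).comp measurable_swap) (hf.comp measurable_swap) h
  exact (Measure.measurePreserving_swap (μ := μ) (ν := ν)).quasiMeasurePreserving.ae this

theorem integrable_exp_mul_logPlus_sub_one (hd : 1 ≤ d) {s : ℝ} (hs0 : 0 ≤ s) (hsd : s < d) :
    Integrable fun w : Pt d => Real.exp (s * logPlus w) - 1 := by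
  have := nontrivial_pt hd
  refine (integrable_fun_norm_addHaar (volume : Measure (Pt d))
    (f := fun y => Real.exp (s * max (Real.log y⁻¹) 0) - 1)).2 ?_
  rw [finrank_euclideanSpace_fin, ← Set.Ioc_union_Ioi_eq_Ioi (zero_le_one (α := ℝ)),
    integrableOn_union]
  constructor
  · have h1 : IntegrableOn (fun y : ℝ => y ^ ((d : ℝ) - 1 - s)) (Set.Ioc 0 1) :=
      (intervalIntegral.intervalIntegrable_rpow' (a := 0) (b := 1) (by linarith)).1
    refine Integrable.mono' h1 ?_ ?_
    · refine Measurable.aestronglyMeasurable ?_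
      simp only [smul_eq_mul]
      exact (measurable_id.pow_const _).mul
        ((((Real.measurable_log.comp measurable_inv).max
          measurable_const).const_mul _).exp.sub_const _)
    · filter_upwards [ae_restrict_mem measurableSet_Ioc] with y hy
      have h0 : 0 ≤ Real.log y⁻¹ := Real.log_nonneg ((one_le_inv₀ hy.1).2 hy.2)
      have h2 : 1 ≤ Real.exp (s * Real.log y⁻¹) := Real.one_le_exp (mul_nonneg hs0 h0)
      rw [max_eq_left h0, smul_eq_mul,
        Real.norm_of_nonneg (mul_nonneg (pow_nonneg hy.1.le _) (sub_nonneg.2 h2))]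
      calc y ^ (d - 1) * (Real.exp (s * Real.log y⁻¹) - 1)
          ≤ y ^ (d - 1) * Real.exp (s * Real.log y⁻¹) :=
            mul_le_mul_of_nonneg_left (by linarith) (pow_nonneg hy.1.le _)
        _ = y ^ ((d : ℝ) - 1 - s) := by
          have h3 : ((d - 1 : ℕ) : ℝ) = (d : ℝ) - 1 := by push_cast [hd]; ring
          rw [← Real.rpow_natCast, h3, Real.rpow_def_of_pos hy.1, Real.rpow_def_of_pos hy.1,
            Real.log_inv, ← Real.exp_add]
          ring_nf
  · refine (integrableOn_zero : IntegrableOn (fun _ : ℝ => (0 : ℝ)) _ _).congr_fun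
      (fun y hy => ?_) measurableSet_Ioi
    have : 0 ≤ Real.log y := Real.log_nonneg (le_of_lt hy)
    simp [this]

theorem integrable_mul_mul_exp_logPlus (hd : 1 ≤ d) {s N : ℝ} (hs0 : 0 ≤ s) (hsd : s < d)
    {h : Pt d → ℝ} (hh : Integrable h) (hN : ∀ x, |h x| ≤ N) :
    Integrable (fun p : Pt d × Pt d => h p.1 * h p.2 * Real.exp (s * logPlus (p.1 - p.2)))
      (volume.prod volume) := by
  have h1 := hh.convolution_integrand (ContinuousLinearMap.mul ℝ ℝ)
    (integrable_exp_mul_logPlus_sub_one hd hs0 hsd)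
  have h2 := (h1.bdd_mul (c := N) (f := fun p : Pt d × Pt d => h p.1)
    hh.aestronglyMeasurable.comp_fst (Eventually.of_forall fun p => hN _)).add (hh.mul_prod hh)
  refine h2.congr (Eventually.of_forall fun p => ?_)
  simp only [Pi.add_apply, ContinuousLinearMap.mul_apply']
  ring

theorem ae_prod_ne (hd : 1 ≤ d) :
    ∀ᵐ p : Pt d × Pt d ∂(volume.prod volume), p.1 ≠ p.2 := by
  have := nontrivial_pt hd
  refine (Measure.ae_prod_iff_ae_ae
    (measurableSet_eq_fun measurable_fst measurable_snd).compl).2 (Eventually.of_forall fun x => ?_)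
  have h : ∀ᵐ y : Pt d, y ≠ x := by
    rw [ae_iff]
    simp
  filter_upwards [h] with y hy using hy.symm

/-- The two-point function of the truncated chaos. -/
def twoPoint {Ω : Type*} [MeasurableSpace Ω] (P : Measure Ω) (γ β α : ℝ) (k₀ : ℕ)
    (X : Scale × Pt d → Ω → ℝ) (C : Scale × Pt d → Scale × Pt d → ℝ) (ε ε' : Scale)
    (p : Pt d × Pt d) : ℝ :=
  ∫ ω, dens γ X C ε p.1 ω * dens γ X C ε' p.2 ω *
    (cutoff β α k₀ X 0 p.1 ω * cutoff β α k₀ X 0 p.2 ω) ∂P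

/-- The two-point function of the cutoff, after tilting the field by `c`. -/
def tiltedCutoff {Ω : Type*} [MeasurableSpace Ω] (P : Measure Ω) (γ β α : ℝ) (k₀ : ℕ)
    (X : Scale × Pt d → Ω → ℝ) (c : Scale × Pt d → ℝ) (p : Pt d × Pt d) : ℝ :=
  ∫ ω, cutoff β α k₀ X (tiltShift γ k₀ c p.1) p.1 ω *
    cutoff β α k₀ X (tiltShift γ k₀ c p.2) p.2 ω ∂P

/-- The integral of `h` against the truncated chaos. -/
def truncInt {Ω : Type*} (γ β α : ℝ) (k₀ : ℕ) (X : Scale × Pt d → Ω → ℝ)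
    (C : Scale × Pt d → Scale × Pt d → ℝ) (h : Pt d → ℝ) (ε : Scale) (ω : Ω) : ℝ :=
  ∫ x, h x * (dens γ X C ε x ω * cutoff β α k₀ X 0 x ω)

namespace IsLogField

variable {Ω : Type*} [MeasurableSpace Ω] {P : Measure Ω} {X : Scale × Pt d → Ω → ℝ}
  {C : Scale × Pt d → Scale × Pt d → ℝ} {G : Scale → Pt d → Pt d → ℝ}
  {K : Pt d → Pt d → ℝ} {c₀ γ β α τ : ℝ} {k₀ : ℕ}

theorem measurable_twoPoint [IsProbabilityMeasure P] (H : IsLogField P X C G K c₀)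
    (ε ε' : Scale) : Measurable (twoPoint P γ β α k₀ X C ε ε') := by
  refine StronglyMeasurable.measurable (StronglyMeasurable.integral_prod_right'
    (f := fun q : (Pt d × Pt d) × Ω => dens γ X C ε q.1.1 q.2 * dens γ X C ε' q.1.2 q.2 *
      (cutoff β α k₀ X 0 q.1.1 q.2 * cutoff β α k₀ X 0 q.1.2 q.2)) ?_)
  have h1 : Measurable fun q : (Pt d × Pt d) × Ω => (q.1.1, q.2) := by fun_prop
  have h2 : Measurable fun q : (Pt d × Pt d) × Ω => (q.1.2, q.2) := by fun_prop
  exact ((((H.measurable_dens ε).comp h1).mul ((H.measurable_dens ε').comp h2)).mul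
    (((H.measurable_cutoff 0).comp h1).mul
      ((H.measurable_cutoff 0).comp h2))).stronglyMeasurable

theorem twoPoint_eq [IsProbabilityMeasure P] (H : IsLogField P X C G K c₀) (ε ε' : Scale)
    (p : Pt d × Pt d) : twoPoint P γ β α k₀ X C ε ε' p =
      Real.exp (γ ^ 2 * C (ε, p.1) (ε', p.2)) *
        tiltedCutoff P γ β α k₀ X (fun t => C (ε, p.1) t + C (ε', p.2) t) p :=
  H.integral_dens_mul_cutoff ε ε' p.1 p.2

theorem twoPoint_nonneg (ε ε' : Scale) (p : Pt d × Pt d) :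
    0 ≤ twoPoint P γ β α k₀ X C ε ε' p :=
  integral_nonneg fun ω => mul_nonneg (mul_pos (dens_pos γ X C ε p.1 ω)
    (dens_pos γ X C ε' p.2 ω)).le (cutoff_mul_nonneg _ _ _ _ _)

/-- The limit of the two-point function in its first scale. -/
def limOne (P : Measure Ω) (γ β α : ℝ) (k₀ : ℕ) (X : Scale × Pt d → Ω → ℝ)
    (C : Scale × Pt d → Scale × Pt d → ℝ) (G : Scale → Pt d → Pt d → ℝ) (ε' : Scale)
    (p : Pt d × Pt d) : ℝ :=
  Real.exp (γ ^ 2 * G ε' p.1 p.2) *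
    tiltedCutoff P γ β α k₀ X (fun t => G t.1 p.1 t.2 + C (ε', p.2) t) p

/-- The limit of the two-point function in both scales. -/
def limTwo (P : Measure Ω) (γ β α : ℝ) (k₀ : ℕ) (X : Scale × Pt d → Ω → ℝ)
    (G : Scale → Pt d → Pt d → ℝ) (K : Pt d → Pt d → ℝ) (p : Pt d × Pt d) : ℝ :=
  Real.exp (γ ^ 2 * K p.1 p.2) *
    tiltedCutoff P γ β α k₀ X (fun t => G t.1 p.1 t.2 + G t.1 p.2 t.2) p

theorem measurable_latPt_cov {F : Pt d → Pt d → ℝ}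
    (hF : Measurable fun p : Pt d × Pt d => F p.1 p.2) {u v : Pt d × Pt d → Pt d}
    (hu : Measurable u) (hv : Measurable v) (k : ℕ) :
    Measurable fun p : Pt d × Pt d => F (u p) (cellPt k (v p)) :=
  hF.comp (hu.prodMk ((measurable_cellPt k).comp hv))

theorem measurable_limOne [IsProbabilityMeasure P] (H : IsLogField P X C G K c₀) (ε' : Scale) :
    Measurable (limOne P γ β α k₀ X C G ε') := by
  refine (((H.cov.measG ε').const_mul _).exp).mul (H.measurable_integral_cutoff
    (c := fun p t => G t.1 p.1 t.2 + C (ε', p.2) t) (fun k => ?_) fun k => ?_)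
  · exact (measurable_latPt_cov (H.cov.measG _) measurable_fst measurable_fst k).add
      (measurable_latPt_cov (F := fun x y => C (ε', x) (expScale k, y)) (H.cov.meas _ _)
        measurable_snd measurable_fst k)
  · exact (measurable_latPt_cov (H.cov.measG _) measurable_fst measurable_snd k).add
      (measurable_latPt_cov (F := fun x y => C (ε', x) (expScale k, y)) (H.cov.meas _ _)
        measurable_snd measurable_snd k)

theorem ae_tendsto_twoPoint_diag [IsProbabilityMeasure P] (H : IsLogField P X C G K c₀)
    (hd : 1 ≤ d) (hγ : 0 < γ) (hβ : 0 < β) (hβτ : β ≤ τ) :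
    ∀ᵐ p ∂((volume : Measure (Pt d)).prod volume), Tendsto
      (fun ε => twoPoint P γ β (γ + τ) k₀ X C ε ε p) smallScale
      (𝓝 (limTwo P γ β (γ + τ) k₀ X G K p)) := by
  filter_upwards [H.cov.lim3, ae_prod_ne hd, Measure.quasiMeasurePreserving_fst.ae
    H.ae_tendsto_latPt, Measure.quasiMeasurePreserving_snd.ae H.ae_tendsto_latPt] with p h1 h2 h3 h4
  simp only [H.twoPoint_eq]
  obtain ⟨B, hB⟩ := H.exists_cov_add_le h2
  refine ((Real.continuous_exp.tendsto _).comp (h1.const_mul _)).mul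
    (H.tendsto_integral_cutoff hγ hβ hβτ (B := B) (fun ε k => hB ε ε k) (fun k => ?_) fun k => ?_)
  · exact (h3 k p.1).add (h4 k p.1)
  · exact (h3 k p.2).add (h4 k p.2)

theorem ae_tendsto_twoPoint [IsProbabilityMeasure P] (H : IsLogField P X C G K c₀)
    (hd : 1 ≤ d) (hγ : 0 < γ) (hβ : 0 < β) (hβτ : β ≤ τ) (ε' : Scale) {u : ℕ → Scale}
    (hu : Tendsto u atTop smallScale) :
    ∀ᵐ p ∂((volume : Measure (Pt d)).prod volume), Tendsto
      (fun n => twoPoint P γ β (γ + τ) k₀ X C (u n) ε' p) atTop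
      (𝓝 (limOne P γ β (γ + τ) k₀ X C G ε' p)) := by
  have h1 : ∀ᵐ p ∂((volume : Measure (Pt d)).prod volume), Tendsto
      (fun n => C (u n, p.1) (ε', p.2)) atTop (𝓝 (G ε' p.1 p.2)) :=
    ae_prod_of_forall_ae_tendsto' (F := fun n p => C (u n, p.1) (ε', p.2))
      (f := fun p => G ε' p.1 p.2) (fun n => H.cov.meas _ _) (H.cov.measG _) fun y => by
        filter_upwards [H.cov.lim1 ε' y] with x hx using hx.comp hu
  filter_upwards [h1, ae_prod_ne hd, Measure.quasiMeasurePreserving_fst.ae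
    H.ae_tendsto_latPt] with p h1 h2 h3
  simp only [H.twoPoint_eq]
  obtain ⟨B, hB⟩ := H.exists_cov_add_le h2
  refine ((Real.continuous_exp.tendsto _).comp (h1.const_mul _)).mul
    (H.tendsto_integral_cutoff hγ hβ hβτ (B := B) (fun n k => hB (u n) ε' k)
      (fun k => ?_) fun k => ?_)
  · exact ((h3 k p.1).comp hu).add_const _
  · exact ((h3 k p.2).comp hu).add_const _

theorem ae_tendsto_limOne [IsProbabilityMeasure P] (H : IsLogField P X C G K c₀)
    (hd : 1 ≤ d) (hγ : 0 < γ) (hβ : 0 < β) (hβτ : β ≤ τ) {u : ℕ → Scale}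
    (hu : Tendsto u atTop smallScale) :
    ∀ᵐ p ∂((volume : Measure (Pt d)).prod volume), Tendsto
      (fun n => limOne P γ β (γ + τ) k₀ X C G (u n) p) atTop
      (𝓝 (limTwo P γ β (γ + τ) k₀ X G K p)) := by
  have h1 : ∀ᵐ p ∂((volume : Measure (Pt d)).prod volume), Tendsto
      (fun n => G (u n) p.1 p.2) atTop (𝓝 (K p.1 p.2)) :=
    ae_prod_of_forall_ae_tendsto (F := fun n p => G (u n) p.1 p.2)
      (f := fun p => K p.1 p.2) (fun n => H.cov.measG _) H.cov.measK fun x => by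
        filter_upwards [H.cov.lim2 x] with y hy using hy.comp hu
  filter_upwards [h1, ae_prod_ne hd, Measure.quasiMeasurePreserving_fst.ae
    H.ae_tendsto_latPt, Measure.quasiMeasurePreserving_snd.ae H.ae_tendsto_latPt] with p h1 h2 h3 h4
  obtain ⟨B, hB⟩ := H.exists_cov_add_le h2
  refine ((Real.continuous_exp.tendsto _).comp (h1.const_mul _)).mul
    (H.tendsto_integral_cutoff hγ hβ hβτ (B := B) (fun n k => ⟨?_, ?_⟩) (fun k => ?_) fun k => ?_)
  · exact le_of_tendsto' ((h3 k p.1).add_const _) fun ε => (hB ε (u n) k).1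
  · exact le_of_tendsto' ((h3 k p.2).add_const _) fun ε => (hB ε (u n) k).2
  · exact ((h4 k p.1).comp hu).const_add _
  · exact ((h4 k p.2).comp hu).const_add _

end IsLogField

namespace IsLogField

variable {Ω : Type*} [MeasurableSpace Ω] {P : Measure Ω} {X : Scale × Pt d → Ω → ℝ}
  {C : Scale × Pt d → Scale × Pt d → ℝ} {G : Scale → Pt d → Pt d → ℝ}
  {K : Pt d → Pt d → ℝ} {c₀ γ β α τ s M : ℝ} {k₀ : ℕ} {h : Pt d → ℝ}

theorem norm_mul_twoPoint_le {ε ε' : Scale} {p : Pt d × Pt d} (hp : p.1 ≠ p.2)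
    (hM : ∀ (ε ε' : Scale) (p : Pt d × Pt d), p.1 ≠ p.2 →
      twoPoint P γ β α k₀ X C ε ε' p ≤ M * Real.exp (s * logPlus (p.1 - p.2))) :
    ‖h p.1 * h p.2 * twoPoint P γ β α k₀ X C ε ε' p‖ ≤
      M * ‖h p.1 * h p.2 * Real.exp (s * logPlus (p.1 - p.2))‖ := by
  rw [norm_mul _ (twoPoint _ _ _ _ _ _ _ _ _ _), norm_mul _ (Real.exp _),
    Real.norm_of_nonneg (twoPoint_nonneg ε ε' p), Real.norm_of_nonneg (Real.exp_pos _).le,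
    mul_left_comm]
  exact mul_le_mul_of_nonneg_left (hM ε ε' p hp) (norm_nonneg _)

theorem integral_truncInt_mul [IsProbabilityMeasure P] (H : IsLogField P X C G K c₀) (hd : 1 ≤ d)
    (hh : Integrable h)
    (hW : Integrable (fun p : Pt d × Pt d => h p.1 * h p.2 * Real.exp (s * logPlus (p.1 - p.2)))
      (volume.prod volume))
    (hM : ∀ (ε ε' : Scale) (p : Pt d × Pt d), p.1 ≠ p.2 →
      twoPoint P γ β α k₀ X C ε ε' p ≤ M * Real.exp (s * logPlus (p.1 - p.2)))
    (ε ε' : Scale) :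
    Integrable (fun ω => truncInt γ β α k₀ X C h ε ω * truncInt γ β α k₀ X C h ε' ω) P ∧
    ∫ ω, truncInt γ β α k₀ X C h ε ω * truncInt γ β α k₀ X C h ε' ω ∂P =
      ∫ p : Pt d × Pt d, h p.1 * h p.2 * twoPoint P γ β α k₀ X C ε ε' p ∂(volume.prod volume) := by
  set F : (Pt d × Pt d) × Ω → ℝ := fun q => h q.1.1 * h q.1.2 *
    (dens γ X C ε q.1.1 q.2 * dens γ X C ε' q.1.2 q.2 *
      (cutoff β α k₀ X 0 q.1.1 q.2 * cutoff β α k₀ X 0 q.1.2 q.2)) with hF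
  have h1 : Measurable fun q : (Pt d × Pt d) × Ω => (q.1.1, q.2) := by fun_prop
  have h2 : Measurable fun q : (Pt d × Pt d) × Ω => (q.1.2, q.2) := by fun_prop
  have hm : AEStronglyMeasurable F ((volume.prod volume).prod P) := by
    refine AEStronglyMeasurable.mul
      (hh.aestronglyMeasurable.comp_fst.mul hh.aestronglyMeasurable.comp_snd).comp_fst ?_
    exact ((((H.measurable_dens ε).comp h1).mul ((H.measurable_dens ε').comp h2)).mul
      (((H.measurable_cutoff 0).comp h1).mul
        ((H.measurable_cutoff 0).comp h2))).aestronglyMeasurable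
  have hFi : Integrable F ((volume.prod volume).prod P) := by
    refine (integrable_prod_iff hm).2 ⟨Eventually.of_forall fun p =>
      (H.integrable_dens_mul_cutoff (γ := γ) ε ε' p.1 p.2).const_mul (h p.1 * h p.2), ?_⟩
    refine Integrable.mono' (hW.norm.const_mul M) hm.norm.integral_prod_right' ?_
    filter_upwards [ae_prod_ne hd] with p hp
    refine le_trans (le_of_eq ?_) (norm_mul_twoPoint_le (ε := ε) (ε' := ε') hp hM)
    rw [Real.norm_of_nonneg (integral_nonneg fun _ => norm_nonneg _),
      norm_mul _ (twoPoint _ _ _ _ _ _ _ _ _ _), Real.norm_of_nonneg (twoPoint_nonneg ε ε' p),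
      twoPoint, ← integral_const_mul]
    refine integral_congr_ae (Eventually.of_forall fun ω => ?_)
    simp only [hF]
    rw [norm_mul, Real.norm_of_nonneg (mul_nonneg (mul_pos (dens_pos γ X C ε p.1 ω)
      (dens_pos γ X C ε' p.2 ω)).le (cutoff_mul_nonneg _ _ _ _ _))]
  have e : ∀ ω, truncInt γ β α k₀ X C h ε ω * truncInt γ β α k₀ X C h ε' ω =
      ∫ p : Pt d × Pt d, F (p, ω) ∂(volume.prod volume) := by
    intro ω
    rw [truncInt, truncInt, ← integral_prod_mul]
    refine integral_congr_ae (Eventually.of_forall fun p => ?_)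
    simp only [hF]
    ring
  simp only [e]
  refine ⟨hFi.integral_prod_right, ?_⟩
  rw [← integral_integral_swap (f := fun p ω => F (p, ω)) hFi]
  refine integral_congr_ae (Eventually.of_forall fun p => ?_)
  simp only [hF, integral_const_mul, twoPoint]

/-- The truncated chaos is Cauchy in `L²`. -/
theorem exists_integral_sq_truncInt_sub_le [IsProbabilityMeasure P] (H : IsLogField P X C G K c₀)
    (hd : 1 ≤ d) (hγ : 0 < γ) (hβ : 0 < β) (hβτ : β ≤ τ) (hh : Integrable h)
    (hW : Integrable (fun p : Pt d × Pt d => h p.1 * h p.2 * Real.exp (s * logPlus (p.1 - p.2)))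
      (volume.prod volume))
    (hM : ∀ (ε ε' : Scale) (p : Pt d × Pt d), p.1 ≠ p.2 →
      twoPoint P γ β (γ + τ) k₀ X C ε ε' p ≤ M * Real.exp (s * logPlus (p.1 - p.2)))
    {η : ℝ} (hη : 0 < η) : ∃ ε', ∀ᶠ ε in smallScale,
      Integrable (fun ω => (truncInt γ β (γ + τ) k₀ X C h ε ω -
        truncInt γ β (γ + τ) k₀ X C h ε' ω) ^ 2) P ∧
      ∫ ω, (truncInt γ β (γ + τ) k₀ X C h ε ω - truncInt γ β (γ + τ) k₀ X C h ε' ω) ^ 2 ∂P ≤ η := by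
  set A : Scale → Scale → ℝ := fun ε ε' =>
    ∫ p : Pt d × Pt d, h p.1 * h p.2 * twoPoint P γ β (γ + τ) k₀ X C ε ε' p ∂(volume.prod volume)
    with hA
  set A1 : Scale → ℝ := fun ε' =>
    ∫ p : Pt d × Pt d, h p.1 * h p.2 * limOne P γ β (γ + τ) k₀ X C G ε' p ∂(volume.prod volume)
    with hA1
  set L := ∫ p : Pt d × Pt d, h p.1 * h p.2 * limTwo P γ β (γ + τ) k₀ X G K p
    ∂(volume.prod volume) with hL
  have hhm : AEStronglyMeasurable (fun p : Pt d × Pt d => h p.1 * h p.2) (volume.prod volume) :=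
    hh.aestronglyMeasurable.comp_fst.mul hh.aestronglyMeasurable.comp_snd
  have t1 : Tendsto (fun ε => A ε ε) smallScale (𝓝 L) := by
    refine tendsto_integral_filter_of_dominated_convergence _ (Eventually.of_forall fun ε =>
      hhm.mul (H.measurable_twoPoint ε ε).aestronglyMeasurable) (Eventually.of_forall fun ε => ?_)
      (hW.norm.const_mul M) ?_
    · filter_upwards [ae_prod_ne hd] with p hp using norm_mul_twoPoint_le hp hM
    · filter_upwards [H.ae_tendsto_twoPoint_diag (k₀ := k₀) hd hγ hβ hβτ] with p hp
        using hp.const_mul _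
  have t2 : ∀ ε', Tendsto (fun ε => A ε ε') smallScale (𝓝 (A1 ε')) := by
    intro ε'
    refine tendsto_of_seq_tendsto fun u hu => ?_
    refine tendsto_integral_of_dominated_convergence _ (fun n =>
      hhm.mul (H.measurable_twoPoint (u n) ε').aestronglyMeasurable) (hW.norm.const_mul M)
      (fun n => ?_) ?_
    · filter_upwards [ae_prod_ne hd] with p hp using norm_mul_twoPoint_le hp hM
    · filter_upwards [H.ae_tendsto_twoPoint (k₀ := k₀) hd hγ hβ hβτ ε' hu] with p hp
        using hp.const_mul _
  have t3 : Tendsto A1 smallScale (𝓝 L) := by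
    refine tendsto_of_seq_tendsto fun u hu => ?_
    refine tendsto_integral_of_dominated_convergence _ (fun n =>
      hhm.mul (H.measurable_limOne (u n)).aestronglyMeasurable) (hW.norm.const_mul M)
      (fun n => ?_) ?_
    · obtain ⟨v, hv⟩ := exists_seq_tendsto smallScale
      filter_upwards [ae_prod_ne hd, H.ae_tendsto_twoPoint (k₀ := k₀) hd hγ hβ hβτ (u n) hv]
        with p hp hp2
      exact le_of_tendsto' (hp2.const_mul _).norm fun m => norm_mul_twoPoint_le hp hM
    · filter_upwards [H.ae_tendsto_limOne (k₀ := k₀) hd hγ hβ hβτ hu] with p hp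
        using hp.const_mul _
  obtain ⟨ε', h1, h3⟩ := ((t1.eventually (Metric.ball_mem_nhds L (by positivity : 0 < η / 6))).and
    (t3.eventually (Metric.ball_mem_nhds L (by positivity : 0 < η / 6)))).exists
  refine ⟨ε', ?_⟩
  filter_upwards [t1.eventually (Metric.ball_mem_nhds L (by positivity : 0 < η / 6)),
    (t2 ε').eventually (Metric.ball_mem_nhds (A1 ε') (by positivity : 0 < η / 6))] with ε h0 h2
  rw [Real.dist_eq, abs_lt] at h0 h1 h2 h3
  have key := fun ε ε' => H.integral_truncInt_mul (γ := γ) hd hh hW hM ε ε'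
  have e : ∀ ω, (truncInt γ β (γ + τ) k₀ X C h ε ω - truncInt γ β (γ + τ) k₀ X C h ε' ω) ^ 2 =
      truncInt γ β (γ + τ) k₀ X C h ε ω * truncInt γ β (γ + τ) k₀ X C h ε ω -
      2 * (truncInt γ β (γ + τ) k₀ X C h ε ω * truncInt γ β (γ + τ) k₀ X C h ε' ω) +
      truncInt γ β (γ + τ) k₀ X C h ε' ω * truncInt γ β (γ + τ) k₀ X C h ε' ω := fun ω => by ring
  simp only [e]
  have i1 := (key ε ε).1.sub ((key ε ε').1.const_mul 2)
  refine ⟨i1.add (key ε' ε').1, ?_⟩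
  have e2 := (integral_add i1 (key ε' ε').1).trans
    (congrArg₂ _ (integral_sub (key ε ε).1 ((key ε ε').1.const_mul 2)) rfl)
  rw [integral_const_mul, (key ε ε).2, (key ε ε').2, (key ε' ε').2] at e2
  refine e2.le.trans ?_
  simp only [hA] at h0 h1 h2
  linarith [h0.2, h1.2, h2.1, h3.1]

theorem integral_abs_chaosInt_sub_truncInt_le [IsProbabilityMeasure P]
    (H : IsLogField P X C G K c₀) (hh : Integrable h) {η : ℝ} {ε : Scale}
    (hη : ∀ x, ∫ ω, dens γ X C ε x ω * (1 - cutoff β α k₀ X 0 x ω) ∂P ≤ η) :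
    Integrable (truncInt γ β α k₀ X C h ε) P ∧
    ∫ ω, |chaosInt γ X C h ε ω - truncInt γ β α k₀ X C h ε ω| ∂P ≤ η * ∫ x, |h x| := by
  have hm : Measurable fun q : Pt d × Ω => cutoff β α k₀ X 0 q.1 q.2 := H.measurable_cutoff 0
  have i0 := H.integrable_prod_dens (γ := γ) hh ε
  have i1 : Integrable (fun q : Pt d × Ω => h q.1 * (dens γ X C ε q.1 q.2 *
      cutoff β α k₀ X 0 q.1 q.2)) (volume.prod P) := by
    refine (i0.mul_bdd (c := 1) hm.aestronglyMeasurable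
      (Eventually.of_forall fun q => ?_)).congr (Eventually.of_forall fun q => ?_)
    · rw [Real.norm_of_nonneg cutoff_nonneg]
      exact cutoff_le_one
    · simp only
      ring
  have i2 := i0.sub i1
  refine ⟨i1.integral_prod_right, ?_⟩
  calc ∫ ω, |chaosInt γ X C h ε ω - truncInt γ β α k₀ X C h ε ω| ∂P
      ≤ ∫ ω, (∫ x, ‖h x * dens γ X C ε x ω -
          h x * (dens γ X C ε x ω * cutoff β α k₀ X 0 x ω)‖) ∂P := by
        refine integral_mono_ae (i0.integral_prod_right.sub i1.integral_prod_right).abs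
          i2.norm.integral_prod_right ?_
        filter_upwards [i0.prod_left_ae, i1.prod_left_ae] with ω h1 h2
        simp only [chaosInt, truncInt]
        rw [← integral_sub h1 h2]
        exact abs_integral_le_integral_abs
    _ = ∫ x, |h x| * ∫ ω, dens γ X C ε x ω * (1 - cutoff β α k₀ X 0 x ω) ∂P := by
        rw [← integral_integral_swap (f := fun x ω => ‖h x * dens γ X C ε x ω -
          h x * (dens γ X C ε x ω * cutoff β α k₀ X 0 x ω)‖) i2.norm]
        refine integral_congr_ae (Eventually.of_forall fun x => ?_)
        simp only
        rw [← integral_const_mul]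
        refine integral_congr_ae (Eventually.of_forall fun ω => ?_)
        simp only
        rw [← mul_sub, norm_mul, Real.norm_eq_abs, ← mul_one_sub, Real.norm_of_nonneg
          (mul_nonneg (dens_pos γ X C ε x ω).le (sub_nonneg.2 cutoff_le_one))]
    _ ≤ ∫ x, |h x| * η := by
        refine integral_mono_of_nonneg (Eventually.of_forall fun x => mul_nonneg (abs_nonneg _)
          (integral_nonneg fun ω => mul_nonneg (dens_pos γ X C ε x ω).le
            (sub_nonneg.2 cutoff_le_one))) (hh.abs.mul_const _)
          (Eventually.of_forall fun x => mul_le_mul_of_nonneg_left (hη x) (abs_nonneg _))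
    _ = η * ∫ x, |h x| := by rw [integral_mul_const, mul_comm]

end IsLogField

namespace IsLogField

variable {Ω : Type*} [MeasurableSpace Ω] {P : Measure Ω} {X : Scale × Pt d → Ω → ℝ}
  {C : Scale × Pt d → Scale × Pt d → ℝ} {G : Scale → Pt d → Pt d → ℝ}
  {K : Pt d → Pt d → ℝ} {c₀ γ : ℝ} {h : Pt d → ℝ}

theorem exists_cutoff_parameters (hγ : 0 < γ) (hγd : γ ^ 2 / 2 < d) : ∃ (τ β : ℝ) (p : ℕ),
    0 < τ ∧ τ ≤ γ ∧ 0 < β ∧ β ≤ τ ∧ p * β = γ - τ ∧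
      γ ^ 2 - (γ - τ) ^ 2 / 2 < d ∧ 0 ≤ γ ^ 2 - (γ - τ) ^ 2 / 2 := by
  set τ := min (γ / 2) ((d - γ ^ 2 / 2) / (2 * γ)) with hτ
  have h0 : 0 < τ := lt_min (by positivity) (div_pos (by linarith) (by positivity))
  have h1 : τ ≤ γ / 2 := min_le_left _ _
  have h2 : τ * (2 * γ) ≤ d - γ ^ 2 / 2 := (le_div_iff₀ (by positivity)).1 (min_le_right _ _)
  have h3 : 0 < γ - τ := by linarith
  set p := ⌈(γ - τ) / τ⌉₊ with hp
  have hp0 : 0 < p := Nat.ceil_pos.2 (div_pos h3 h0)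
  have hp1 : (0 : ℝ) < p := Nat.cast_pos.2 hp0
  refine ⟨τ, (γ - τ) / p, p, h0, by linarith, div_pos h3 hp1, ?_, mul_div_cancel₀ _ hp1.ne', ?_, ?_⟩
  · rw [div_le_iff₀ hp1, mul_comm, ← div_le_iff₀ h0]
    exact Nat.le_ceil _
  · nlinarith
  · nlinarith

theorem exists_integral_abs_chaosInt_sub_le_of_bounded [IsProbabilityMeasure P]
    (H : IsLogField P X C G K c₀) (hd : 1 ≤ d) (hγ : 0 < γ) (hγd : γ ^ 2 / 2 < d)
    (hh : Integrable h) {N : ℝ} (hN : ∀ x, |h x| ≤ N) {η : ℝ} (hη : 0 < η) :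
    ∃ ε', ∀ᶠ ε in smallScale,
      ∫ ω, |chaosInt γ X C h ε ω - chaosInt γ X C h ε' ω| ∂P ≤ η := by
  obtain ⟨τ, β, p, hτ, hτγ, hβ, hβτ, hp, hsd, hs0⟩ := exists_cutoff_parameters hγ hγd
  set m := ∫ x, |h x| with hm
  have hm0 : 0 ≤ m := integral_nonneg fun x => abs_nonneg _
  obtain ⟨k₀, hk₀⟩ := H.exists_integral_dens_mul_one_sub_cutoff_le hγ hβ hβτ
    (by positivity : 0 < η / (4 * (m + 1)))
  obtain ⟨M, -, hM⟩ := H.exists_two_point_le (k₀ := k₀) hγ hτγ hτ hp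
  obtain ⟨ε', hε'⟩ := H.exists_integral_sq_truncInt_sub_le (k₀ := k₀) hd hγ hβ hβτ hh
    (integrable_mul_mul_exp_logPlus hd hs0 hsd hh hN)
    (fun ε ε' p hp => hM ε ε' p.1 p.2 hp) (by positivity : 0 < η / 4 * (η / 4))
  refine ⟨ε', ?_⟩
  filter_upwards [hε'] with ε ⟨i2, h2⟩
  obtain ⟨i3, h3⟩ := H.integral_abs_chaosInt_sub_truncInt_le hh (hk₀ ε)
  obtain ⟨i4, h4⟩ := H.integral_abs_chaosInt_sub_truncInt_le hh (hk₀ ε')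
  have j3 := H.integrable_chaosInt (γ := γ) hh ε
  have j4 := H.integrable_chaosInt (γ := γ) hh ε'
  have hsmall : η / (4 * (m + 1)) * m ≤ η / 4 := by
    rw [div_mul_eq_mul_div, div_le_div_iff₀ (by positivity) (by positivity)]
    nlinarith
  set I := truncInt γ β (γ + τ) k₀ X C h with hI
  calc ∫ ω, |chaosInt γ X C h ε ω - chaosInt γ X C h ε' ω| ∂P
      ≤ ∫ ω, (|chaosInt γ X C h ε ω - I ε ω| + |chaosInt γ X C h ε' ω - I ε' ω| +
          (η / 4 + (η / 4)⁻¹ * (I ε ω - I ε' ω) ^ 2)) ∂P := by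
        refine integral_mono (j3.sub j4).abs (((j3.sub i3).abs.add (j4.sub i4).abs).add
          ((integrable_const _).add (i2.const_mul _))) fun ω => ?_
        have h5 : |I ε ω - I ε' ω| ≤ η / 4 + (η / 4)⁻¹ * (I ε ω - I ε' ω) ^ 2 := by
          rw [← sq_abs, inv_mul_eq_div, ← sub_le_iff_le_add', le_div_iff₀ (by positivity)]
          nlinarith [sq_nonneg (|I ε ω - I ε' ω| - η / 4), abs_nonneg (I ε ω - I ε' ω)]
        have h6 : chaosInt γ X C h ε ω - chaosInt γ X C h ε' ω =
          (chaosInt γ X C h ε ω - I ε ω) - (chaosInt γ X C h ε' ω - I ε' ω) +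
            (I ε ω - I ε' ω) := by ring
        simp only
        rw [h6]
        refine (abs_add_le _ _).trans (add_le_add (abs_sub _ _) h5)
    _ = (∫ ω, |chaosInt γ X C h ε ω - I ε ω| ∂P) + (∫ ω, |chaosInt γ X C h ε' ω - I ε' ω| ∂P) +
          (η / 4 + (η / 4)⁻¹ * ∫ ω, (I ε ω - I ε' ω) ^ 2 ∂P) := by
        have e1 := integral_add ((j3.sub i3).abs.add (j4.sub i4).abs)
          ((integrable_const (η / 4)).add (i2.const_mul (η / 4)⁻¹))
        have e2 := integral_add (j3.sub i3).abs (j4.sub i4).abs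
        have e3 := integral_add (integrable_const (μ := P) (η / 4)) (i2.const_mul (η / 4)⁻¹)
        rw [integral_const_mul, integral_const, probReal_univ, one_smul] at e3
        exact e1.trans (congrArg₂ _ e2 e3)
    _ ≤ η / 4 + η / 4 + (η / 4 + (η / 4)⁻¹ * (η / 4 * (η / 4))) := by
        gcongr
        · exact h3.trans hsmall
        · exact h4.trans hsmall
    _ = η := by
        field_simp
        ring

theorem exists_integral_abs_sub_le_of_bounded (hh : Integrable h) {η : ℝ} (hη : 0 < η) :
    ∃ (N : ℝ) (k : Pt d → ℝ), Integrable k ∧ (∀ x, |k x| ≤ N) ∧ ∫ x, |h x - k x| ≤ η := by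
  obtain ⟨k, hk, hki⟩ := (memLp_one_iff_integrable.2 hh).exists_boundedContinuous_eLpNorm_sub_le
    ENNReal.one_ne_top (ENNReal.ofReal_pos.2 hη).ne'
  have hki' := memLp_one_iff_integrable.1 hki
  refine ⟨‖k‖, k, hki', fun x => k.norm_coe_le_norm x, ?_⟩
  have h1 : Integrable (h - ⇑k) := hh.sub hki'
  rw [eLpNorm_one_eq_lintegral_enorm, ← ofReal_integral_norm_eq_lintegral_enorm h1] at hk
  exact (ENNReal.ofReal_le_ofReal_iff hη.le).1 hk

theorem exists_integral_abs_chaosInt_sub_le [IsProbabilityMeasure P]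
    (H : IsLogField P X C G K c₀) (hd : 1 ≤ d) (hγ : 0 < γ) (hγd : γ ^ 2 / 2 < d)
    (hh : Integrable h) {η : ℝ} (hη : 0 < η) :
    ∃ ε', ∀ᶠ ε in smallScale,
      ∫ ω, |chaosInt γ X C h ε ω - chaosInt γ X C h ε' ω| ∂P ≤ η := by
  obtain ⟨N, k, hk, hN, hhk⟩ := exists_integral_abs_sub_le_of_bounded hh
    (by positivity : 0 < η / 3)
  obtain ⟨ε', hε'⟩ := H.exists_integral_abs_chaosInt_sub_le_of_bounded hd hγ hγd hk hN
    (by positivity : 0 < η / 3)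
  refine ⟨ε', ?_⟩
  filter_upwards [hε'] with ε h1
  have i1 := H.integrable_chaosInt (γ := γ) hh ε
  have i2 := H.integrable_chaosInt (γ := γ) hh ε'
  have i3 := H.integrable_chaosInt (γ := γ) hk ε
  have i4 := H.integrable_chaosInt (γ := γ) hk ε'
  have h2 := (H.integral_abs_chaosInt_sub_le (γ := γ) hh hk ε).trans hhk
  have h3 := (H.integral_abs_chaosInt_sub_le (γ := γ) hh hk ε').trans hhk
  calc ∫ ω, |chaosInt γ X C h ε ω - chaosInt γ X C h ε' ω| ∂P
      ≤ ∫ ω, (|chaosInt γ X C h ε ω - chaosInt γ X C k ε ω| +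
          |chaosInt γ X C h ε' ω - chaosInt γ X C k ε' ω| +
          |chaosInt γ X C k ε ω - chaosInt γ X C k ε' ω|) ∂P := by
        refine integral_mono (i1.sub i2).abs (((i1.sub i3).abs.add (i2.sub i4).abs).add
          (i3.sub i4).abs) fun ω => ?_
        have h6 : chaosInt γ X C h ε ω - chaosInt γ X C h ε' ω =
          (chaosInt γ X C h ε ω - chaosInt γ X C k ε ω) -
            (chaosInt γ X C h ε' ω - chaosInt γ X C k ε' ω) +
            (chaosInt γ X C k ε ω - chaosInt γ X C k ε' ω) := by ring
        simp only
        rw [h6]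
        exact (abs_add_le _ _).trans (add_le_add (abs_sub _ _) le_rfl)
    _ = (∫ ω, |chaosInt γ X C h ε ω - chaosInt γ X C k ε ω| ∂P) +
          (∫ ω, |chaosInt γ X C h ε' ω - chaosInt γ X C k ε' ω| ∂P) +
          ∫ ω, |chaosInt γ X C k ε ω - chaosInt γ X C k ε' ω| ∂P :=
        (integral_add ((i1.sub i3).abs.add (i2.sub i4).abs) (i3.sub i4).abs).trans
          (congrArg₂ _ (integral_add (i1.sub i3).abs (i2.sub i4).abs) rfl)
    _ ≤ η / 3 + η / 3 + η / 3 := by gcongr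
    _ = η := by ring

/-- In the subcritical regime, the approximate chaos converges in `L¹`. -/
theorem exists_tendsto_integral_abs_chaosInt_sub [IsProbabilityMeasure P]
    (H : IsLogField P X C G K c₀) (hd : 1 ≤ d) (hγ : 0 < γ) (hγd : γ ^ 2 / 2 < d)
    (hh : Integrable h) : ∃ J : Ω → ℝ, Measurable J ∧ Integrable J P ∧
      Tendsto (fun ε => ∫ ω, |chaosInt γ X C h ε ω - J ω| ∂P) smallScale (𝓝 0) := by
  have hi := fun ε => H.integrable_chaosInt (γ := γ) hh ε
  set F : Scale → Lp ℝ 1 P := fun ε => (hi ε).toL1 with hF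
  have hdist : ∀ ε ε', dist (F ε) (F ε') =
      ∫ ω, |chaosInt γ X C h ε ω - chaosInt γ X C h ε' ω| ∂P := by
    intro ε ε'
    rw [dist_eq_norm, hF, ← Integrable.toL1_sub, L1.norm_of_fun_eq_integral_norm]
    rfl
  have hc : Cauchy (map F smallScale) := by
    refine Metric.cauchy_iff.2 ⟨inferInstance, fun η hη => ?_⟩
    obtain ⟨ε', h1⟩ := H.exists_integral_abs_chaosInt_sub_le hd hγ hγd hh
      (by positivity : 0 < η / 3)
    refine ⟨Metric.closedBall (F ε') (η / 3), ?_, fun a ha b hb => ?_⟩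
    · rw [mem_map]
      filter_upwards [h1] with ε h2
      rw [Set.mem_preimage, Metric.mem_closedBall, hdist]
      exact h2
    · have := dist_triangle_right a b (F ε')
      rw [Metric.mem_closedBall] at ha hb
      linarith
  obtain ⟨J, hJ⟩ := CompleteSpace.complete hc
  refine ⟨J, (Lp.stronglyMeasurable J).measurable, L1.integrable_coeFn J, ?_⟩
  have h1 : Tendsto (fun ε => dist (F ε) J) smallScale (𝓝 0) :=
    tendsto_iff_dist_tendsto_zero.1 hJ
  refine h1.congr fun ε => ?_
  rw [dist_eq_norm, L1.norm_eq_integral_norm]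
  refine integral_congr_ae ?_
  filter_upwards [Lp.coeFn_sub (F ε) J, (hi ε).coeFn_toL1] with ω h2 h3
  rw [h2, Pi.sub_apply, h3, Real.norm_eq_abs]

end IsLogField

theorem exists_seq_tendsto_average {E Ω : Type*} [MeasurableSpace E] [MeasurableSpace Ω]
    (ν : Measure E) [IsProbabilityMeasure ν] (P : Measure Ω) [SFinite P] {u : E → Ω → ℝ}
    (hu : Measurable fun p : E × Ω => u p.1 p.2)
    (hi : ∀ᵐ ω ∂P, Integrable (fun x => u x ω) ν) :
    ∃ y : ℕ → E, ∀ᵐ ω ∂P, Tendsto (fun n : ℕ => (∑ i ∈ Finset.range n, u (y i) ω) / n) atTop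
      (𝓝 (∫ x, u x ω ∂ν)) := by
  set μ : Measure (ℕ → E) := Measure.infinitePi fun _ => ν with hμ
  have hI : Measurable fun ω => ∫ x, u x ω ∂ν :=
    (hu.stronglyMeasurable.integral_prod_left' (μ := ν)).measurable
  have hA : ∀ n : ℕ, Measurable fun p : Ω × (ℕ → E) =>
      (∑ i ∈ Finset.range n, u (p.2 i) p.1) / (n : ℝ) := fun n => by
    refine (Finset.measurable_sum _ fun i _ => ?_).div_const _
    have hi : Measurable fun p : Ω × (ℕ → E) => (p.2 i, p.1) := by fun_prop
    exact hu.comp hi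
  have hm : MeasurableSet {p : Ω × (ℕ → E) | Tendsto
      (fun n : ℕ => (∑ i ∈ Finset.range n, u (p.2 i) p.1) / n) atTop
      (𝓝 (∫ x, u x p.1 ∂ν))} :=
    measurableSet_tendsto_fun hA (hI.comp measurable_fst)
  have h1 : ∀ᵐ ω ∂P, ∀ᵐ y ∂μ, Tendsto
      (fun n : ℕ => (∑ i ∈ Finset.range n, u (y i) ω) / n) atTop (𝓝 (∫ x, u x ω ∂ν)) := by
    filter_upwards [hi] with ω hω
    have hmω : Measurable fun x => u x ω := hu.comp measurable_prodMk_right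
    have hmp : ∀ i : ℕ, MeasurePreserving (fun y : ℕ → E => y i) μ ν := fun i =>
      measurePreserving_eval_infinitePi (fun _ => ν) i
    have hind : iIndepFun (fun (i : ℕ) (y : ℕ → E) => u (y i) ω) μ :=
      iIndepFun_infinitePi fun _ => hmω
    have hid : ∀ i, Measure.map (fun y : ℕ → E => u (y i) ω) μ = ν.map fun x => u x ω := by
      intro i
      rw [← (hmp i).map_eq, Measure.map_map hmω (hmp i).measurable]
      rfl
    have hmi : ∀ i, AEMeasurable (fun y : ℕ → E => u (y i) ω) μ := fun i =>
      (hmω.comp (hmp i).measurable).aemeasurable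
    have := strong_law_ae_real (fun (i : ℕ) (y : ℕ → E) => u (y i) ω)
      ((hmp 0).integrable_comp_of_integrable hω)
      (fun i j hij => hind.indepFun hij) (fun i => ⟨hmi i, hmi 0, (hid i).trans (hid 0).symm⟩)
    have e : ∫ y, u (y 0) ω ∂μ = ∫ x, u x ω ∂ν := by
      rw [← (hmp 0).map_eq, integral_map (hmp 0).measurable.aemeasurable
        hmω.aestronglyMeasurable]
    rwa [e] at this
  exact (((Measure.ae_ae_comm (μ := P) (ν := μ) (p := fun ω y => Tendsto
    (fun n : ℕ => (∑ i ∈ Finset.range n, u (y i) ω) / n) atTop (𝓝 (∫ x, u x ω ∂ν)))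
    hm).1 h1)).exists

namespace IsLogField

variable {Ω : Type*} [MeasurableSpace Ω] {P : Measure Ω} {X : Scale × Pt d → Ω → ℝ}
  {C : Scale × Pt d → Scale × Pt d → ℝ} {G : Scale → Pt d → Pt d → ℝ}
  {K : Pt d → Pt d → ℝ} {c₀ γ : ℝ}

theorem integrable_dens_mul_comp [IsProbabilityMeasure P] (H : IsLogField P X C G K c₀)
    (δ : Scale) (x : Pt d)
    {Z : Ω → ℝ} (hZ : AEMeasurable Z P) {φ : ℝ → ℝ} (hφm : Measurable φ)
    (hφ : ∀ t, |φ t| ≤ 1) : Integrable (fun ω => dens γ X C δ x ω * φ (Z ω)) P :=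
  (H.integrable_dens δ x).mul_bdd (c := 1) (hφm.comp_aemeasurable hZ).aestronglyMeasurable
    (Eventually.of_forall fun _ => hφ _)

theorem integral_dens_mul_comp_sum_le [IsProbabilityMeasure P] (H : IsLogField P X C G K c₀)
    (δ ε : Scale) (x : Pt d)
    (y : ℕ → Pt d) (n : ℕ) {φ : ℝ → ℝ} (hφmono : Monotone φ) (hφ : ∀ t, |φ t| ≤ 1) :
    ∫ ω, dens γ X C δ x ω * φ ((∑ i ∈ Finset.range n, dens γ X C ε (y i) ω) / n) ∂P ≤
      ∫ ω, φ (Real.exp (γ ^ 2 * (Real.log (δ : ℝ)⁻¹ + c₀)) *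
        ((∑ i ∈ Finset.range n, dens γ X C ε (y i) ω) / n)) ∂P := by
  have hφm := hφmono.measurable
  set F : (Fin n → ℝ) → ℝ := fun z =>
    φ ((∑ i : Fin n, Real.exp (γ * z i - γ ^ 2 / 2 * C (ε, y i) (ε, y i))) / n) with hF
  have hFm : Measurable F := by
    refine hφm.comp ((Finset.measurable_sum _ fun i _ => ?_).div_const _)
    exact (((measurable_pi_apply _).const_mul _).sub_const _).exp
  have key := H.gauss.integral_tilt ![(δ, x)] ![γ] (fun i : Fin n => (ε, y i)) hFm
  simp only [Fin.sum_univ_one, Matrix.cons_val_fin_one] at key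
  have e1 : ∀ ω, dens γ X C δ x ω * φ ((∑ i ∈ Finset.range n, dens γ X C ε (y i) ω) / n) =
      Real.exp (-(γ ^ 2 / 2 * C (δ, x) (δ, x))) *
        (Real.exp (γ * X (δ, x) ω) * F fun i => X (ε, y i) ω) := by
    intro ω
    rw [dens_eq γ X C δ, mul_assoc, hF]
    simp only [Finset.sum_range, dens]
  have hS : Measurable fun ω => (∑ i ∈ Finset.range n, dens γ X C ε (y i) ω) / (n : ℝ) :=
    (Finset.measurable_sum _ fun i _ => H.measurable_dens_right ε (y i)).div_const _
  have hbdd : ∀ Z : Ω → ℝ, Measurable Z → Integrable (fun ω => φ (Z ω)) P := fun Z hZ =>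
    Integrable.of_bound (hφm.comp hZ).aestronglyMeasurable 1 (Eventually.of_forall fun _ => hφ _)
  simp only [e1]
  rw [integral_const_mul, key, ← mul_assoc, ← Real.exp_add]
  have e2 : -(γ ^ 2 / 2 * C (δ, x) (δ, x)) + γ * γ * C (δ, x) (δ, x) / 2 = 0 := by ring
  rw [e2, Real.exp_zero, one_mul]
  refine integral_mono (Integrable.of_bound (hFm.comp (measurable_pi_lambda _ fun k =>
    (H.gauss.meas _).add_const _)).aestronglyMeasurable 1 (Eventually.of_forall fun _ => hφ _))
    (hbdd _ (hS.const_mul _)) fun ω => hφmono ?_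
  rw [Finset.sum_range, ← mul_div_assoc, Finset.mul_sum]
  gcongr with i _
  rw [dens, ← Real.exp_add]
  refine Real.exp_le_exp.2 ?_
  have := mul_le_mul_of_nonneg_left (H.cov.le_log_scale (δ, x) (ε, y i)) (sq_nonneg γ)
  simp only at this ⊢
  linarith

/-- Tilting by a density at scale `δ` increases bounded monotone functionals of the chaos by at
most a deterministic factor in the argument. -/
theorem integral_dens_mul_comp_chaosInt_le [IsProbabilityMeasure P]
    (H : IsLogField P X C G K c₀) (δ ε : Scale) (x : Pt d)
    {h : Pt d → ℝ} (hh : Integrable h) (hm : Measurable h) (h0 : ∀ x, 0 ≤ h x)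
    (h1 : ∫ x, h x = 1) {φ : ℝ → ℝ}
    (hφmono : Monotone φ) (hφc : Continuous φ) (hφ : ∀ t, |φ t| ≤ 1) :
    ∫ ω, dens γ X C δ x ω * φ (chaosInt γ X C h ε ω) ∂P ≤
      ∫ ω, φ (Real.exp (γ ^ 2 * (Real.log (δ : ℝ)⁻¹ + c₀)) * chaosInt γ X C h ε ω) ∂P := by
  set ν : Measure (Pt d) := volume.withDensity fun x => ENNReal.ofReal (h x) with hν
  have : IsProbabilityMeasure ν := by
    refine ⟨?_⟩
    rw [hν, withDensity_apply _ MeasurableSet.univ, Measure.restrict_univ,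
      ← ofReal_integral_eq_lintegral_ofReal hh (Eventually.of_forall h0), h1, ENNReal.ofReal_one]
  have hmr : Measurable fun x => ENNReal.ofReal (h x) := hm.ennreal_ofReal
  have hlt : ∀ᵐ x : Pt d, ENNReal.ofReal (h x) < ∞ :=
    Eventually.of_forall fun _ => ENNReal.ofReal_lt_top
  have hint : ∀ ω, ∫ x, dens γ X C ε x ω ∂ν = chaosInt γ X C h ε ω := by
    intro ω
    rw [hν, integral_withDensity_eq_integral_toReal_smul hmr hlt, chaosInt]
    simp only [ENNReal.toReal_ofReal (h0 _), smul_eq_mul]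
  obtain ⟨y, hy⟩ := exists_seq_tendsto_average ν P (H.measurable_dens (γ := γ) ε) (by
    filter_upwards [H.ae_integrable_dens (γ := γ) hh ε] with ω hω
    rw [hν, integrable_withDensity_iff_integrable_smul' hmr hlt]
    simpa only [ENNReal.toReal_ofReal (h0 _), smul_eq_mul] using hω)
  simp only [hint] at hy
  have hS : ∀ n : ℕ, Measurable fun ω =>
      (∑ i ∈ Finset.range n, dens γ X C ε (y i) ω) / (n : ℝ) := fun n =>
    (Finset.measurable_sum _ fun i _ => H.measurable_dens_right ε (y i)).div_const _
  refine le_of_tendsto_of_tendsto' (b := atTop)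
    (tendsto_integral_of_dominated_convergence (fun ω => dens γ X C δ x ω)
    (fun n => (H.integrable_dens_mul_comp δ x (hS n).aemeasurable hφc.measurable
      hφ).aestronglyMeasurable) (H.integrable_dens δ x) (fun n => Eventually.of_forall fun ω => ?_)
      (hy.mono fun ω hω => ((hφc.tendsto _).comp hω).const_mul _))
    (tendsto_integral_of_dominated_convergence (fun ω => 1)
    (fun n => (hφc.measurable.comp ((hS n).const_mul _)).aestronglyMeasurable)
      (integrable_const _) (fun n => Eventually.of_forall fun ω => hφ _)
      (hy.mono fun ω hω => (hφc.tendsto _).comp (hω.const_mul _)))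
    fun n => H.integral_dens_mul_comp_sum_le δ ε x y n hφmono hφ
  rw [norm_mul, Real.norm_of_nonneg (dens_pos γ X C δ x ω).le]
  exact mul_le_of_le_one_right (dens_pos γ X C δ x ω).le (hφ _)

end IsLogField

/-- Convergence in mean along the scales implies convergence in probability. -/
theorem tendstoInMeasure_of_tendsto_integral_abs {Ω : Type*} [MeasurableSpace Ω]
    {P : Measure Ω} {F : Scale → Ω → ℝ} {J : Ω → ℝ} (hF : ∀ ε, Integrable (F ε) P)
    (hJ : Integrable J P)
    (hlim : Tendsto (fun ε => ∫ ω, |F ε ω - J ω| ∂P) smallScale (𝓝 0)) :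
    TendstoInMeasure P F smallScale J := by
  refine tendstoInMeasure_of_tendsto_eLpNorm one_ne_zero
    (fun ε => (hF ε).aestronglyMeasurable) hJ.aestronglyMeasurable ?_
  have e : ∀ ε, eLpNorm (F ε - J) 1 P = ENNReal.ofReal (∫ ω, |F ε ω - J ω| ∂P) := by
    intro ε
    rw [eLpNorm_one_eq_lintegral_enorm,
      ← ofReal_integral_norm_eq_lintegral_enorm ((hF ε).sub hJ)]
    rfl
  simp only [e]
  simpa using ENNReal.tendsto_ofReal hlim

theorem abs_min_max_le (k : ℕ) (t : ℝ) : |min (max (k * t) 0) 1| ≤ 1 := by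
  rw [abs_of_nonneg (le_min (le_max_right _ _) zero_le_one)]
  exact min_le_right _ _

theorem tendsto_min_max (t : ℝ) :
    Tendsto (fun k : ℕ => min (max (k * t) 0) 1) atTop
      (𝓝 ((Set.Ioi (0 : ℝ)).indicator (fun _ => 1) t)) := by
  rcases le_or_gt t 0 with ht | ht
  · rw [Set.indicator_of_notMem (by simpa using ht)]
    refine tendsto_const_nhds.congr fun k => ?_
    rw [max_eq_right (mul_nonpos_of_nonneg_of_nonpos k.cast_nonneg ht), min_eq_left zero_le_one]
  · rw [Set.indicator_of_mem (by simpa using ht)]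
    obtain ⟨N, hN⟩ := exists_nat_ge t⁻¹
    refine tendsto_const_nhds.congr' ?_
    filter_upwards [eventually_ge_atTop N] with k hk
    have : t⁻¹ ≤ k := hN.trans (by exact_mod_cast hk)
    rw [inv_le_iff_one_le_mul₀ ht] at this
    rw [min_eq_right (le_max_of_le_left this)]

theorem chaosInt_nonneg {Ω : Type*} (γ : ℝ) (X : Scale × Pt d → Ω → ℝ)
    (C : Scale × Pt d → Scale × Pt d → ℝ) {h : Pt d → ℝ} (h0 : ∀ x, 0 ≤ h x) (ε : Scale) (ω : Ω) :
    0 ≤ chaosInt γ X C h ε ω :=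
  integral_nonneg fun x => mul_nonneg (h0 x) (dens_pos γ X C ε x ω).le

namespace IsLogField

variable {Ω : Type*} [MeasurableSpace Ω] {P : Measure Ω} {X : Scale × Pt d → Ω → ℝ}
  {C : Scale × Pt d → Scale × Pt d → ℝ} {G : Scale → Pt d → Pt d → ℝ}
  {K : Pt d → Pt d → ℝ} {c₀ γ : ℝ}

variable [IsProbabilityMeasure P]

theorem tendsto_integral_chaosInt (H : IsLogField P X C G K c₀) {h : Pt d → ℝ}
    (hh : Integrable h) {J : Ω → ℝ} (hJ : Integrable J P)
    (hlim : Tendsto (fun ε => ∫ ω, |chaosInt γ X C h ε ω - J ω| ∂P) smallScale (𝓝 0))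
    {w : Ω → ℝ} (hw : AEStronglyMeasurable w P) (hw1 : ∀ ω, |w ω| ≤ 1) :
    Tendsto (fun ε => ∫ ω, chaosInt γ X C h ε ω * w ω ∂P) smallScale
      (𝓝 (∫ ω, J ω * w ω ∂P)) := by
  rw [tendsto_iff_norm_sub_tendsto_zero]
  refine squeeze_zero (fun _ => norm_nonneg _) (fun ε => ?_) hlim
  have hbd : ∀ {Z : Ω → ℝ}, Integrable Z P → Integrable (fun ω => Z ω * w ω) P := fun hZ =>
    hZ.mul_bdd (c := 1) hw (Eventually.of_forall fun ω => hw1 ω)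
  have h1 := H.integrable_chaosInt (γ := γ) hh ε
  rw [← integral_sub (hbd h1) (hbd hJ), Real.norm_eq_abs]
  refine abs_integral_le_integral_abs.trans (integral_mono ((hbd h1).sub (hbd hJ)).abs
    (h1.sub hJ).abs fun ω => ?_)
  simp only
  rw [← sub_mul, abs_mul]
  exact mul_le_of_le_one_right (abs_nonneg _) (hw1 ω)

theorem ae_nonneg_of_tendsto (H : IsLogField P X C G K c₀) {h : Pt d → ℝ}
    (hh : Integrable h) (h0 : ∀ x, 0 ≤ h x) {J : Ω → ℝ} (hJ : Integrable J P)
    (hlim : Tendsto (fun ε => ∫ ω, |chaosInt γ X C h ε ω - J ω| ∂P) smallScale (𝓝 0)) :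
    ∀ᵐ ω ∂P, 0 ≤ J ω := by
  obtain ⟨ns, -, hns⟩ := (tendstoInMeasure_of_tendsto_integral_abs
    (fun ε => H.integrable_chaosInt (γ := γ) hh ε) hJ hlim).exists_seq_tendsto_ae'
  filter_upwards [hns] with ω hω
  exact ge_of_tendsto' hω fun i => chaosInt_nonneg γ X C h0 _ ω

theorem integral_dens_mul_indicator_le (H : IsLogField P X C G K c₀) (δ : Scale) (x : Pt d)
    {h : Pt d → ℝ} (hh : Integrable h) (hm : Measurable h) (h0 : ∀ x, 0 ≤ h x)
    (h1 : ∫ x, h x = 1) {J : Ω → ℝ} (hJm : Measurable J) (hJ : Integrable J P)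
    (hlim : Tendsto (fun ε => ∫ ω, |chaosInt γ X C h ε ω - J ω| ∂P) smallScale (𝓝 0)) :
    ∫ ω, dens γ X C δ x ω * (Set.Ioi (0 : ℝ)).indicator (fun _ => 1) (J ω) ∂P ≤
      ∫ ω, (Set.Ioi (0 : ℝ)).indicator (fun _ => 1) (J ω) ∂P := by
  set A : ℝ := Real.exp (γ ^ 2 * (Real.log (δ : ℝ)⁻¹ + c₀)) with hA
  have hA0 : 0 < A := Real.exp_pos _
  have hdom : ∀ {φ : ℝ → ℝ}, (∀ t, |φ t| ≤ 1) → ∀ (Z : Ω → ℝ) ω,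
      ‖dens γ X C δ x ω * φ (Z ω)‖ ≤ dens γ X C δ x ω := by
    intro φ hφ Z ω
    rw [norm_mul, Real.norm_of_nonneg (dens_pos γ X C δ x ω).le]
    exact mul_le_of_le_one_right (dens_pos γ X C δ x ω).le (hφ _)
  obtain ⟨ns, -, hns⟩ := (tendstoInMeasure_of_tendsto_integral_abs
    (fun ε => H.integrable_chaosInt (γ := γ) hh ε) hJ hlim).exists_seq_tendsto_ae'
  have step : ∀ {φ : ℝ → ℝ}, Monotone φ → Continuous φ → (∀ t, |φ t| ≤ 1) →
      ∫ ω, dens γ X C δ x ω * φ (J ω) ∂P ≤ ∫ ω, φ (A * J ω) ∂P := by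
    intro φ hφmono hφc hφ
    refine le_of_tendsto_of_tendsto' (b := atTop)
      (tendsto_integral_of_dominated_convergence (fun ω => dens γ X C δ x ω)
      (fun n => (H.integrable_dens_mul_comp δ x (H.integrable_chaosInt hh (ns n)).aemeasurable
        hφc.measurable hφ).aestronglyMeasurable) (H.integrable_dens δ x)
        (fun n => Eventually.of_forall fun ω => hdom hφ _ ω)
        (hns.mono fun ω hω => ((hφc.tendsto _).comp hω).const_mul _))
      (tendsto_integral_of_dominated_convergence (fun ω => 1)
      (fun n => (hφc.measurable.comp_aemeasurable
        ((H.integrable_chaosInt hh (ns n)).aemeasurable.const_mul _)).aestronglyMeasurable)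
        (integrable_const _) (fun n => Eventually.of_forall fun ω => hφ _)
        (hns.mono fun ω hω => (hφc.tendsto _).comp (hω.const_mul _)))
      fun n => H.integral_dens_mul_comp_chaosInt_le δ (ns n) x hh hm h0 h1 hφmono hφc hφ
  have hmono : ∀ k : ℕ, Monotone fun t : ℝ => min (max (k * t) 0) 1 := fun k s t hst => by
    simp only
    gcongr
  have hcont : ∀ k : ℕ, Continuous fun t : ℝ => min (max (k * t) 0) 1 := fun k => by fun_prop
  refine le_of_tendsto_of_tendsto' (b := atTop)
    (tendsto_integral_of_dominated_convergence (fun ω => dens γ X C δ x ω)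
      (fun k => (H.integrable_dens_mul_comp δ x hJm.aemeasurable
        (hcont k).measurable (abs_min_max_le k)).aestronglyMeasurable) (H.integrable_dens δ x)
        (fun k => Eventually.of_forall fun ω => hdom (abs_min_max_le k) _ ω)
        (Eventually.of_forall fun ω => (tendsto_min_max (J ω)).const_mul _))
    (tendsto_integral_of_dominated_convergence (fun ω => 1)
      (fun k => ((hcont k).measurable.comp (hJm.const_mul A)).aestronglyMeasurable)
        (integrable_const _) (fun k => Eventually.of_forall fun ω => abs_min_max_le k _)
        (Eventually.of_forall fun ω => ?_))
    fun k => step (hmono k) (hcont k) (abs_min_max_le k)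
  have e : (Set.Ioi (0 : ℝ)).indicator (fun _ => (1 : ℝ)) (J ω) =
      (Set.Ioi (0 : ℝ)).indicator (fun _ => 1) (A * J ω) := by
    simp only [Set.indicator_apply, Set.mem_Ioi, mul_pos_iff_of_pos_left hA0]
  rw [e]
  exact tendsto_min_max _

/-- The limit of the chaos is almost surely positive, for normalised test functions. -/
theorem ae_pos_of_integral_eq_one (H : IsLogField P X C G K c₀)
    {h : Pt d → ℝ} (hh : Integrable h) (hm : Measurable h) (h0 : ∀ x, 0 ≤ h x)
    (h1 : ∫ x, h x = 1) {J : Ω → ℝ} (hJm : Measurable J) (hJ : Integrable J P)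
    (hlim : Tendsto (fun ε => ∫ ω, |chaosInt γ X C h ε ω - J ω| ∂P) smallScale (𝓝 0)) :
    ∀ᵐ ω ∂P, 0 < J ω := by
  set w : Ω → ℝ := fun ω => (Set.Ioi (0 : ℝ)).indicator (fun _ => 1) (J ω) with hw
  have hwm : Measurable w := (measurable_const.indicator measurableSet_Ioi).comp hJm
  have hw0 : ∀ ω, 0 ≤ w ω := fun ω => Set.indicator_nonneg (fun _ _ => zero_le_one) _
  have hw1 : ∀ ω, w ω ≤ 1 := fun ω => Set.indicator_le_self' (fun _ _ => zero_le_one) _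
  have hwa : ∀ ω, |w ω| ≤ 1 := fun ω => by rw [abs_of_nonneg (hw0 ω)]; exact hw1 ω
  have hwi : Integrable w P := Integrable.of_bound hwm.aestronglyMeasurable 1
    (Eventually.of_forall hwa)
  have hle : ∀ δ, ∫ ω, chaosInt γ X C h δ ω * w ω ∂P ≤ ∫ ω, w ω ∂P := by
    intro δ
    have hpi : Integrable (fun p : Pt d × Ω => h p.1 * dens γ X C δ p.1 p.2 * w p.2)
        (volume.prod P) :=
      (H.integrable_prod_dens hh δ).mul_bdd (c := 1)
        (hwm.comp measurable_snd).aestronglyMeasurable (Eventually.of_forall fun p => hwa p.2)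
    have e : ∫ ω, chaosInt γ X C h δ ω * w ω ∂P =
        ∫ x, h x * ∫ ω, dens γ X C δ x ω * w ω ∂P := by
      simp only [chaosInt, ← integral_mul_const, ← integral_const_mul]
      rw [← integral_integral_swap (f := fun x ω => h x * dens γ X C δ x ω * w ω) hpi]
      simp only [mul_assoc]
    have hpi' := hpi.integral_prod_left
    simp only [mul_assoc, integral_const_mul] at hpi'
    rw [e]
    calc ∫ x, h x * ∫ ω, dens γ X C δ x ω * w ω ∂P ≤ ∫ x, h x * ∫ ω, w ω ∂P :=
        integral_mono hpi' (hh.mul_const _) fun x => mul_le_mul_of_nonneg_left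
          (H.integral_dens_mul_indicator_le δ x hh hm h0 h1 hJm hJ hlim) (h0 x)
      _ = ∫ ω, w ω ∂P := by rw [integral_mul_const, h1, one_mul]
  have hJ0 := H.ae_nonneg_of_tendsto hh h0 hJ hlim
  have hlim1 := H.tendsto_integral_chaosInt hh hJ hlim hwm.aestronglyMeasurable hwa
  have hlim2 := H.tendsto_integral_chaosInt hh hJ hlim (w := fun _ => 1)
    aestronglyMeasurable_const (fun _ => by simp)
  simp only [mul_one, H.integral_chaosInt hh, h1] at hlim2
  have hJ1 : ∫ ω, J ω ∂P = 1 := tendsto_nhds_unique hlim2 tendsto_const_nhds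
  have hJw : ∫ ω, J ω * w ω ∂P = 1 := by
    rw [← hJ1]
    refine integral_congr_ae ?_
    filter_upwards [hJ0] with ω hω
    rcases hω.eq_or_lt with h' | h'
    · rw [← h', zero_mul]
    · simp [hw, h']
  have hw_ge : 1 ≤ ∫ ω, w ω ∂P := by
    rw [← hJw]
    exact le_of_tendsto' hlim1 hle
  have h3 : ∫ ω, (1 - w ω) ∂P = 0 := by
    refine le_antisymm ?_ (integral_nonneg fun ω => sub_nonneg.2 (hw1 ω))
    rw [integral_sub (integrable_const _) hwi]
    simpa using hw_ge
  have h4 := (integral_eq_zero_iff_of_nonneg (fun ω => sub_nonneg.2 (hw1 ω))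
    ((integrable_const _).sub hwi)).1 h3
  filter_upwards [h4] with ω hω
  by_contra hneg
  simp [hw, Set.indicator_of_notMem (show J ω ∉ Set.Ioi 0 from hneg)] at hω

/-- The limit of the chaos is almost surely positive. -/
theorem ae_pos_of_tendsto (H : IsLogField P X C G K c₀)
    {h : Pt d → ℝ} (hh : Integrable h) (hm : Measurable h) (h0 : ∀ x, 0 ≤ h x)
    (h1 : 0 < ∫ x, h x) {J : Ω → ℝ} (hJm : Measurable J) (hJ : Integrable J P)
    (hlim : Tendsto (fun ε => ∫ ω, |chaosInt γ X C h ε ω - J ω| ∂P) smallScale (𝓝 0)) :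
    ∀ᵐ ω ∂P, 0 < J ω := by
  set c := (∫ x, h x)⁻¹ with hc
  have hc0 : 0 < c := inv_pos.2 h1
  have hs : ∀ ε ω, chaosInt γ X C (fun x => c * h x) ε ω = c * chaosInt γ X C h ε ω := by
    intro ε ω
    simp only [chaosInt, mul_assoc, integral_const_mul]
  have := H.ae_pos_of_integral_eq_one (γ := γ) (hh.const_mul c) (hm.const_mul c)
    (fun x => mul_nonneg hc0.le (h0 x))
    (by rw [integral_const_mul, hc, inv_mul_cancel₀ h1.ne']) (hJm.const_mul c) (hJ.const_mul c) (by
      simp only [hs, ← mul_sub, abs_mul, integral_const_mul]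
      simpa using hlim.const_mul |c|)
  filter_upwards [this] with ω hω
  exact (mul_pos_iff_of_pos_left hc0).1 hω

end IsLogField

/-- A continuous cutoff, equal to `1` on the ball of radius `R` and to `0` outside the ball of
radius `R + 1`. -/
def radialCutoff (R : ℕ) (x : Pt d) : ℝ := max 0 (min 1 (R + 1 - ‖x‖))

theorem continuous_radialCutoff (R : ℕ) : Continuous (radialCutoff (d := d) R) := by
  unfold radialCutoff
  fun_prop

theorem radialCutoff_nonneg (R : ℕ) (x : Pt d) : 0 ≤ radialCutoff R x := le_max_left _ _

theorem radialCutoff_le_one (R : ℕ) (x : Pt d) : radialCutoff R x ≤ 1 :=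
  max_le zero_le_one (min_le_left _ _)

theorem radialCutoff_eq_one {R : ℕ} {x : Pt d} (hx : ‖x‖ ≤ R) : radialCutoff R x = 1 := by
  rw [radialCutoff, min_eq_left (by linarith), max_eq_right zero_le_one]

theorem radialCutoff_eq_zero {R : ℕ} {x : Pt d} (hx : (R : ℝ) + 1 ≤ ‖x‖) :
    radialCutoff R x = 0 := by
  rw [radialCutoff, max_eq_left]
  exact (min_le_right _ _).trans (by linarith)

theorem hasCompactSupport_radialCutoff (R : ℕ) : HasCompactSupport (radialCutoff (d := d) R) := by
  refine HasCompactSupport.of_support_subset_isCompact (isCompact_closedBall 0 (R + 1))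
    fun x hx => ?_
  by_contra hx'
  rw [mem_closedBall_zero_iff, not_le] at hx'
  exact hx (radialCutoff_eq_zero hx'.le)

theorem tendsto_radialCutoff (x : Pt d) :
    Tendsto (fun R => radialCutoff R x) atTop (𝓝 1) := by
  obtain ⟨N, hN⟩ := exists_nat_ge ‖x‖
  refine tendsto_const_nhds.congr' ?_
  filter_upwards [eventually_ge_atTop N] with R hR
  exact (radialCutoff_eq_one (hN.trans (by exact_mod_cast hR))).symm

/-- A countable family of bounded continuous functions, containing the constant `1` and uniformly
approximating every compactly supported continuous function. -/
theorem exists_seq_uniformly_dense : ∃ φ : ℕ → Pt d → ℝ, (∀ j, Continuous (φ j)) ∧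
    (∀ j, ∃ B, ∀ x, |φ j x| ≤ B) ∧ (φ 0 = fun _ => 1) ∧
    ∀ ψ : Pt d → ℝ, Continuous ψ → HasCompactSupport ψ → ∀ η > 0, ∃ j, ∀ x, |ψ x - φ j x| ≤ η := by
  let u : ℕ → C(Pt d, ℝ) := TopologicalSpace.denseSeq _
  let φ : ℕ → Pt d → ℝ := fun n => Nat.casesOn n (fun _ => 1) fun m x =>
    radialCutoff m.unpair.1 x * u m.unpair.2 x
  have hs : ∀ m, φ (m + 1) = fun x => radialCutoff m.unpair.1 x * u m.unpair.2 x := fun _ => rfl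
  have hc : ∀ m, Continuous (φ (m + 1)) := fun m => by
    rw [hs]
    exact (continuous_radialCutoff _).mul (u _).continuous
  refine ⟨φ, fun j => ?_, fun j => ?_, rfl, fun ψ hψ hψs η hη => ?_⟩
  · cases j with
    | zero => exact continuous_const
    | succ m => exact hc m
  · cases j with
    | zero => exact ⟨1, fun x => by simp [φ]⟩
    | succ m =>
      obtain ⟨B, hB⟩ := (hasCompactSupport_radialCutoff (d := d) m.unpair.1).mul_right
        (f' := u m.unpair.2) |>.exists_bound_of_continuous (hc m)
      exact ⟨B, fun x => by rw [hs, ← Real.norm_eq_abs]; exact hB x⟩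
  · obtain ⟨r, hr⟩ := hψs.isCompact.isBounded.subset_closedBall 0
    obtain ⟨R, hR⟩ := exists_nat_ge r
    have hopen : IsOpen {w : C(Pt d, ℝ) | ∀ x ∈ Metric.closedBall (0 : Pt d) (R + 1),
        w x ∈ Metric.ball (ψ x) η} := by
      have h1 := (ContinuousMap.isOpen_setOfPred_mapsTo (X := Pt d) (Y := ℝ)
        (isCompact_closedBall 0 (R + 1)) (Metric.isOpen_ball (x := 0) (ε := η))).preimage
        (f := fun w : C(Pt d, ℝ) => w - ⟨ψ, hψ⟩) (by fun_prop)
      convert h1 using 1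
      ext w
      simp [Set.MapsTo, Real.dist_eq]
    obtain ⟨i, hi⟩ := (TopologicalSpace.denseRange_denseSeq C(Pt d, ℝ)).exists_mem_open hopen
      ⟨⟨ψ, hψ⟩, fun x _ => Metric.mem_ball_self hη⟩
    refine ⟨Nat.pair R i + 1, fun x => ?_⟩
    rw [hs, Nat.unpair_pair]
    rcases le_or_gt ‖x‖ (R + 1) with hx | hx
    · have hxu : |u i x - ψ x| < η := by
        simpa [Real.dist_eq] using hi x (by simpa using hx)
      have hψx : ψ x = radialCutoff R x * ψ x := by
        by_cases hx' : x ∈ tsupport ψ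
        · rw [radialCutoff_eq_one, one_mul]
          exact (mem_closedBall_zero_iff.1 (hr hx')).trans hR
        · rw [image_eq_zero_of_notMem_tsupport hx', mul_zero]
      simp only
      rw [hψx, ← mul_sub, abs_mul, abs_of_nonneg (radialCutoff_nonneg _ _), abs_sub_comm]
      exact (mul_le_of_le_one_left (abs_nonneg _) (radialCutoff_le_one _ _)).trans hxu.le
    · simp only
      have hx' : x ∉ tsupport ψ := fun h =>
        absurd ((mem_closedBall_zero_iff.1 (hr h)).trans hR) (by linarith)
      rw [image_eq_zero_of_notMem_tsupport hx', radialCutoff_eq_zero hx.le]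
      simpa using hη.le

theorem integrable_of_continuous_of_bound {E : Type*} [TopologicalSpace E] [MeasurableSpace E]
    [OpensMeasurableSpace E] [SecondCountableTopology E] {μ : Measure E} [IsFiniteMeasure μ]
    {φ : E → ℝ} (hφ : Continuous φ) (hb : ∃ B, ∀ x, |φ x| ≤ B) : Integrable φ μ := by
  obtain ⟨B, hB⟩ := hb
  exact Integrable.of_bound hφ.aestronglyMeasurable B (Eventually.of_forall hB)

theorem HasCompactSupport.exists_abs_le {φ : Pt d → ℝ} (hs : HasCompactSupport φ)
    (hφ : Continuous φ) : ∃ B, ∀ x, |φ x| ≤ B := by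
  obtain ⟨B, hB⟩ := hs.exists_bound_of_continuous hφ
  exact ⟨B, fun x => by simpa using hB x⟩

/-- Finite measures whose integrals converge along a uniformly dense family of test functions
converge vaguely to a finite measure. -/
theorem exists_measure_tendsto_integral {φ : ℕ → Pt d → ℝ} (hφc : ∀ j, Continuous (φ j))
    (hφb : ∀ j, ∃ B, ∀ x, |φ j x| ≤ B) (hφ0 : φ 0 = fun _ => 1)
    (hφd : ∀ ψ : Pt d → ℝ, Continuous ψ → HasCompactSupport ψ → ∀ η > 0,
      ∃ j, ∀ x, |ψ x - φ j x| ≤ η)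
    (μ : ℕ → Measure (Pt d)) [∀ n, IsFiniteMeasure (μ n)]
    (hμ : ∀ j, ∃ l, Tendsto (fun n => ∫ x, φ j x ∂(μ n)) atTop (𝓝 l)) :
    ∃ M : Measure (Pt d), IsFiniteMeasure M ∧ ∀ ψ : Pt d → ℝ, Continuous ψ →
      HasCompactSupport ψ → Tendsto (fun n => ∫ x, ψ x ∂(μ n)) atTop (𝓝 (∫ x, ψ x ∂M)) := by
  obtain ⟨B, hB⟩ : ∃ B, ∀ n, (μ n).real Set.univ ≤ B := by
    obtain ⟨l, hl⟩ := hμ 0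
    obtain ⟨B, hB⟩ := hl.bddAbove_range
    refine ⟨B, fun n => ?_⟩
    have := hB ⟨n, rfl⟩
    simpa [hφ0] using this
  have hB0 : 0 ≤ B := measureReal_nonneg.trans (hB 0)
  have hex : ∀ ψ : Pt d → ℝ, Continuous ψ → HasCompactSupport ψ →
      ∃ l, Tendsto (fun n => ∫ x, ψ x ∂(μ n)) atTop (𝓝 l) := by
    intro ψ hψ hs
    refine cauchySeq_tendsto_of_complete (Metric.cauchySeq_iff.2 fun η hη => ?_)
    obtain ⟨j, hj⟩ := hφd ψ hψ hs (η / (4 * (B + 1))) (by positivity)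
    obtain ⟨l, hl⟩ := hμ j
    obtain ⟨N, hN⟩ := Metric.cauchySeq_iff.1 hl.cauchySeq (η / 2) (by positivity)
    have hd : ∀ n, |∫ x, ψ x ∂(μ n) - ∫ x, φ j x ∂(μ n)| ≤ η / 4 := by
      intro n
      rw [← integral_sub (integrable_of_continuous_of_bound hψ (hs.exists_abs_le hψ))
        (integrable_of_continuous_of_bound (hφc j) (hφb j)), ← Real.norm_eq_abs]
      refine (norm_integral_le_of_norm_le_const (Eventually.of_forall hj)).trans ?_
      calc η / (4 * (B + 1)) * (μ n).real Set.univ ≤ η / (4 * (B + 1)) * (B + 1) := by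
            gcongr
            exact (hB n).trans (by linarith)
        _ = η / 4 := by field_simp
    refine ⟨N, fun m hm n hn => ?_⟩
    have h1 := abs_le.1 (hd m)
    have h2 := abs_le.1 (hd n)
    have h3 := hN m hm n hn
    rw [Real.dist_eq, abs_lt] at h3 ⊢
    constructor <;> linarith [h1.1, h1.2, h2.1, h2.2, h3.1, h3.2]
  choose! L hL using hex
  have hi : ∀ (ψ : CompactlySupportedContinuousMap (Pt d) ℝ) n, Integrable ψ (μ n) :=
    fun ψ n => integrable_of_continuous_of_bound ψ.continuous
      (ψ.hasCompactSupport.exists_abs_le ψ.continuous)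
  have hLψ := fun ψ : CompactlySupportedContinuousMap (Pt d) ℝ =>
    hL ψ ψ.continuous ψ.hasCompactSupport
  let Λ₀ : CompactlySupportedContinuousMap (Pt d) ℝ →ₗ[ℝ] ℝ :=
    { toFun := fun ψ => L ψ
      map_add' := fun ψ₁ ψ₂ => by
        refine tendsto_nhds_unique (hLψ (ψ₁ + ψ₂)) (((hLψ ψ₁).add (hLψ ψ₂)).congr fun n => ?_)
        exact (integral_add (hi ψ₁ n) (hi ψ₂ n)).symm
      map_smul' := fun c ψ => by
        refine tendsto_nhds_unique (hLψ (c • ψ)) (((hLψ ψ).const_mul c).congr fun n => ?_)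
        exact (integral_const_mul c _).symm }
  let Λ := PositiveLinearMap.mk₀ Λ₀ fun ψ hψ =>
    ge_of_tendsto' (hLψ ψ) fun n => integral_nonneg hψ
  have hint : ∀ ψ : Pt d → ℝ, Continuous ψ → HasCompactSupport ψ →
      ∫ x, ψ x ∂(RealRMK.rieszMeasure Λ) = L ψ := fun ψ hψ hs =>
    RealRMK.integral_rieszMeasure Λ ⟨⟨ψ, hψ⟩, hs⟩
  refine ⟨RealRMK.rieszMeasure Λ, ⟨?_⟩, fun ψ hψ hs => by rw [hint ψ hψ hs]; exact hL ψ hψ hs⟩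
  have hball : ∀ R : ℕ, RealRMK.rieszMeasure Λ (Metric.closedBall 0 R) ≤ ENNReal.ofReal B := by
    intro R
    have hc := continuous_radialCutoff (d := d) R
    have hs := hasCompactSupport_radialCutoff (d := d) R
    calc RealRMK.rieszMeasure Λ (Metric.closedBall 0 R)
        = ∫⁻ x, (Metric.closedBall 0 R).indicator 1 x ∂(RealRMK.rieszMeasure Λ) := by
          rw [lintegral_indicator_one Metric.isClosed_closedBall.measurableSet]
      _ ≤ ∫⁻ x, ENNReal.ofReal (radialCutoff R x) ∂(RealRMK.rieszMeasure Λ) := by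
          refine lintegral_mono fun x => ?_
          by_cases hx : x ∈ Metric.closedBall (0 : Pt d) R
          · rw [radialCutoff_eq_one (mem_closedBall_zero_iff.1 hx)]
            simp [hx]
          · simp [hx]
      _ = ENNReal.ofReal (L (radialCutoff R)) := by
          rw [← hint _ hc hs, ofReal_integral_eq_lintegral_ofReal
            (hc.integrable_of_hasCompactSupport hs)
            (Eventually.of_forall (radialCutoff_nonneg R))]
      _ ≤ ENNReal.ofReal B := by
          refine ENNReal.ofReal_le_ofReal (le_of_tendsto' (hL _ hc hs) fun n => ?_)
          refine le_trans ?_ (hB n)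
          calc ∫ x, radialCutoff R x ∂(μ n) ≤ ∫ x, (1 : ℝ) ∂(μ n) :=
                integral_mono (integrable_of_continuous_of_bound hc (hs.exists_abs_le hc))
                  (integrable_const _) (radialCutoff_le_one R)
            _ = (μ n).real Set.univ := by simp
  have hmono : Monotone fun R : ℕ => Metric.closedBall (0 : Pt d) R := fun R S hRS =>
    Metric.closedBall_subset_closedBall (by exact_mod_cast hRS)
  rw [← Metric.iUnion_closedBall_nat (0 : Pt d), hmono.measure_iUnion]
  exact (iSup_le hball).trans_lt ENNReal.ofReal_lt_top

/-- A family of finite measures is measurable as soon as the integrals of compactly supported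
continuous functions are. -/
theorem measurable_measure_of_measurable_integral {Ω : Type*} [MeasurableSpace Ω]
    (M : Ω → Measure (Pt d)) [∀ ω, IsFiniteMeasure (M ω)]
    (hM : ∀ ψ : Pt d → ℝ, Continuous ψ → HasCompactSupport ψ →
      Measurable fun ω => ∫ x, ψ x ∂(M ω)) :
    Measurable M := by
  have hclosed : ∀ F : Set (Pt d), IsClosed F → Measurable fun ω => M ω F := by
    intro F hF
    have h1 : Measurable fun ω => (M ω).real F := by
      refine measurable_of_tendsto_metrizable
        (f := fun k ω => ∫ x, radialCutoff k x * (hF.apprSeq k x : ℝ) ∂(M ω)) (fun k => ?_) ?_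
      · exact hM _ ((continuous_radialCutoff k).mul
          (NNReal.continuous_coe.comp (hF.apprSeq k).continuous))
          ((hasCompactSupport_radialCutoff k).mul_right)
      · rw [tendsto_pi_nhds]
        intro ω
        have e : (M ω).real F = ∫ x, F.indicator (fun _ => (1 : ℝ)) x ∂(M ω) := by
          rw [integral_indicator hF.measurableSet]
          simp
        rw [e]
        refine tendsto_integral_of_dominated_convergence (fun _ => 1) (fun k => ?_)
          (integrable_const _) (fun k => Eventually.of_forall fun x => ?_)
          (Eventually.of_forall fun x => ?_)
        · exact ((continuous_radialCutoff k).mul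
            (NNReal.continuous_coe.comp (hF.apprSeq k).continuous)).aestronglyMeasurable
        · rw [Real.norm_of_nonneg (mul_nonneg (radialCutoff_nonneg _ _) (NNReal.coe_nonneg _))]
          exact mul_le_one₀ (radialCutoff_le_one _ _) (NNReal.coe_nonneg _)
            (by exact_mod_cast HasOuterApproxClosed.apprSeq_apply_le_one hF k x)
        · have h2 := (tendsto_pi_nhds.1 (HasOuterApproxClosed.tendsto_apprSeq hF) x)
          have h3 := (NNReal.continuous_coe.tendsto _).comp h2
          have h4 := (tendsto_radialCutoff x).mul h3
          rw [one_mul] at h4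
          have h5 : F.indicator (fun _ => (1 : ℝ)) x =
              ((F.indicator (fun _ => (1 : ℝ≥0)) x : ℝ≥0) : ℝ) := by
            by_cases hx : x ∈ F
            · rw [Set.indicator_of_mem hx, Set.indicator_of_mem hx, NNReal.coe_one]
            · rw [Set.indicator_of_notMem hx, Set.indicator_of_notMem hx, NNReal.coe_zero]
          rw [h5]
          exact h4
    have e : (fun ω => M ω F) = fun ω => ENNReal.ofReal ((M ω).real F) :=
      funext fun ω => (ofReal_measureReal (measure_ne_top _ _)).symm
    rw [e]
    exact h1.ennreal_ofReal
  refine Measurable.measure_of_isPiSystem (S := {s | IsClosed s}) ?_ isPiSystem_isClosed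
    (fun s hs => hclosed s hs) (hclosed _ isClosed_univ)
  rw [BorelSpace.measurable_eq (α := Pt d), borel_eq_generateFrom_isClosed]

/-- A countable family of fields converging in mean along the scales converges almost surely along
a common sequence of scales. -/
theorem exists_seq_forall_ae_tendsto {Ω : Type*} [MeasurableSpace Ω] {P : Measure Ω}
    {F : ℕ → Scale → Ω → ℝ} {J : ℕ → Ω → ℝ} (hF : ∀ j ε, Integrable (F j ε) P)
    (hJ : ∀ j, Integrable (J j) P)
    (hlim : ∀ j, Tendsto (fun ε => ∫ ω, |F j ε ω - J j ω| ∂P) smallScale (𝓝 0)) :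
    ∃ ns : ℕ → Scale, Tendsto ns atTop smallScale ∧
      ∀ᵐ ω ∂P, ∀ j, Tendsto (fun n => F j (ns n) ω) atTop (𝓝 (J j ω)) := by
  obtain ⟨u, hu⟩ := exists_seq_tendsto smallScale
  obtain ⟨κ, hκ, hP⟩ := extraction_forall_of_eventually
    (P := fun n k => ∀ j ∈ Finset.range (n + 1), ∫ ω, |F j (u k) ω - J j ω| ∂P ≤ (1 / 2) ^ n)
    fun n => (Filter.eventually_all_finset _).2 fun j _ =>
      ((hlim j).comp hu).eventually_le_const (by positivity)
  refine ⟨u ∘ κ, hu.comp hκ.tendsto_atTop, ae_all_iff.2 fun j => ?_⟩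
  have hsum : Summable fun n => ∫ ω, |F j (u (κ n)) ω - J j ω| ∂P := by
    refine Summable.of_norm_bounded_eventually_nat (g := fun n => (1 / 2 : ℝ) ^ n)
      (summable_geometric_of_lt_one (by norm_num) (by norm_num)) ?_
    filter_upwards [eventually_ge_atTop j] with n hn
    rw [Real.norm_of_nonneg (integral_nonneg fun _ => abs_nonneg _)]
    exact hP n j (Finset.mem_range.2 (Nat.lt_succ_of_le hn))
  have hi : ∀ n, Integrable (fun ω => F j (u (κ n)) ω - J j ω) P := fun n => (hF j _).sub (hJ j)
  have h := summable_norm_of_tsum_eLpNorm_ne_top (μ := P) le_rfl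
    (fun n => (hi n).aestronglyMeasurable) (by
      have e : ∀ n, eLpNorm (fun ω => F j (u (κ n)) ω - J j ω) 1 P =
          ENNReal.ofReal (∫ ω, |F j (u (κ n)) ω - J j ω| ∂P) := fun n => by
        rw [eLpNorm_one_eq_lintegral_enorm, ← ofReal_integral_norm_eq_lintegral_enorm (hi n)]
        rfl
      simp only [e]
      exact hsum.tsum_ofReal_ne_top)
  filter_upwards [h] with ω hω
  exact tendsto_iff_norm_sub_tendsto_zero.2 hω.tendsto_atTop_zero

namespace IsLogField

variable {Ω : Type*} [MeasurableSpace Ω] {P : Measure Ω} {X : Scale × Pt d → Ω → ℝ}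
  {C : Scale × Pt d → Scale × Pt d → ℝ} {G : Scale → Pt d → Pt d → ℝ}
  {K : Pt d → Pt d → ℝ} {c₀ γ : ℝ}

theorem measurable_chaosInt (H : IsLogField P X C G K c₀) {h : Pt d → ℝ} (hm : Measurable h)
    (ε : Scale) : Measurable (chaosInt γ X C h ε) := by
  have h1 : Measurable fun p : Pt d × Ω => h p.1 * dens γ X C ε p.1 p.2 :=
    (hm.comp measurable_fst).mul (H.measurable_dens ε)
  exact (h1.stronglyMeasurable.integral_prod_left' (μ := volume)).measurable

/-- **The subcritical chaos measure**: the random measure obtained as the limit of the approximate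
chaos. -/
theorem exists_chaosMeasure [IsProbabilityMeasure P] (H : IsLogField P X C G K c₀) (hd : 1 ≤ d)
    (hγ : 0 < γ) (hγd : γ ^ 2 / 2 < d) {h : Pt d → ℝ} (hh : Integrable h) (hm : Measurable h)
    (h0 : ∀ x, 0 ≤ h x) :
    ∃ M : Ω → Measure (Pt d), Measurable M ∧ (∀ ω, IsFiniteMeasure (M ω)) ∧
      ∀ ψ : Pt d → ℝ, Continuous ψ → HasCompactSupport ψ →
        TendstoInMeasure P (fun ε => chaosInt γ X C (fun x => ψ x * h x) ε) smallScale
          (fun ω => ∫ x, ψ x ∂(M ω)) ∧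
        ((∀ x, 0 ≤ ψ x) → 0 < ∫ x, ψ x * h x → ∀ᵐ ω ∂P, 0 < ∫ x, ψ x ∂(M ω)) := by
  obtain ⟨φ, hφc, hφb, hφ0, hφd⟩ := exists_seq_uniformly_dense (d := d)
  have hint : ∀ ψ : Pt d → ℝ, Continuous ψ → (∃ B, ∀ x, |ψ x| ≤ B) →
      Integrable fun x => ψ x * h x := by
    rintro ψ hψ ⟨B, hB⟩
    exact hh.bdd_mul (c := B) hψ.aestronglyMeasurable (Eventually.of_forall hB)
  have hJex : ∀ ψ : Pt d → ℝ, Continuous ψ → (∃ B, ∀ x, |ψ x| ≤ B) → ∃ J : Ω → ℝ,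
      Measurable J ∧ Integrable J P ∧ Tendsto (fun ε =>
        ∫ ω, |chaosInt γ X C (fun x => ψ x * h x) ε ω - J ω| ∂P) smallScale (𝓝 0) :=
    fun ψ hψ hb => H.exists_tendsto_integral_abs_chaosInt_sub hd hγ hγd (hint ψ hψ hb)
  choose J hJm hJi hJlim using fun j => hJex (φ j) (hφc j) (hφb j)
  obtain ⟨ns, hns, hae⟩ := exists_seq_forall_ae_tendsto
    (fun j ε => H.integrable_chaosInt (hint (φ j) (hφc j) (hφb j)) ε) hJi hJlim
  let μ : ℕ → Ω → Measure (Pt d) := fun n ω =>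
    volume.withDensity fun x => ENNReal.ofReal (h x * dens γ X C (ns n) x ω)
  have hdm : ∀ n ω, Measurable fun x => ENNReal.ofReal (h x * dens γ X C (ns n) x ω) :=
    fun n ω => (hm.mul (H.measurable_dens_left _ ω)).ennreal_ofReal
  have hμint : ∀ n ω (ψ : Pt d → ℝ), ∫ x, ψ x ∂(μ n ω) =
      chaosInt γ X C (fun x => ψ x * h x) (ns n) ω := by
    intro n ω ψ
    rw [integral_withDensity_eq_integral_toReal_smul (hdm n ω)
      (Eventually.of_forall fun _ => ENNReal.ofReal_lt_top), chaosInt]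
    refine integral_congr_ae (Eventually.of_forall fun x => ?_)
    simp only [smul_eq_mul]
    rw [ENNReal.toReal_ofReal (mul_nonneg (h0 x) (dens_pos γ X C _ x ω).le)]
    ring
  have hgood : ∀ᵐ ω ∂P, ∃ M : Measure (Pt d), IsFiniteMeasure M ∧ ∀ ψ : Pt d → ℝ, Continuous ψ →
      HasCompactSupport ψ → Tendsto (fun n => chaosInt γ X C (fun x => ψ x * h x) (ns n) ω) atTop
        (𝓝 (∫ x, ψ x ∂M)) := by
    filter_upwards [hae, ae_all_iff.2 fun n => H.ae_integrable_dens (γ := γ) hh (ns n)]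
      with ω hω hω'
    have : ∀ n, IsFiniteMeasure (μ n ω) := fun n => by
      refine isFiniteMeasure_withDensity_ofReal (hω' n).2
    simp only [← hμint] at hω ⊢
    exact exists_measure_tendsto_integral hφc hφb hφ0 hφd (fun n => μ n ω) fun j => ⟨_, hω j⟩
  set S : Set Ω := (toMeasurable P {ω | ¬ ∃ M : Measure (Pt d), IsFiniteMeasure M ∧
    ∀ ψ : Pt d → ℝ, Continuous ψ → HasCompactSupport ψ →
      Tendsto (fun n => chaosInt γ X C (fun x => ψ x * h x) (ns n) ω) atTop
        (𝓝 (∫ x, ψ x ∂M))})ᶜ with hS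
  have hSm : MeasurableSet S := (measurableSet_toMeasurable _ _).compl
  have hSae : ∀ᵐ ω ∂P, ω ∈ S := by
    rw [ae_iff]
    simp only [hS, Set.mem_compl_iff, not_not]
    exact (measure_toMeasurable _).trans hgood
  have hSM : ∀ ω, ∃ M : Measure (Pt d), IsFiniteMeasure M ∧ ∀ ψ : Pt d → ℝ, Continuous ψ →
      HasCompactSupport ψ → Tendsto (fun n => S.indicator
        (fun ω => chaosInt γ X C (fun x => ψ x * h x) (ns n) ω) ω) atTop (𝓝 (∫ x, ψ x ∂M)) := by
    intro ω
    by_cases hω : ω ∈ S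
    · simp only [Set.indicator_of_mem hω]
      by_contra hneg
      exact hω (subset_toMeasurable _ _ hneg)
    · refine ⟨0, inferInstance, fun ψ _ _ => ?_⟩
      simp [Set.indicator_of_notMem hω]
  choose M hMfin hM using hSM
  refine ⟨M, measurable_measure_of_measurable_integral M fun ψ hψ hs => ?_, hMfin,
    fun ψ hψ hs => ?_⟩
  · exact measurable_of_tendsto_metrizable
      (fun n => (H.measurable_chaosInt (hψ.measurable.mul hm) (ns n)).indicator hSm)
      (tendsto_pi_nhds.2 fun ω => hM ω ψ hψ hs)
  · have hi := hint ψ hψ (hs.exists_abs_le hψ)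
    obtain ⟨Jψ, hJψm, hJψi, hJψ⟩ := hJex ψ hψ (hs.exists_abs_le hψ)
    have hlim := tendstoInMeasure_of_tendsto_integral_abs
      (fun ε => H.integrable_chaosInt hi ε) hJψi hJψ
    have hlimM : TendstoInMeasure P
        (fun n => chaosInt γ X C (fun x => ψ x * h x) (ns n)) atTop fun ω => ∫ x, ψ x ∂(M ω) := by
      refine tendstoInMeasure_of_tendsto_ae
        (fun n => (H.integrable_chaosInt hi _).aestronglyMeasurable) ?_
      filter_upwards [hSae] with ω hω
      simpa only [Set.indicator_of_mem hω] using hM ω ψ hψ hs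
    have heq : Jψ =ᵐ[P] fun ω => ∫ x, ψ x ∂(M ω) :=
      tendstoInMeasure_ae_unique (hlim.comp hns) hlimM
    refine ⟨hlim.congr_right heq, fun hψ0 hpos => ?_⟩
    filter_upwards [heq, H.ae_pos_of_tendsto hi (hψ.measurable.mul hm)
      (fun x => mul_nonneg (hψ0 x) (h0 x)) hpos hJψm hJψi hJψ] with ω h1 h2
    exact h1 ▸ h2

end IsLogField

theorem abs_half_add_le {a b c : ℝ} (ha : |a| ≤ c) (hb : |b| ≤ c) : |(a + b) / 2| ≤ c := by
  rw [abs_le] at *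
  constructor <;> linarith [ha.1, ha.2, hb.1, hb.2]

theorem mollifiedCov_symmetrized {g : Pt d → Pt d → ℝ} {θ : Pt d → ℝ} {R B c : ℝ}
    (h : MollifierBound θ R B) (hd : 1 ≤ d) (hg : Measurable (Function.uncurry g))
    (hgc : ∀ x y, |g x y| ≤ c) {ε ε' : ℝ} (hε : 0 < ε) (hε' : 0 < ε') (x y : Pt d) :
    mollifiedCov (logKernel fun a b => (g a b + g b a) / 2) θ θ ε ε' x y =
      (mollifiedCov (logKernel g) θ θ ε ε' x y + mollifiedCov (logKernel g) θ θ ε' ε y x) / 2 := by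
  have hg' : Measurable (Function.uncurry fun a b => g b a) := hg.comp measurable_swap
  have hgs : Measurable (Function.uncurry fun a b => (g a b + g b a) / 2) :=
    (hg.add hg').div_const 2
  have hgsc : ∀ x y, |(g x y + g y x) / 2| ≤ c := fun x y => abs_half_add_le (hgc x y) (hgc y x)
  rw [mollifiedCov_swap h hd hg hgc hε hε', mollifiedCov_eq_prod h hd hgs hgsc hε hε',
    mollifiedCov_eq_prod h hd hg hgc hε hε',
    mollifiedCov_eq_prod h hd hg' (fun x y => hgc y x) hε hε',
    ← integral_add (integrable_mollified_logKernel h hd hg hgc hε hε' x y)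
      (integrable_mollified_logKernel h hd hg' (fun x y => hgc y x) hε hε' x y), ← integral_div]
  refine integral_congr_ae (Eventually.of_forall fun p => ?_)
  simp only [logKernel_eq]
  ring

/-- Only the symmetric part of the covariance kernel matters, so that every field of the statement
is a log-correlated field with a symmetric covariance which agrees on the diagonal. -/
theorem IsGaussianFamily.exists_isLogField {g : Pt d → Pt d → ℝ} {θ : Pt d → ℝ} {Ω : Type*}
    [MeasurableSpace Ω] {P : Measure Ω} {X : ℝ → Pt d → Ω → ℝ}
    (hX : IsGaussianFamily P X (mollifiedCov (logKernel g) θ θ)) (hd : 1 ≤ d)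
    (hg : IsBoundedMeasurable g) (hθ : IsMollifier θ) :
    ∃ C G K c₀, IsLogField P (fun t : Scale × Pt d => X t.1 t.2) C G K c₀ ∧
      ∀ ε x, C (ε, x) (ε, x) = mollifiedCov (logKernel g) θ θ ε ε x x := by
  obtain ⟨hgm, c, hgc⟩ := hg
  obtain ⟨R, B, h⟩ := hθ.exists_bound
  have hgs : Measurable (Function.uncurry fun a b => (g a b + g b a) / 2) :=
    (hgm.add (hgm.comp measurable_swap)).div_const 2
  have hgsc : ∀ x y, |(g x y + g y x) / 2| ≤ c := fun x y => abs_half_add_le (hgc x y) (hgc y x)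
  obtain ⟨c₀, hc₀⟩ := isLogCov_mollifiedCov h hd hgs hgsc
  have hsym := fun s t : Scale × Pt d =>
    mollifiedCov_symmetrized h hd hgm hgc s.1.2.1 t.1.2.1 s.2 t.2
  refine ⟨_, _, _, c₀, ⟨fun ε => ?_, ⟨fun t => ?_, fun s t => ?_, fun n t l => ?_⟩, hc₀⟩,
    fun ε x => ?_⟩
  · exact hX.1.comp ((measurable_const (a := (ε : ℝ))).prodMk measurable_id)
  · exact hX.1.comp (measurable_const.prodMk (measurable_const.prodMk measurable_id))
  · simp only [hsym, add_comm]
  · obtain ⟨v, hv, hm⟩ := hX.2 n (fun i => (t i).1) (fun i => (t i).2) (fun i => (t i).1.2) l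
    refine ⟨v, ?_, hm⟩
    have hswap : ∑ i, ∑ j, l i * l j *
        mollifiedCov (logKernel g) θ θ (t j).1 (t i).1 (t j).2 (t i).2 = v := by
      rw [hv, Finset.sum_comm]
      refine Finset.sum_congr rfl fun i _ => Finset.sum_congr rfl fun j _ => ?_
      rw [mul_comm (l j)]
    have hhalf : (v : ℝ) = (v + v) / 2 := by ring
    rw [hhalf]
    nth_rewrite 1 [hv]
    rw [← hswap, ← Finset.sum_add_distrib, Finset.sum_div]
    refine Finset.sum_congr rfl fun i _ => ?_
    rw [← Finset.sum_add_distrib, Finset.sum_div]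
    refine Finset.sum_congr rfl fun j _ => ?_
    rw [hsym]
    ring
  · rw [hsym]
    ring

theorem tendstoInMeasure_nhdsWithin_Ioc_iff {Ω : Type*} [MeasurableSpace Ω] {P : Measure Ω}
    {F : ℝ → Ω → ℝ} {Z : Ω → ℝ} :
    TendstoInMeasure P F (𝓝[Set.Ioc (0 : ℝ) 1] 0) Z ↔
      TendstoInMeasure P (fun ε : Scale => F ε) smallScale Z := by
  simp only [TendstoInMeasure, ← map_smallScale, tendsto_map'_iff]
  rfl

theorem exists_bump_integral_pos {D : Set (Pt d)} (hD : IsOpen D) (hDne : D.Nonempty)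
    {f : Pt d → ℝ} (hf0 : ∀ x, 0 ≤ f x) (hfint : IntegrableOn f D)
    (hpos : ∀ᵐ x ∂(volume.restrict D), 0 < f x) :
    ∃ ψ : Pt d → ℝ, Continuous ψ ∧ HasCompactSupport ψ ∧ tsupport ψ ⊆ D ∧ (∀ x, 0 ≤ ψ x) ∧
      0 < ∫ x, ψ x * D.indicator f x := by
  obtain ⟨z, hz⟩ := hDne
  obtain ⟨r, hr, hrD⟩ := Metric.isOpen_iff.1 hD z hz
  let b : ContDiffBump z := ⟨r / 4, r / 2, by positivity, by linarith⟩
  refine ⟨b, b.continuous, b.hasCompactSupport, ?_, fun x => b.nonneg, ?_⟩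
  · rw [b.tsupport_eq]
    exact (Metric.closedBall_subset_ball (by change r / 2 < r; linarith)).trans hrD
  have hint : Integrable fun x => b x * D.indicator f x :=
    ((integrable_indicator_iff hD.measurableSet).2 hfint).bdd_mul (c := 1)
      b.continuous.aestronglyMeasurable
      (Eventually.of_forall fun x => by
        rw [Real.norm_of_nonneg b.nonneg]; exact b.le_one)
  rw [integral_pos_iff_support_of_nonneg
    (fun x => mul_nonneg b.nonneg (Set.indicator_nonneg (fun x _ => hf0 x) x)) hint]
  refine (Metric.measure_ball_pos volume z (by positivity : 0 < r / 2)).trans_le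
    (measure_mono_ae ?_)
  filter_upwards [(ae_restrict_iff' hD.measurableSet).1 hpos] with x hx hxb
  have hxD : x ∈ D := hrD (Metric.ball_subset_ball (by linarith) hxb)
  change b x * D.indicator f x ≠ 0
  rw [Set.indicator_of_mem hxD]
  exact (mul_pos (b.pos_of_mem_ball hxb) (hx hxD)).ne'

/-- **Existence of Gaussian multiplicative chaos.** Let `D ⊆ ℝ^d` be nonempty open and
`f : D → [0,∞)` Lebesgue-integrable. There is a random Radon measure `M` on `D` (a measurable
map `Ω → Measure`, supported in `D` and finite on compact subsets of `D`) such that for every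
continuous compactly supported `φ` with support in `D`, `∫ φ dM_ε → ∫ φ dM` in probability as
`ε → 0`. Moreover, if `f > 0` a.e. on `D`, then `M ≠ 0` a.s. when `0 < γ < √(2d)` while
`M = 0` a.s. when `γ ≥ √(2d)`. -/
theorem gmc_existence (hd : 1 ≤ d)
    (g : EuclideanSpace ℝ (Fin d) → EuclideanSpace ℝ (Fin d) → ℝ) (hg : IsBoundedMeasurable g)
    (θ : EuclideanSpace ℝ (Fin d) → ℝ) (hθ : IsMollifier θ)
    {Ω : Type*} [MeasurableSpace Ω] (P : Measure Ω) [IsProbabilityMeasure P]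
    (X : ℝ → EuclideanSpace ℝ (Fin d) → Ω → ℝ)
    (hX : IsGaussianFamily P X (mollifiedCov (logKernel g) θ θ))
    (γ : ℝ) (hγ : 0 < γ)
    (D : Set (EuclideanSpace ℝ (Fin d))) (hD : IsOpen D) (hDne : D.Nonempty)
    (f : EuclideanSpace ℝ (Fin d) → ℝ) (hf0 : ∀ x, 0 ≤ f x) (hfmeas : Measurable f)
    (hfint : IntegrableOn f D) :
    ∃ M : Ω → Measure (EuclideanSpace ℝ (Fin d)),
      (∀ A : Set (EuclideanSpace ℝ (Fin d)), MeasurableSet A → Measurable fun ω => M ω A) ∧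
      (∀ ω, M ω Dᶜ = 0) ∧
      (∀ ω, ∀ A : Set (EuclideanSpace ℝ (Fin d)), IsCompact A → A ⊆ D → M ω A ≠ ⊤) ∧
      (∀ φ : EuclideanSpace ℝ (Fin d) → ℝ, Continuous φ → HasCompactSupport φ →
        tsupport φ ⊆ D →
        TendstoInMeasure P
          (fun ε ω => ∫ x in D,
            φ x * Real.exp (γ * X ε x ω -
              γ ^ 2 / 2 * mollifiedCov (logKernel g) θ θ ε ε x x) * f x)
          (𝓝[Set.Ioc (0 : ℝ) 1] 0)
          (fun ω => ∫ x, φ x ∂(M ω))) ∧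
      ((∀ᵐ x ∂(volume.restrict D), 0 < f x) →
        (γ < Real.sqrt (2 * d) → ∀ᵐ ω ∂P, M ω ≠ 0) ∧
        (Real.sqrt (2 * d) ≤ γ → ∀ᵐ ω ∂P, M ω = 0)) := by
  obtain ⟨C, G, K, c₀, H, hdiag⟩ := hX.exists_isLogField hd hg hθ
  have hh : Integrable (D.indicator f) := (integrable_indicator_iff hD.measurableSet).2 hfint
  have hchaos : ∀ (φ : Pt d → ℝ) (ε : Scale) ω, (∫ x in D, φ x * Real.exp (γ * X ε x ω -
      γ ^ 2 / 2 * mollifiedCov (logKernel g) θ θ ε ε x x) * f x) =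
      chaosInt γ (fun t : Scale × Pt d => X t.1 t.2) C (fun x => φ x * D.indicator f x) ε ω := by
    intro φ ε ω
    rw [chaosInt, ← integral_indicator hD.measurableSet]
    refine integral_congr_ae (Eventually.of_forall fun x => ?_)
    by_cases hx : x ∈ D
    · simp only [Set.indicator_of_mem hx, dens, hdiag]
      ring
    · simp [Set.indicator_of_notMem hx]
  simp only [tendstoInMeasure_nhdsWithin_Ioc_iff, hchaos]
  rcases lt_or_ge γ (Real.sqrt (2 * d)) with hlt | hge
  · have hγd : γ ^ 2 / 2 < d := by
      have := (Real.lt_sqrt hγ.le).1 hlt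
      linarith
    obtain ⟨M, hMm, hMf, hM⟩ := H.exists_chaosMeasure hd hγ hγd hh
      (hfmeas.indicator hD.measurableSet) (Set.indicator_nonneg fun x _ => hf0 x)
    have hres : ∀ φ : Pt d → ℝ, tsupport φ ⊆ D → ∀ ω,
        ∫ x, φ x ∂((M ω).restrict D) = ∫ x, φ x ∂(M ω) := fun φ hφ ω =>
      setIntegral_eq_integral_of_forall_compl_eq_zero fun x hx =>
        image_eq_zero_of_notMem_tsupport fun hx' => hx (hφ hx')
    refine ⟨fun ω => (M ω).restrict D, fun A hA => ?_, fun ω => ?_, fun ω A _ _ => ?_,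
      fun φ hφ hs hsD => ?_, fun hpos => ⟨fun _ => ?_, fun h => absurd hlt h.not_gt⟩⟩
    · simp only [Measure.restrict_apply hA]
      exact (Measure.measurable_coe (hA.inter hD.measurableSet)).comp hMm
    · simp [Measure.restrict_apply hD.measurableSet.compl]
    · have := hMf ω
      exact measure_ne_top _ _
    · simp only [hres φ hsD]
      exact (hM φ hφ hs).1
    · obtain ⟨ψ, hψ, hs, hsD, hψ0, hψpos⟩ := exists_bump_integral_pos hD hDne hf0 hfint hpos
      filter_upwards [(hM ψ hψ hs).2 hψ0 hψpos] with ω hω h0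
      rw [← hres ψ hsD, h0, integral_zero_measure] at hω
      exact hω.false
  · have hγd : (d : ℝ) ≤ γ ^ 2 / 2 := by
      have := (Real.sqrt_le_left hγ.le).1 hge
      linarith
    refine ⟨fun _ => 0, fun A _ => measurable_const, fun _ => rfl, fun _ A _ _ => by simp,
      fun φ hφ hs _ => ?_, fun _ => ⟨fun h => absurd hge h.not_ge, fun _ => by simp⟩⟩
    obtain ⟨b, hb⟩ := hs.exists_abs_le hφ
    simp only [integral_zero_measure]
    exact H.tendstoInMeasure_chaosInt_zero hγ hγd
      (hh.bdd_mul hφ.aestronglyMeasurable (Eventually.of_forall hb))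

end
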